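/- arXiv:1907.00351 — 4 statements merged into one kernel-verified Lean document; each statement's English description precedes it below -/
import Mathlib

section
/- Every orientation of any planar graph on at most 7 vertices admits an acyclic 2-colouring. -/
def AcyclicOn {V : Type*} (A : V → V → Prop) (X : Set V) : Prop :=
  ∀ v ∈ X, ¬ Relation.TransGen (fun a b => a ∈ X ∧ b ∈ X ∧ A a b) v v

def IsAcyclicColoring {V : Type*} (A : V → V → Prop) (k : ℕ) (c : V → Fin k) : Prop :=
  ∀ i : Fin k, AcyclicOn A {v | c v = i}

def IsOrientation {V : Type*} (G : SimpleGraph V) (A : V → V → Prop) : Prop :=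
  (∀ a b, A a b → ¬ A b a) ∧ (∀ a b, G.Adj a b ↔ (A a b ∨ A b a))

def SimpleGraph.IsMinor {W V : Type*} (H : SimpleGraph W) (G : SimpleGraph V) : Prop :=
  ∃ f : W → Set V, (∀ w, (f w).Nonempty) ∧ (∀ w, (G.induce (f w)).Connected) ∧
    (Pairwise fun w w' => Disjoint (f w) (f w')) ∧
    ∀ ⦃w w'⦄, H.Adj w w' → ∃ u ∈ f w, ∃ v ∈ f w', G.Adj u v

def SimpleGraph.Planar {V : Type*} (G : SimpleGraph V) : Prop :=
  ¬ (completeGraph (Fin 5)).IsMinor G ∧ ¬ (completeBipartiteGraph (Fin 3) (Fin 3)).IsMinor G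

def IsPlanarTriangulation {V : Type*} [Finite V] (G : SimpleGraph V) : Prop :=
  3 ≤ Nat.card V ∧ G.Planar ∧ ∀ H : SimpleGraph V, G ≤ H → H.Planar → H = G

def IsTriangle {V : Type*} (G : SimpleGraph V) (a b c : V) : Prop :=
  G.Adj a b ∧ G.Adj a c ∧ G.Adj b c

def IsFacialTriangle {V : Type*} (G : SimpleGraph V) (a b c : V) : Prop :=
  IsTriangle G a b c ∧ (G.induce {v | v ≠ a ∧ v ≠ b ∧ v ≠ c}).Preconnected

def IsSeparatingTriangle {V : Type*} (G : SimpleGraph V) (a b c : V) : Prop :=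
  IsTriangle G a b c ∧ ¬ (G.induce {v | v ≠ a ∧ v ≠ b ∧ v ≠ c}).Preconnected

def FourConnected {V : Type*} [Finite V] (G : SimpleGraph V) : Prop :=
  5 ≤ Nat.card V ∧ ∀ S : Set V, Nat.card S ≤ 3 → (G.induce Sᶜ).Connected

namespace SmallPlanar

variable {V : Type}

lemma AcyclicOn.mono {A : V → V → Prop} {X Y : Set V} (h : AcyclicOn A Y) (hXY : X ⊆ Y) :
    AcyclicOn A X := fun v hv ht =>
  h v (hXY hv) (Relation.TransGen.mono (fun _ _ hab => ⟨hXY hab.1, hXY hab.2.1, hab.2.2⟩) _ _ ht)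

lemma acyclicOn_empty (A : V → V → Prop) : AcyclicOn A ∅ := fun _ hv => hv.elim

/-- Adding a source keeps a set acyclic. -/
lemma acyclicOn_insert_source {A : V → V → Prop} {X : Set V} (h : AcyclicOn A X) {v : V}
    (hv : ∀ u ∈ insert v X, ¬ A u v) : AcyclicOn A (insert v X) := by
  have key : ∀ a b, Relation.TransGen
      (fun a b => a ∈ insert v X ∧ b ∈ insert v X ∧ A a b) a b → b ≠ v ∧
      (a ≠ v → Relation.TransGen (fun a b => a ∈ X ∧ b ∈ X ∧ A a b) a b) := by
    intro a b hab
    induction hab with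
    | single h1 =>
      obtain ⟨ha, hb, hA⟩ := h1
      have hb' : _ ≠ v := fun e => hv _ ha (e ▸ hA)
      exact ⟨hb', fun ha' => .single ⟨ha.resolve_left ha', hb.resolve_left hb', hA⟩⟩
    | tail _ h1 ih =>
      obtain ⟨ha, hb, hA⟩ := h1
      have hb' : _ ≠ v := fun e => hv _ ha (e ▸ hA)
      exact ⟨hb', fun ha' => (ih.2 ha').tail
        ⟨ha.resolve_left ih.1, hb.resolve_left hb', hA⟩⟩
  intro w hw ht
  have := key w w ht
  exact h w (hw.resolve_left this.1) (this.2 this.1)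

/-- Adding a sink keeps a set acyclic. -/
lemma acyclicOn_insert_sink {A : V → V → Prop} {X : Set V} (h : AcyclicOn A X) {v : V}
    (hv : ∀ u ∈ insert v X, ¬ A v u) : AcyclicOn A (insert v X) := by
  have key : ∀ a b, Relation.TransGen
      (fun a b => a ∈ insert v X ∧ b ∈ insert v X ∧ A a b) a b → a ≠ v ∧
      (b ≠ v → Relation.TransGen (fun a b => a ∈ X ∧ b ∈ X ∧ A a b) a b) := by
    intro a b hab
    induction hab using Relation.TransGen.head_induction_on with
    | single h1 =>
      obtain ⟨ha, hb, hA⟩ := h1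
      have ha' : _ ≠ v := fun e => hv _ hb (e ▸ hA)
      exact ⟨ha', fun hb' => .single ⟨ha.resolve_left ha', hb.resolve_left hb', hA⟩⟩
    | head h1 _ ih =>
      obtain ⟨ha, hb, hA⟩ := h1
      have ha' : _ ≠ v := fun e => hv _ hb (e ▸ hA)
      exact ⟨ha', fun hb' => .head
        ⟨ha.resolve_left ha', hb.resolve_left ih.1, hA⟩ (ih.2 hb')⟩
  intro w hw ht
  have := key w w ht
  exact h w (hw.resolve_left this.1) (this.2 this.1)

/-- Adding a vertex with at most one neighbour keeps a set acyclic. -/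
lemma acyclicOn_insert {G : SimpleGraph V} {A : V → V → Prop} (hA : IsOrientation G A)
    {X : Set V} (h : AcyclicOn A X) {v : V}
    (hv : ∀ u ∈ X, ∀ w ∈ X, G.Adj v u → G.Adj v w → u = w) : AcyclicOn A (insert v X) := by
  by_cases hs : ∀ u ∈ insert v X, ¬ A u v
  · exact acyclicOn_insert_source h hs
  · apply acyclicOn_insert_sink h
    push Not at hs
    obtain ⟨u, hu, huv⟩ := hs
    intro w hw hvw
    have irr : ∀ x, ¬ A x x := fun x hx => hA.1 x x hx hx
    have hu' : u ∈ X := hu.resolve_left fun e => irr v (e ▸ huv)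
    have hw' : w ∈ X := hw.resolve_left fun e => irr v (e ▸ hvw)
    have := hv u hu' w hw' ((hA.2 _ _).2 (.inr huv)) ((hA.2 _ _).2 (.inl hvw))
    subst this
    exact hA.1 _ _ huv hvw

/-- A path-like set of four vertices is acyclic. -/
lemma acyclicOn_four {G : SimpleGraph V} {A : V → V → Prop} (hA : IsOrientation G A)
    {p q r s : V} (h1 : ¬ G.Adj p r) (h2 : ¬ G.Adj p s) (h3 : ¬ G.Adj q s) :
    AcyclicOn A {p, q, r, s} := by
  refine acyclicOn_insert hA (acyclicOn_insert hA (acyclicOn_insert hA (v := r)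
    (X := {s}) ?_ ?_) ?_) ?_
  · rw [← insert_empty_eq]
    exact acyclicOn_insert hA (acyclicOn_empty A) (by simp)
  · simp
  · simp only [Set.mem_insert_iff, Set.mem_singleton_iff]; grind
  · simp only [Set.mem_insert_iff, Set.mem_singleton_iff]; grind

lemma acyclicOn_three {G : SimpleGraph V} {A : V → V → Prop} (hA : IsOrientation G A)
    {p q r : V} (h1 : ¬ G.Adj p r) : AcyclicOn A {p, q, r} := by
  refine acyclicOn_insert hA (acyclicOn_insert hA (v := q) (X := {r}) ?_ ?_) ?_
  · rw [← insert_empty_eq]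
    exact acyclicOn_insert hA (acyclicOn_empty A) (by simp)
  · simp
  · simp only [Set.mem_insert_iff, Set.mem_singleton_iff]; grind

lemma minor_of_pairs {W : Type*} {H : SimpleGraph W} {G : SimpleGraph V} (x y : W → V)
    (hc : ∀ w, x w = y w ∨ G.Adj (x w) (y w))
    (hd : ∀ w w', w ≠ w' → x w ≠ x w' ∧ x w ≠ y w' ∧ y w ≠ y w')
    (ha : ∀ w w', H.Adj w w' → G.Adj (x w) (x w') ∨ G.Adj (x w) (y w') ∨ G.Adj (y w) (x w') ∨
      G.Adj (y w) (y w')) : H.IsMinor G := by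
  refine ⟨fun w => {x w, y w}, fun w => ⟨x w, by simp⟩, fun w => ?_, fun w w' h => ?_,
    fun w w' h => ?_⟩
  · rcases hc w with h | h
    · simp only
      rw [h, Set.pair_eq_singleton]
      exact @SimpleGraph.Connected.mk _ _ (fun a b => by
        rw [Subsingleton.elim a b]) inferInstance
    · exact SimpleGraph.induce_pair_connected_of_adj h
  · have := hd w w' h
    have := hd w' w h.symm
    simp only [Set.disjoint_left, Set.mem_insert_iff, Set.mem_singleton_iff]
    grind
  · have := ha w w' h
    rcases this with h | h | h | h
    · exact ⟨_, by simp, _, by simp, h⟩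
    · exact ⟨_, by simp, _, by simp, h⟩
    · exact ⟨_, by simp, _, by simp, h⟩
    · exact ⟨_, by simp, _, by simp, h⟩

lemma k33_minor {G : SimpleGraph V} (x y a b p q r : V) (hxy : x = y ∨ G.Adj x y)
    (hd : [x, a, b, p, q, r].Nodup) (hd' : [y, a, b, p, q, r].Nodup)
    (h1 : G.Adj x p ∨ G.Adj y p) (h2 : G.Adj x q ∨ G.Adj y q) (h3 : G.Adj x r ∨ G.Adj y r)
    (h4 : G.Adj a p) (h5 : G.Adj a q) (h6 : G.Adj a r)
    (h7 : G.Adj b p) (h8 : G.Adj b q) (h9 : G.Adj b r) :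
    (completeBipartiteGraph (Fin 3) (Fin 3)).IsMinor G := by
  simp only [List.nodup_cons, List.mem_cons, List.not_mem_nil, not_or] at hd hd'
  have s := fun u v => G.adj_comm u v
  apply minor_of_pairs (Sum.elim ![x, a, b] ![p, q, r]) (Sum.elim ![y, a, b] ![p, q, r])
  · rintro (w | w) <;> fin_cases w <;> simp [hxy]
  · rintro (w | w) (w' | w') <;> fin_cases w <;> fin_cases w' <;> simp <;> grind
  · rintro (w | w) (w' | w') <;> fin_cases w <;> fin_cases w' <;> simp <;> grind

lemma k5_minor {G : SimpleGraph V} (x y a b c d : V) (hxy : x = y ∨ G.Adj x y)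
    (hd : [x, a, b, c, d].Nodup) (hd' : [y, a, b, c, d].Nodup)
    (h1 : G.Adj x a ∨ G.Adj y a) (h2 : G.Adj x b ∨ G.Adj y b) (h3 : G.Adj x c ∨ G.Adj y c)
    (h4 : G.Adj x d ∨ G.Adj y d) (h5 : G.Adj a b) (h6 : G.Adj a c) (h7 : G.Adj a d)
    (h8 : G.Adj b c) (h9 : G.Adj b d) (h10 : G.Adj c d) :
    (SimpleGraph.completeGraph (Fin 5)).IsMinor G := by
  simp only [List.nodup_cons, List.mem_cons, List.not_mem_nil, not_or] at hd hd'
  have s := fun u v => G.adj_comm u v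
  apply minor_of_pairs ![x, a, b, c, d] ![y, a, b, c, d]
  · intro w; fin_cases w <;> simp [hxy]
  · intro w w'; fin_cases w <;> fin_cases w' <;> simp <;> grind
  · intro w w'; fin_cases w <;> fin_cases w' <;> simp <;> grind


lemma card_sdiff_list [DecidableEq V] (S : Finset V) (l : List V) (hl : l.Nodup)
    (hS : ∀ x ∈ l, x ∈ S) : (S \ l.toFinset).card = S.card - l.length := by
  rw [Finset.card_sdiff_of_subset (by intro x; simpa using hS x), List.toFinset_card_of_nodup hl]

/-- A path of the complement of `G`, inside `S`. -/
def CoPath (G : SimpleGraph V) (S : Finset V) (l : List V) : Prop :=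
  l.Nodup ∧ (∀ x ∈ l, x ∈ S) ∧ l.IsChain (fun x y => ¬ G.Adj x y)

lemma pair_lemma [DecidableEq V] {G : SimpleGraph V} (T : Finset V) (hT : 2 ≤ T.card)
    (h : ∀ x ∈ T, ∀ y ∈ T, ∀ z ∈ T, [x, y, z].Nodup → ¬ G.Adj x y → G.Adj y z) :
    ∃ a ∈ T, ∃ b ∈ T, a ≠ b ∧ ∀ z ∈ T, z ≠ a → z ≠ b → G.Adj a z ∧ G.Adj b z := by
  have s := fun u v => G.adj_comm u v
  simp only [List.nodup_cons, List.mem_cons, List.not_mem_nil, not_or] at h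
  by_cases h2 : ∃ a ∈ T, ∃ b ∈ T, a ≠ b ∧ ¬ G.Adj a b
  · obtain ⟨a, ha, b, hb, hab, hn⟩ := h2
    refine ⟨a, ha, b, hb, hab, fun z hz hza hzb => ⟨?_, ?_⟩⟩
    · apply h b hb a ha z hz <;> grind
    · apply h a ha b hb z hz <;> grind
  · push Not at h2
    obtain ⟨a, ha, b, hb, hab⟩ := Finset.one_lt_card.1 hT
    exact ⟨a, ha, b, hb, hab, fun z hz hza hzb => ⟨h2 a ha z hz hza.symm, h2 b hb z hz hzb.symm⟩⟩

lemma seven [DecidableEq V] {G : SimpleGraph V} (S : Finset V) (hS : S.card = 7)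
    (hK : ¬ (completeBipartiteGraph (Fin 3) (Fin 3)).IsMinor G)
    (hdeg : ∀ v ∈ S, ∀ a ∈ S, ∀ b ∈ S, ∀ c ∈ S, [v, a, b, c].Nodup →
      ¬ G.Adj v a → ¬ G.Adj v b → G.Adj v c) :
    ∃ p q r s t u v, (∀ x ∈ S, x ∈ [p, q, r, s, t, u, v]) ∧ ¬ G.Adj p r ∧ ¬ G.Adj p s ∧
      ¬ G.Adj q s ∧ ¬ G.Adj t v := by
  have s := fun u v => G.adj_comm u v
  by_cases h7 : ∃ a0 a1 a2 a3 a4 a5 a6, CoPath G S [a0, a1, a2, a3, a4, a5, a6]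
  · obtain ⟨a0, a1, a2, a3, a4, a5, a6, hn, hm, hc⟩ := h7
    simp at hn hm hc
    refine (hK (k33_minor a0 a3 a1 a2 a4 a5 a6 (.inr (hdeg a3 ?_ a2 ?_ a4 ?_ a0 ?_ ?_ ?_ ?_).symm)
      ?_ ?_ (.inl (hdeg a4 ?_ a3 ?_ a5 ?_ a0 ?_ ?_ ?_ ?_).symm)
      (.inl (hdeg a5 ?_ a4 ?_ a6 ?_ a0 ?_ ?_ ?_ ?_).symm)
      (.inr (hdeg a3 ?_ a2 ?_ a4 ?_ a6 ?_ ?_ ?_ ?_))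
      (hdeg a1 ?_ a0 ?_ a2 ?_ a4 ?_ ?_ ?_ ?_) (hdeg a1 ?_ a0 ?_ a2 ?_ a5 ?_ ?_ ?_ ?_)
      (hdeg a1 ?_ a0 ?_ a2 ?_ a6 ?_ ?_ ?_ ?_) (hdeg a2 ?_ a1 ?_ a3 ?_ a4 ?_ ?_ ?_ ?_)
      (hdeg a2 ?_ a1 ?_ a3 ?_ a5 ?_ ?_ ?_ ?_) (hdeg a2 ?_ a1 ?_ a3 ?_ a6 ?_ ?_ ?_ ?_))).elim <;>
      clear hdeg <;> (try simp) <;> grind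
  by_cases h6 : ∃ a0 a1 a2 a3 a4 a5, CoPath G S [a0, a1, a2, a3, a4, a5]
  · obtain ⟨a0, a1, a2, a3, a4, a5, hp⟩ := h6
    have hr := card_sdiff_list S _ hp.1 hp.2.1
    rw [hS] at hr
    obtain ⟨b, hb⟩ := Finset.card_eq_one.1 hr
    have hb : b ∈ S \ [a0, a1, a2, a3, a4, a5].toFinset := by rw [hb]; simp
    obtain ⟨hn, hm, hc⟩ := hp
    have e1 : G.Adj a5 b := by
      by_contra h
      refine h7 ⟨a0, a1, a2, a3, a4, a5, b, ?_⟩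
      simp [CoPath] at hn hm hc hb ⊢
      grind
    clear h7
    simp at hn hm hc hb
    refine (hK (k33_minor a0 a2 a1 b a3 a4 a5 (.inr (hdeg a2 ?_ a1 ?_ a3 ?_ a0 ?_ ?_ ?_ ?_).symm)
      ?_ ?_ (.inl (hdeg a3 ?_ a2 ?_ a4 ?_ a0 ?_ ?_ ?_ ?_).symm)
      (.inl (hdeg a4 ?_ a3 ?_ a5 ?_ a0 ?_ ?_ ?_ ?_).symm)
      (.inr (hdeg a2 ?_ a1 ?_ a3 ?_ a5 ?_ ?_ ?_ ?_))
      (hdeg a1 ?_ a0 ?_ a2 ?_ a3 ?_ ?_ ?_ ?_) (hdeg a1 ?_ a0 ?_ a2 ?_ a4 ?_ ?_ ?_ ?_)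
      (hdeg a1 ?_ a0 ?_ a2 ?_ a5 ?_ ?_ ?_ ?_) (hdeg a3 ?_ a2 ?_ a4 ?_ b ?_ ?_ ?_ ?_).symm
      (hdeg a4 ?_ a3 ?_ a5 ?_ b ?_ ?_ ?_ ?_).symm e1.symm)).elim <;>
      clear hdeg <;> (try simp) <;> grind
  clear h7
  by_cases h5 : ∃ a0 a1 a2 a3 a4, CoPath G S [a0, a1, a2, a3, a4]
  · obtain ⟨a0, a1, a2, a3, a4, hp⟩ := h5
    have hr := card_sdiff_list S _ hp.1 hp.2.1
    rw [hS] at hr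
    obtain ⟨b, c, hbc, hr⟩ := Finset.card_eq_two.1 hr
    have hcov : ∀ x ∈ S, x ∈ [a3, a1, a4, a2, b, a0, c] := by
      intro x hx
      have : x ∈ S \ [a0, a1, a2, a3, a4].toFinset ↔ x ∈ ({b, c} : Finset V) := by rw [hr]
      simp [hx] at this ⊢
      clear hdeg h6
      grind
    have hb : b ∈ S \ [a0, a1, a2, a3, a4].toFinset := by rw [hr]; simp
    have hc' : c ∈ S \ [a0, a1, a2, a3, a4].toFinset := by rw [hr]; simp
    obtain ⟨hn, hm, hc⟩ := hp
    have ends : ∀ x ∈ S \ [a0, a1, a2, a3, a4].toFinset, G.Adj a0 x ∧ G.Adj a4 x := by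
      intro x hx
      constructor <;> by_contra h
      · refine h6 ⟨x, a0, a1, a2, a3, a4, ?_⟩
        rw [s] at h
        clear hdeg hcov hr hb hc' s
        simp [CoPath] at hn hm hc hx ⊢
        grind
      · refine h6 ⟨a0, a1, a2, a3, a4, x, ?_⟩
        clear hdeg hcov hr hb hc' s
        simp [CoPath] at hn hm hc hx ⊢
        grind
    have e0 := ends b hb
    have e1 := ends c hc'
    clear h6 ends hr
    simp at hn hm hc hb hc'
    by_cases h04 : G.Adj a0 a4
    · refine (hK (k33_minor a0 a0 a1 a2 a4 b c (.inl rfl)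
        ?_ ?_ (.inl h04) (.inl e0.1) (.inl e1.1)
        (hdeg a1 ?_ a0 ?_ a2 ?_ a4 ?_ ?_ ?_ ?_) (hdeg a1 ?_ a0 ?_ a2 ?_ b ?_ ?_ ?_ ?_)
        (hdeg a1 ?_ a0 ?_ a2 ?_ c ?_ ?_ ?_ ?_) (hdeg a2 ?_ a1 ?_ a3 ?_ a4 ?_ ?_ ?_ ?_)
        (hdeg a2 ?_ a1 ?_ a3 ?_ b ?_ ?_ ?_ ?_) (hdeg a2 ?_ a1 ?_ a3 ?_ c ?_ ?_ ?_ ?_))).elim <;>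
        clear hdeg <;> (try simp) <;> grind
    by_cases hbc' : G.Adj b c
    · refine (hK (k33_minor a0 a2 a1 b a3 a4 c (.inr (hdeg a2 ?_ a1 ?_ a3 ?_ a0 ?_ ?_ ?_ ?_).symm)
        ?_ ?_ (.inl (hdeg a3 ?_ a2 ?_ a4 ?_ a0 ?_ ?_ ?_ ?_).symm)
        (.inr (hdeg a2 ?_ a1 ?_ a3 ?_ a4 ?_ ?_ ?_ ?_)) (.inl e1.1)
        (hdeg a1 ?_ a0 ?_ a2 ?_ a3 ?_ ?_ ?_ ?_) (hdeg a1 ?_ a0 ?_ a2 ?_ a4 ?_ ?_ ?_ ?_)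
        (hdeg a1 ?_ a0 ?_ a2 ?_ c ?_ ?_ ?_ ?_) (hdeg a3 ?_ a2 ?_ a4 ?_ b ?_ ?_ ?_ ?_).symm
        e0.2.symm hbc')).elim <;>
        clear hdeg <;> (try simp) <;> grind
    exact ⟨a3, a1, a4, a2, b, a0, c, hcov, hc.2.2.2, fun h => hc.2.2.1 h.symm, hc.2.1, hbc'⟩
  clear h6
  by_cases h4 : ∃ a0 a1 a2 a3, CoPath G S [a0, a1, a2, a3]
  · obtain ⟨a0, a1, a2, a3, hp⟩ := h4
    have hr := card_sdiff_list S _ hp.1 hp.2.1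
    rw [hS] at hr
    obtain ⟨b, hb, c, hc', d, hd, h1, h2, h3⟩ := Finset.two_lt_card.1 (by rw [hr]; simp)
    obtain ⟨hn, hm, hc⟩ := hp
    have all : ∀ x ∈ S \ [a0, a1, a2, a3].toFinset, G.Adj a0 x ∧ G.Adj a1 x ∧ G.Adj a2 x := by
      intro x hx
      refine ⟨?_, ?_, ?_⟩
      · by_contra h
        refine h5 ⟨x, a0, a1, a2, a3, ?_⟩
        clear hdeg
        simp [CoPath] at hn hm hc hx ⊢
        grind
      · clear h5
        simp at hn hm hc hx
        apply hdeg a1 _ a0 _ a2 <;> (try simp) <;> grind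
      · clear h5
        simp at hn hm hc hx
        apply hdeg a2 _ a1 _ a3 <;> (try simp) <;> grind
    have e0 := all b hb
    have e1 := all c hc'
    have e2 := all d hd
    refine (hK (k33_minor a0 a0 a1 a2 b c d (.inl rfl)
        ?_ ?_ (.inl e0.1) (.inl e1.1) (.inl e2.1) e0.2.1 e1.2.1 e2.2.1 e0.2.2 e1.2.2 e2.2.2)).elim <;>
      clear all hdeg h5 <;> (simp at hn hm hb hc' hd ⊢; grind)
  clear h5
  by_cases h3 : ∃ a0 a1 a2, CoPath G S [a0, a1, a2]
  · obtain ⟨a0, a1, a2, hp⟩ := h3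
    have hr := card_sdiff_list S _ hp.1 hp.2.1
    rw [hS] at hr
    obtain ⟨b, hb, c, hc', d, hd, h1, h2, h3⟩ := Finset.two_lt_card.1 (by rw [hr]; simp)
    obtain ⟨hn, hm, hc⟩ := hp
    have all : ∀ x ∈ S \ [a0, a1, a2].toFinset, G.Adj a0 x ∧ G.Adj a1 x ∧ G.Adj a2 x := by
      intro x hx
      refine ⟨?_, ?_, ?_⟩
      · by_contra h
        refine h4 ⟨x, a0, a1, a2, ?_⟩
        clear hdeg
        simp [CoPath] at hn hm hc hx ⊢
        grind
      · clear h4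
        simp at hn hm hc hx
        apply hdeg a1 _ a0 _ a2 <;> (try simp) <;> grind
      · by_contra h
        refine h4 ⟨a0, a1, a2, x, ?_⟩
        clear hdeg
        simp [CoPath] at hn hm hc hx ⊢
        grind
    have e0 := all b hb
    have e1 := all c hc'
    have e2 := all d hd
    refine (hK (k33_minor a0 a0 a1 a2 b c d (.inl rfl)
        ?_ ?_ (.inl e0.1) (.inl e1.1) (.inl e2.1) e0.2.1 e1.2.1 e2.2.1 e0.2.2 e1.2.2 e2.2.2)).elim <;>
      clear all hdeg h4 <;> (simp at hn hm hb hc' hd ⊢; grind)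
  clear h4 hdeg
  have hno : ∀ x ∈ S, ∀ y ∈ S, ∀ z ∈ S, [x, y, z].Nodup → ¬ G.Adj x y → G.Adj y z := by
    intro x hx y hy z hz hn hxy
    by_contra h
    exact h3 ⟨x, y, z, hn, by simp [hx, hy, hz], by simp [hxy, h]⟩
  obtain ⟨a0, ha0, a1, ha1, h01, hA⟩ := pair_lemma S (by omega) hno
  have hr := card_sdiff_list S [a0, a1] (by simpa using h01) (by simp [ha0, ha1])
  rw [hS] at hr
  obtain ⟨x, hx, y, hy, hxy, hX⟩ := pair_lemma (S \ [a0, a1].toFinset) (by rw [hr]; simp)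
    (fun x hx y hy z hz => hno x (Finset.mem_sdiff.1 hx).1 y (Finset.mem_sdiff.1 hy).1 z
      (Finset.mem_sdiff.1 hz).1)
  have hr2 := card_sdiff_list _ [x, y] (by simpa using hxy)
    (by simp only [List.mem_cons, List.not_mem_nil, or_false]; rintro z (rfl | rfl) <;> assumption)
  rw [hr] at hr2
  obtain ⟨b, hb, c, hc', d, hd, h1, h2, h3⟩ := Finset.two_lt_card.1 (by rw [hr2]; simp)
  have e : ∀ z ∈ (S \ [a0, a1].toFinset) \ [x, y].toFinset,
      G.Adj a0 z ∧ G.Adj a1 z ∧ G.Adj x z := by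
    intro z hz
    obtain ⟨hz1, hz2⟩ := Finset.mem_sdiff.1 hz
    simp at hz2
    have := hX z hz1 hz2.1 hz2.2
    simp at hz1
    have := hA z hz1.1 hz1.2.1 hz1.2.2
    tauto
  have e0 := e b hb
  have e1 := e c hc'
  have e2 := e d hd
  refine (hK (k33_minor a0 a0 a1 x b c d (.inl rfl)
      ?_ ?_ (.inl e0.1) (.inl e1.1) (.inl e2.1) e0.2.1 e1.2.1 e2.2.1 e0.2.2 e1.2.2 e2.2.2)).elim <;>
    clear hA hX e hno <;> simp at hx hy hb hc' hd ⊢ <;> grind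

set_option maxHeartbeats 4000000 in
lemma six [DecidableEq V] {G : SimpleGraph V} (S : Finset V) (hS : S.card = 6)
    (hK : ¬ (SimpleGraph.completeGraph (Fin 5)).IsMinor G)
    (hdeg : ∀ v ∈ S, ∀ a ∈ S, ∀ b ∈ S, [v, a, b].Nodup → ¬ G.Adj v a → G.Adj v b) :
    ∃ p q r s t u, (∀ x ∈ S, x ∈ [p, q, r, s, t, u]) ∧ ¬ G.Adj p r ∧ ¬ G.Adj s u := by
  have s := fun u v => G.adj_comm u v
  have hno : ∀ x ∈ S, ∀ y ∈ S, ∀ z ∈ S, [x, y, z].Nodup → ¬ G.Adj x y → G.Adj y z := by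
    intro x hx y hy z hz hn hxy
    exact hdeg y hy x hx z hz (by simp at hn ⊢; grind) (by rwa [G.adj_comm])
  clear hdeg
  obtain ⟨a0, ha0, a1, ha1, h01, hA⟩ := pair_lemma S (by omega) hno
  have hr := card_sdiff_list S [a0, a1] (by simpa using h01) (by simp [ha0, ha1])
  rw [hS] at hr
  obtain ⟨x, hx, y, hy, hxy, hX⟩ := pair_lemma (S \ [a0, a1].toFinset) (by rw [hr]; simp)
    (fun x hx y hy z hz => hno x (Finset.mem_sdiff.1 hx).1 y (Finset.mem_sdiff.1 hy).1 z
      (Finset.mem_sdiff.1 hz).1)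
  have hr2 := card_sdiff_list _ [x, y] (by simpa using hxy)
    (by simp only [List.mem_cons, List.not_mem_nil, or_false]; rintro z (rfl | rfl) <;> assumption)
  rw [hr] at hr2
  obtain ⟨b, c, hbc, hr3⟩ := Finset.card_eq_two.1 hr2
  have hcov : ∀ z ∈ S, z = a0 ∨ z = a1 ∨ z = x ∨ z = y ∨ z = b ∨ z = c := by
    intro z hz
    have : z ∈ (S \ [a0, a1].toFinset) \ [x, y].toFinset ↔ z ∈ ({b, c} : Finset V) := by rw [hr3]
    simp [hz] at this ⊢
    clear hA hX hno
    grind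
  have hb : b ∈ (S \ [a0, a1].toFinset) \ [x, y].toFinset := by rw [hr3]; simp
  have hc : c ∈ (S \ [a0, a1].toFinset) \ [x, y].toFinset := by rw [hr3]; simp
  have hxb := hX b (Finset.mem_sdiff.1 hb).1
  have hxc := hX c (Finset.mem_sdiff.1 hc).1
  have hAx := hA x (Finset.mem_sdiff.1 hx).1
  have hAy := hA y (Finset.mem_sdiff.1 hy).1
  simp at hx hy hb hc
  have hAb := hA b hb.1.1
  have hAc := hA c hc.1.1
  clear hA hX hno hr hr2 hr3 hS
  -- the three pairs are `a0 a1`, `x y`, `b c`; any adjacent pair gives a `K₅` minor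
  have k : ∀ p p' q q' r r' : V, [p, p', q, q', r, r'].Nodup → G.Adj p q → G.Adj p q' →
      G.Adj p r → G.Adj p r' → G.Adj p' q → G.Adj p' q' → G.Adj p' r → G.Adj p' r' →
      G.Adj q r → G.Adj q r' → G.Adj q' r → G.Adj q' r' → ¬ G.Adj r r' := by
    intro p p' q q' r r' hn h1 h2 h3 h4 h5 h6 h7 h8 h9 h10 h11 h12 h13
    simp at hn
    refine hK (k5_minor p q p' q' r r' (.inr h1) ?_ ?_ (.inr h5.symm) (.inl h2) (.inl h3) (.inl h4)
      h6 h7 h8 h11 h12 h13) <;> (try simp) <;> grind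
  have n1 : ¬ G.Adj a0 a1 := by
    apply k x y b c a0 a1 <;> clear k hcov <;> first | (simp; grind) | grind
  have n2 : ¬ G.Adj b c := by
    apply k x y a0 a1 b c <;> clear k hcov <;> first | (simp; grind) | grind
  refine ⟨a0, x, a1, b, y, c, ?_, n1, n2⟩
  intro z hz
  have := hcov z hz
  simp
  tauto

lemma five [DecidableEq V] {G : SimpleGraph V} (S : Finset V) (hS : S.card = 5)
    (hK : ¬ (SimpleGraph.completeGraph (Fin 5)).IsMinor G)
    (hdeg : ∀ v ∈ S, ∀ a ∈ S, v ≠ a → G.Adj v a) : False := by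
  apply hK
  let e := S.equivFinOfCardEq hS
  refine minor_of_pairs (fun i => (e.symm i : V)) (fun i => (e.symm i : V)) (fun _ => .inl rfl)
    (fun w w' h => ?_) (fun w w' h => ?_)
  · have : (e.symm w : V) ≠ e.symm w' := fun h' => h (e.symm.injective (Subtype.ext h'))
    exact ⟨this, this, this⟩
  · refine .inl (hdeg _ (e.symm w).2 _ (e.symm w').2 fun h' => ?_)
    exact h.ne (e.symm.injective (Subtype.ext h'))

lemma coloring_of_cover {A : V → V → Prop} {S X Y : Set V} (hX : AcyclicOn A X)
    (hY : AcyclicOn A Y) (h : ∀ x ∈ S, x ∈ X ∨ x ∈ Y) :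
    ∃ c : V → Fin 2, ∀ i, AcyclicOn A ({v | c v = i} ∩ S) := by
  classical
  refine ⟨fun v => if v ∈ X then 0 else 1, fun i => ?_⟩
  fin_cases i
  · refine AcyclicOn.mono hX ?_
    rintro x ⟨h1, h2⟩
    by_contra h3
    simp [h3] at h1
  · refine AcyclicOn.mono hY ?_
    rintro x ⟨h1, h2⟩
    by_cases h3 : x ∈ X
    · simp [h3] at h1
    · exact (h x h2).resolve_left h3

lemma step {A : V → V → Prop} [DecidableEq V] (S : Finset V) (v : V) (hv : v ∈ S)
    (irr : ¬ A v v) (c : V → Fin 2) (hc : ∀ i, AcyclicOn A ({v | c v = i} ∩ ↑(S.erase v)))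
    (i : Fin 2)
    (hi : (∀ u ∈ S, c u = i → ¬ A u v) ∨ (∀ u ∈ S, c u = i → ¬ A v u)) :
    ∃ c : V → Fin 2, ∀ i, AcyclicOn A ({v | c v = i} ∩ ↑S) := by
  refine ⟨Function.update c v i, fun j => ?_⟩
  by_cases hj : j = i
  · subst hj
    have : AcyclicOn A (insert v ({v | c v = j} ∩ ↑(S.erase v))) := by
      rcases hi with hi | hi
      · apply acyclicOn_insert_source (hc j)
        rintro u (rfl | ⟨hu, hu'⟩)
        · exact irr
        · exact hi u (Finset.mem_of_mem_erase hu') hu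
      · apply acyclicOn_insert_sink (hc j)
        rintro u (rfl | ⟨hu, hu'⟩)
        · exact irr
        · exact hi u (Finset.mem_of_mem_erase hu') hu
    refine AcyclicOn.mono this ?_
    rintro x ⟨h1, h2⟩
    by_cases hx : x = v
    · exact .inl hx
    · right
      simp_all [Function.update_of_ne]
  · refine AcyclicOn.mono (hc j) ?_
    rintro x ⟨h1, h2⟩
    by_cases hx : x = v
    · subst hx
      simp at h1
      exact (hj h1.symm).elim
    · simp_all [Function.update_of_ne]

lemma color_avoid [DecidableEq V] (T : Finset V) (hT : T.card ≤ 1) (c : V → Fin 2) :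
    ∃ i, ∀ u ∈ T, c u ≠ i := by
  by_cases hne : T.Nonempty
  · obtain ⟨w, hw⟩ := hne
    refine ⟨c w + 1, fun u hu => ?_⟩
    rw [Finset.card_le_one.1 hT u hu w hw]
    generalize c w = k
    revert k
    decide
  · exact ⟨0, fun u hu => (hne ⟨u, hu⟩).elim⟩

lemma core [DecidableEq V] {G : SimpleGraph V} (hG : G.Planar) {A : V → V → Prop}
    (hA : IsOrientation G A) : ∀ n, n ≤ 7 → ∀ S : Finset V, S.card = n →
    ∃ c : V → Fin 2, ∀ i, AcyclicOn A ({v | c v = i} ∩ ↑S) := by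
  classical
  intro n
  induction n with
  | zero =>
    intro _ S hS
    rw [Finset.card_eq_zero] at hS
    subst hS
    exact ⟨fun _ => 0, fun i => AcyclicOn.mono (acyclicOn_empty A) (by simp)⟩
  | succ n ih =>
    intro hn S hS
    by_cases hd : ∃ v ∈ S, (S.filter (G.Adj v)).card ≤ 3
    · obtain ⟨v, hv, hd⟩ := hd
      obtain ⟨c, hc⟩ := ih (by omega) (S.erase v) (by rw [Finset.card_erase_of_mem hv]; omega)
      have irr : ¬ A v v := fun h => hA.1 v v h h
      have hsum : (S.filter (fun u => A u v)).card + (S.filter (fun u => A v u)).card ≤ 3 := by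
        rw [← Finset.card_union_of_disjoint]
        · refine le_trans (Finset.card_le_card ?_) hd
          intro u
          simp only [Finset.mem_union, Finset.mem_filter, hA.2]
          tauto
        · rw [Finset.disjoint_left]
          intro u
          simp only [Finset.mem_filter]
          exact fun h1 h2 => hA.1 _ _ h1.2 h2.2
      rcases (by omega : (S.filter (fun u => A u v)).card ≤ 1 ∨
        (S.filter (fun u => A v u)).card ≤ 1) with h | h
      · obtain ⟨i, hi⟩ := color_avoid _ h c
        exact step S v hv irr c hc i (.inl fun u hu h1 h2 => hi u (by simp [hu, h2]) h1)
      · obtain ⟨i, hi⟩ := color_avoid _ h c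
        exact step S v hv irr c hc i (.inr fun u hu h1 h2 => hi u (by simp [hu, h2]) h1)
    · push Not at hd
      have key : ∀ v ∈ S, ∀ l : List V, (∀ x ∈ l, x ∈ S) → (v :: l).Nodup →
          (∀ x ∈ l, ¬ G.Adj v x) → l.length + 5 ≤ S.card := by
        intro v hv l hl hl' hl2
        have h1 := card_sdiff_list S (v :: l) hl' (by simp; exact ⟨hv, hl⟩)
        have h2 : S.filter (G.Adj v) ⊆ S \ (v :: l).toFinset := by
          intro u
          simp
          intro h3 h4
          refine ⟨h3, fun e => ?_, fun e => hl2 u e h4⟩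
          subst e
          exact G.loopless.irrefl _ h4
        have h3 := Finset.card_le_card h2
        have h4 := hd v hv
        rw [List.length_cons] at h1
        omega
      have hge : 5 ≤ S.card := by
        obtain ⟨v, hv⟩ := Finset.card_pos.1 (by omega : 0 < S.card)
        have := key v hv [] (by simp) (by simp) (by simp)
        simpa using this
      obtain h | h | h : S.card = 5 ∨ S.card = 6 ∨ S.card = 7 := by omega
      · refine (five S h hG.1 fun v hv a ha hva => ?_).elim
        by_contra hna
        have := key v hv [a] (by simp [ha]) (by simp [hva]) (by simp [hna])
        simp at this
        omega
      · obtain ⟨p, q, r, s, t, u, hcov, h1, h2⟩ := six S h hG.1 (by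
          intro v hv a ha b hb hn h1
          by_contra h2
          have := key v hv [a, b] (by simp [ha, hb]) hn (by simp [h1, h2])
          simp at this
          omega)
        refine coloring_of_cover (acyclicOn_three hA (q := q) h1) (acyclicOn_three hA (q := t) h2) ?_
        intro x hx
        have := hcov x hx
        simp at this ⊢
        tauto
      · obtain ⟨p, q, r, s, t, u, v, hcov, h1, h2, h3, h4⟩ := seven S h hG.2 (by
          intro v hv a ha b hb c hc hn h1 h2
          by_contra h3
          have := key v hv [a, b, c] (by simp [ha, hb, hc]) hn (by simp [h1, h2, h3])
          simp at this
          omega)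
        refine coloring_of_cover (acyclicOn_four hA h1 h2 h3) (acyclicOn_three hA (q := u) h4) ?_
        intro x hx
        have := hcov x hx
        simp at this ⊢
        tauto

end SmallPlanar

/-- every orientation of a planar graph on at most 7 vertices admits an
acyclic 2-colouring. -/
theorem stmt_6 (V : Type) [Finite V] (hV : Nat.card V ≤ 7) (G : SimpleGraph V)
    (hG : G.Planar) (A : V → V → Prop) (hA : IsOrientation G A) :
    ∃ c : V → Fin 2, IsAcyclicColoring A 2 c := by
  classical
  have := Fintype.ofFinite V
  rw [Nat.card_eq_fintype_card] at hV
  obtain ⟨c, hc⟩ := SmallPlanar.core hG hA _ hV Finset.univ Finset.card_univ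
  exact ⟨c, fun i => SmallPlanar.AcyclicOn.mono (hc i) (by simp)⟩
end

section
/- The complete graph K6 has dichromatic number 2; that is, every orientation (tournament) on 6 vertices admits a partition of its vertex set into two acyclic sets, and some tournament on 6 vertices has no acyclic set of all 6 vertices. -/
def IsTournament {V : Type*} (A : V → V → Prop) : Prop :=
  (∀ a b, A a b → ¬ A b a) ∧ (∀ a b, a ≠ b → A a b ∨ A b a)

/-- The three vertices form a directed triangle. -/
def Cyc3 (A : Fin 6 → Fin 6 → Prop) (p q r : Fin 6) : Prop :=
  (A p q ∧ A q r ∧ A r p) ∨ (A q p ∧ A r q ∧ A p r)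

/-- A set covered by a triple that is not a directed triangle is acyclic. -/
lemma acyclicOn_of_not_cyc3 {A : Fin 6 → Fin 6 → Prop} (hA : IsTournament A)
    {p q r : Fin 6} (h : ¬ Cyc3 A p q r) (X : Set (Fin 6))
    (hX : ∀ v ∈ X, v = p ∨ v = q ∨ v = r) : AcyclicOn A X := by
  obtain ⟨h1, h2⟩ := hA
  have irr : ∀ a, ¬ A a a := fun a ha => h1 a a ha ha
  have tr : ∀ a ∈ X, ∀ b ∈ X, ∀ c ∈ X, A a b → A b c → A a c := by
    intro a ha b hb c hc hab hbc
    by_contra hac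
    have hne : c ≠ a := by
      rintro rfl
      exact h1 _ _ hab hbc
    have hca : A c a := (h2 c a hne).resolve_right hac
    apply h
    unfold Cyc3
    rcases hX a ha with rfl | rfl | rfl <;> rcases hX b hb with rfl | rfl | rfl <;>
      rcases hX c hc with rfl | rfl | rfl <;>
      first
      | exact absurd hab (irr _)
      | exact absurd hbc (irr _)
      | exact absurd hca (irr _)
      | exact Or.inl ⟨‹_›, ‹_›, ‹_›⟩
      | exact Or.inr ⟨‹_›, ‹_›, ‹_›⟩
  intro v _ hT
  have key : ∀ w, Relation.TransGen (fun a b => a ∈ X ∧ b ∈ X ∧ A a b) v w →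
      v ∈ X ∧ w ∈ X ∧ A v w := by
    intro w hw
    induction hw with
    | single h => exact h
    | tail _ h ih => exact ⟨ih.1, h.2.1, tr _ ih.1 _ ih.2.1 _ h.2.1 ih.2.2 h.2.2⟩
  exact irr v (key v hT).2.2

/-- If the tournament has no good colouring, one side of each 3+3 split is a directed triangle. -/
lemma cyc3_or {A : Fin 6 → Fin 6 → Prop} (hA : IsTournament A)
    (hn : ¬ ∃ c : Fin 6 → Fin 2, IsAcyclicColoring A 2 c) (p q r s t u : Fin 6)
    (hall : ∀ v, v = p ∨ v = q ∨ v = r ∨ v = s ∨ v = t ∨ v = u) :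
    Cyc3 A p q r ∨ Cyc3 A s t u := by
  by_contra hc
  push Not at hc
  apply hn
  refine ⟨fun v => if v = p ∨ v = q ∨ v = r then 0 else 1, fun i => ?_⟩
  fin_cases i
  · refine acyclicOn_of_not_cyc3 hA hc.1 _ fun v hv => ?_
    by_contra hv'
    simp at hv; tauto
  · refine acyclicOn_of_not_cyc3 hA hc.2 _ fun v hv => ?_
    by_cases hv' : v = p ∨ v = q ∨ v = r
    · simp at hv; tauto
    · have := hall v
      tauto

open Classical in
/-- The 0/1 indicator of an arc. -/
noncomputable def arcInd (A : Fin 6 → Fin 6 → Prop) (a b : Fin 6) : ℤ := if A a b then 1 else 0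

/-- The indicator of a directed triangle, as a quadratic polynomial in arc indicators. -/
def triInd (x y z : ℤ) : ℤ := z + x * y - z * x - z * y

lemma triInd_nonneg {A : Fin 6 → Fin 6 → Prop} (p q r : Fin 6) :
    0 ≤ triInd (arcInd A p q) (arcInd A q r) (arcInd A p r) := by
  unfold triInd arcInd
  split_ifs <;> norm_num

lemma triInd_eq {A : Fin 6 → Fin 6 → Prop} (hA : IsTournament A) {p q r : Fin 6}
    (h : Cyc3 A p q r) :
    1 ≤ triInd (arcInd A p q) (arcInd A q r) (arcInd A p r) := by
  obtain ⟨h1, -⟩ := hA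
  unfold triInd arcInd
  rcases h with ⟨a, b, c⟩ | ⟨a, b, c⟩
  · simp [a, b, h1 _ _ c]
  · simp [h1 _ _ a, h1 _ _ b, c]

/-- No integer lies strictly between 2 and 3. -/
lemma score_ineq (s : ℤ) : 0 ≤ (s - 2) * (s - 3) := by
  rcases le_or_gt s 2 with h | h
  · nlinarith
  · nlinarith

lemma arcInd_sq (A : Fin 6 → Fin 6 → Prop) (a b : Fin 6) :
    arcInd A a b * arcInd A a b = arcInd A a b := by
  unfold arcInd
  split_ifs <;> norm_num

/-- K6 has dichromatic number exactly 2. -/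
theorem stmt_7 :
    (∀ A : Fin 6 → Fin 6 → Prop, IsTournament A →
      ∃ c : Fin 6 → Fin 2, IsAcyclicColoring A 2 c) ∧
    (∃ A : Fin 6 → Fin 6 → Prop, IsTournament A ∧ ¬ AcyclicOn A Set.univ) := by
  constructor
  · intro A hA
    by_contra hn
    have key : ∀ p q r s t u : Fin 6,
        (∀ v, v = p ∨ v = q ∨ v = r ∨ v = s ∨ v = t ∨ v = u) →
        1 ≤ triInd (arcInd A p q) (arcInd A q r) (arcInd A p r) +
          triInd (arcInd A s t) (arcInd A t u) (arcInd A s u) := by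
      intro p q r s t u hall
      have n1 := triInd_nonneg (A := A) p q r
      have n2 := triInd_nonneg (A := A) s t u
      rcases cyc3_or hA hn p q r s t u hall with h | h
      · have := triInd_eq hA h
        linarith
      · have := triInd_eq hA h
        linarith
    have k1 := key 0 1 2 3 4 5 (by decide)
    have k2 := key 0 1 3 2 4 5 (by decide)
    have k3 := key 0 1 4 2 3 5 (by decide)
    have k4 := key 0 1 5 2 3 4 (by decide)
    have k5 := key 0 2 3 1 4 5 (by decide)
    have k6 := key 0 2 4 1 3 5 (by decide)
    have k7 := key 0 2 5 1 3 4 (by decide)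
    have k8 := key 0 3 4 1 2 5 (by decide)
    have k9 := key 0 3 5 1 2 4 (by decide)
    have k10 := key 0 4 5 1 2 3 (by decide)
    have e01 := arcInd_sq A 0 1
    have e02 := arcInd_sq A 0 2
    have e03 := arcInd_sq A 0 3
    have e04 := arcInd_sq A 0 4
    have e05 := arcInd_sq A 0 5
    have e12 := arcInd_sq A 1 2
    have e13 := arcInd_sq A 1 3
    have e14 := arcInd_sq A 1 4
    have e15 := arcInd_sq A 1 5
    have e23 := arcInd_sq A 2 3
    have e24 := arcInd_sq A 2 4
    have e25 := arcInd_sq A 2 5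
    have e34 := arcInd_sq A 3 4
    have e35 := arcInd_sq A 3 5
    have e45 := arcInd_sq A 4 5
    have s0 := score_ineq (arcInd A 0 1 + arcInd A 0 2 + arcInd A 0 3 + arcInd A 0 4 + arcInd A 0 5)
    have s1 := score_ineq ((1 - arcInd A 0 1) + arcInd A 1 2 + arcInd A 1 3 + arcInd A 1 4 + arcInd A 1 5)
    have s2 := score_ineq ((1 - arcInd A 0 2) + (1 - arcInd A 1 2) + arcInd A 2 3 + arcInd A 2 4 + arcInd A 2 5)
    have s3 := score_ineq ((1 - arcInd A 0 3) + (1 - arcInd A 1 3) + (1 - arcInd A 2 3) + arcInd A 3 4 + arcInd A 3 5)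
    have s4 := score_ineq ((1 - arcInd A 0 4) + (1 - arcInd A 1 4) + (1 - arcInd A 2 4) + (1 - arcInd A 3 4) + arcInd A 4 5)
    have s5 := score_ineq ((1 - arcInd A 0 5) + (1 - arcInd A 1 5) + (1 - arcInd A 2 5) + (1 - arcInd A 3 5) + (1 - arcInd A 4 5))
    unfold triInd at k1 k2 k3 k4 k5 k6 k7 k8 k9 k10
    generalize arcInd A 0 1 = x01 at *
    generalize arcInd A 0 2 = x02 at *
    generalize arcInd A 0 3 = x03 at *
    generalize arcInd A 0 4 = x04 at *
    generalize arcInd A 0 5 = x05 at *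
    generalize arcInd A 1 2 = x12 at *
    generalize arcInd A 1 3 = x13 at *
    generalize arcInd A 1 4 = x14 at *
    generalize arcInd A 1 5 = x15 at *
    generalize arcInd A 2 3 = x23 at *
    generalize arcInd A 2 4 = x24 at *
    generalize arcInd A 2 5 = x25 at *
    generalize arcInd A 3 4 = x34 at *
    generalize arcInd A 3 5 = x35 at *
    generalize arcInd A 4 5 = x45 at *
    linarith
  · refine ⟨fun a b => (a < b ∧ ¬ (a = 0 ∧ b = 5)) ∨ (a = 5 ∧ b = 0), ⟨by decide, by decide⟩, ?_⟩
    intro h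
    apply h 0 (Set.mem_univ _)
    refine .tail (b := 5) (.tail (b := 1) (.single ?_) ?_) ?_ <;> simp
end

section
/- If every planar digraph admits an acyclic 2-colouring, then every orientation of a planar triangulation admits an acyclic 2-colouring with no monochromatic facial triangle. -/
/-! Set-based connectivity. -/

/-- Cut formulation of preconnectedness of a vertex set. -/
def CN {V : Type*} (G : SimpleGraph V) (S : Set V) : Prop :=
  ∀ U : Set V, (∃ u ∈ S, u ∈ U) → (∀ x ∈ U, x ∈ S → ∀ y ∈ S, G.Adj x y → y ∈ U) → S ⊆ U

theorem cn_iff {V : Type*} (G : SimpleGraph V) (S : Set V) :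
    (G.induce S).Preconnected ↔ CN G S := by
  constructor
  · rintro h U ⟨u, huS, huU⟩ hcl v hv
    obtain ⟨p⟩ := h ⟨u, huS⟩ ⟨v, hv⟩
    have key : ∀ (x y : S), (G.induce S).Walk x y → (x : V) ∈ U → (y : V) ∈ U := by
      intro x y p
      induction p with
      | nil => exact id
      | cons hadj _ ih =>
        intro hx
        exact ih (hcl _ hx (Subtype.property _) _ (Subtype.property _) hadj)
    exact key _ _ p huU
  · intro h u v
    have := h {w | ∃ hw : w ∈ S, (G.induce S).Reachable u ⟨w, hw⟩}
      ⟨u, u.2, u.2, SimpleGraph.Reachable.refl _⟩ (by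
        rintro x ⟨hx, hr⟩ _ y hy hadj
        refine ⟨hy, hr.trans (SimpleGraph.Adj.reachable ?_)⟩
        exact hadj)
    obtain ⟨_, hr⟩ := this v.2
    exact hr

theorem cn_connected {V : Type*} (G : SimpleGraph V) (S : Set V) :
    (G.induce S).Connected ↔ CN G S ∧ S.Nonempty := by
  rw [SimpleGraph.connected_iff, cn_iff, Set.nonempty_coe_sort]

/-- One base point suffices. -/
theorem cn_base {V : Type*} {G : SimpleGraph V} {S : Set V} (b : V) (hb : b ∈ S)
    (h : ∀ U : Set V, b ∈ U → (∀ x ∈ U, x ∈ S → ∀ y ∈ S, G.Adj x y → y ∈ U) → S ⊆ U) :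
    CN G S := by
  rintro U ⟨u, huS, huU⟩ hcl
  by_cases hbU : b ∈ U
  · exact h U hbU hcl
  · exfalso
    refine h Uᶜ hbU ?_ huS huU
    intro x hx hxS y hyS hadj hyU
    exact hx (hcl y hyU hyS x hxS hadj.symm)

theorem cn_union {V : Type*} {G : SimpleGraph V} {S C : Set V} (hS : CN G S) (hC : CN G C)
    {q u : V} (hq : q ∈ S) (hu : u ∈ C) (hadj : G.Adj q u) : CN G (S ∪ C) := by
  refine cn_base q (Or.inl hq) ?_
  intro U hqU hcl
  have h1 : S ⊆ U := hS U ⟨q, hq, hqU⟩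
    (fun x hx hxS y hy ha => hcl x hx (Or.inl hxS) y (Or.inl hy) ha)
  have h2 : C ⊆ U := hC U ⟨u, hu, hcl q hqU (Or.inl hq) u (Or.inr hu) hadj⟩
    (fun x hx hxS y hy ha => hcl x hx (Or.inr hxS) y (Or.inr hy) ha)
  exact Set.union_subset h1 h2

theorem cn_singleton {V : Type*} (G : SimpleGraph V) (u : V) : CN G {u} := by
  rintro U ⟨v, hv, hvU⟩ _ w hw
  rw [Set.mem_singleton_iff] at hv hw
  rw [hw, ← hv]; exact hvU

/-- Splitting a connected set between two of its points. -/
theorem cn_split {V : Type*} {G : SimpleGraph V} {P : Set V} (hP : CN G P) {a u : V}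
    (ha : a ∈ P) (hu : u ∈ P) (hau : u ≠ a) :
    ∃ C ⊆ P, u ∈ C ∧ a ∉ C ∧ CN G C ∧ CN G (P \ C) ∧
      ∃ x ∈ P \ C, ∃ y ∈ C, G.Adj x y := by
  let r : V → V → Prop := fun x y => y ∈ P ∧ y ≠ a ∧ G.Adj x y
  let C : Set V := {v | Relation.ReflTransGen r u v}
  have hCP : ∀ v ∈ C, v ∈ P ∧ v ≠ a := by
    intro v hv
    induction hv with
    | refl => exact ⟨hu, hau⟩
    | tail _ h _ => exact ⟨h.1, h.2.1⟩
  have huC : u ∈ C := Relation.ReflTransGen.refl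
  have haC : a ∉ C := fun h => (hCP a h).2 rfl
  have hstep : ∀ x ∈ C, ∀ y ∈ P, y ≠ a → G.Adj x y → y ∈ C :=
    fun x hx y hy hya hadj => Relation.ReflTransGen.tail hx ⟨hy, hya, hadj⟩
  refine ⟨C, fun v hv => (hCP v hv).1, huC, haC, ?_, ?_, ?_⟩
  · refine cn_base u huC ?_
    intro U huU hcl v hv
    have hv' : Relation.ReflTransGen r u v := hv
    induction hv' with
    | refl => exact huU
    | tail h1 h2 ih => exact hcl _ (ih h1) h1 _ (Relation.ReflTransGen.tail h1 h2) h2.2.2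
  · refine cn_base a ⟨ha, haC⟩ ?_
    intro U haU hcl v hv
    have := hP (U ∪ C) ⟨a, ha, Or.inl haU⟩ (by
      intro x hx hxP y hy hadj
      by_cases hyC : y ∈ C
      · exact Or.inr hyC
      left
      by_cases hxC : x ∈ C
      · by_cases hya : y = a
        · rw [hya]; exact haU
        · exact absurd (hstep x hxC y hy hya hadj) hyC
      · have hxU : x ∈ U := hx.resolve_right hxC
        exact hcl x hxU ⟨hxP, hxC⟩ y ⟨hy, hyC⟩ hadj)
    exact (this hv.1).resolve_right hv.2
  · by_contra hcon
    push Not at hcon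
    have := hP C ⟨u, hu, huC⟩ (by
      intro x hx hxP y hy hadj
      by_contra hyC
      exact hcon y ⟨hy, hyC⟩ x hx hadj.symm)
    exact haC (this ha)

/-! Minor models in terms of `CN`. -/

theorem minor_iff {W V : Type*} (H : SimpleGraph W) (G : SimpleGraph V) :
    H.IsMinor G ↔ ∃ f : W → Set V, (∀ w, (f w).Nonempty) ∧ (∀ w, CN G (f w)) ∧
    (∀ w w', w ≠ w' → ∀ v, v ∈ f w → v ∉ f w') ∧
    ∀ w w', H.Adj w w' → ∃ u ∈ f w, ∃ v ∈ f w', G.Adj u v := by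
  constructor
  · rintro ⟨f, h1, h2, h3, h4⟩
    refine ⟨f, h1, fun w => ((cn_connected _ _).1 (h2 w)).1, ?_, fun w w' h => h4 h⟩
    intro w w' hne v hv hv'
    exact Set.disjoint_left.1 (h3 hne) hv hv'
  · rintro ⟨f, h1, h2, h3, h4⟩
    refine ⟨f, h1, fun w => (cn_connected _ _).2 ⟨h2 w, h1 w⟩, ?_, fun w w' h => h4 w w' h⟩
    intro w w' hne
    exact Set.disjoint_left.2 (fun v => h3 _ _ hne v)

/-- Adjacency of vertex sets. -/
def Tch {V : Type*} (G : SimpleGraph V) (S S' : Set V) : Prop :=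
  ∃ u ∈ S, ∃ v ∈ S', G.Adj u v

theorem Tch.symm {V : Type*} {G : SimpleGraph V} {S S' : Set V} (h : Tch G S S') : Tch G S' S := by
  obtain ⟨u, hu, v, hv, ha⟩ := h
  exact ⟨v, hv, u, hu, ha.symm⟩

theorem k33_of {V : Type*} {G : SimpleGraph V} (A B : Fin 3 → Set V)
    (hA : ∀ i, (A i).Nonempty ∧ CN G (A i)) (hB : ∀ i, (B i).Nonempty ∧ CN G (B i))
    (hAA : ∀ i j, i ≠ j → ∀ v, v ∈ A i → v ∉ A j)
    (hBB : ∀ i j, i ≠ j → ∀ v, v ∈ B i → v ∉ B j)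
    (hAB : ∀ i j, ∀ v, v ∈ A i → v ∉ B j)
    (hadj : ∀ i j, Tch G (A i) (B j)) :
    (completeBipartiteGraph (Fin 3) (Fin 3)).IsMinor G := by
  rw [minor_iff]
  refine ⟨Sum.elim A B, ?_, ?_, ?_, ?_⟩
  · rintro (i | i)
    exacts [(hA i).1, (hB i).1]
  · rintro (i | i)
    exacts [(hA i).2, (hB i).2]
  · rintro (i | i) (j | j) hne v hv hv'
    · exact hAA i j (fun h => hne (by rw [h])) v hv hv'
    · exact hAB i j v hv hv'
    · exact hAB j i v hv' hv
    · exact hBB i j (fun h => hne (by rw [h])) v hv hv'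
  · rintro (i | i) (j | j) h
    · simp at h
    · exact hadj i j
    · exact (hadj j i).symm
    · simp at h

theorem k5_of {V : Type*} {G : SimpleGraph V} (Q R : Set V) (P : Fin 3 → Set V)
    (hQ : Q.Nonempty ∧ CN G Q) (hR : R.Nonempty ∧ CN G R) (hP : ∀ i, (P i).Nonempty ∧ CN G (P i))
    (hPP : ∀ i j, i ≠ j → ∀ v, v ∈ P i → v ∉ P j)
    (hQP : ∀ j, ∀ v, v ∈ Q → v ∉ P j) (hRP : ∀ j, ∀ v, v ∈ R → v ∉ P j)
    (hQR : ∀ v, v ∈ Q → v ∉ R)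
    (aQR : Tch G Q R) (aQP : ∀ j, Tch G Q (P j)) (aRP : ∀ j, Tch G R (P j))
    (aPP : ∀ i j, i ≠ j → Tch G (P i) (P j)) :
    (SimpleGraph.completeGraph (Fin 5)).IsMinor G := by
  rw [minor_iff]
  refine ⟨![Q, R, P 0, P 1, P 2], ?_, ?_, ?_, ?_⟩
  · intro i
    fin_cases i
    exacts [hQ.1, hR.1, (hP 0).1, (hP 1).1, (hP 2).1]
  · intro i
    fin_cases i
    exacts [hQ.2, hR.2, (hP 0).2, (hP 1).2, (hP 2).2]
  · have hPQ : ∀ j, ∀ v, v ∈ P j → v ∉ Q := fun j v h h' => hQP j v h' h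
    have hPR : ∀ j, ∀ v, v ∈ P j → v ∉ R := fun j v h h' => hRP j v h' h
    have hRQ : ∀ v, v ∈ R → v ∉ Q := fun v h h' => hQR v h' h
    intro i j hne
    fin_cases i <;> fin_cases j <;> first
      | exact absurd rfl hne
      | exact hQR
      | exact hRQ
      | exact hQP _
      | exact hPQ _
      | exact hRP _
      | exact hPR _
      | exact hPP _ _ (by decide)
  · intro i j hne
    change Tch G _ _
    have hne' : i ≠ j := hne
    fin_cases i <;> fin_cases j <;> first
      | exact absurd rfl hne'
      | exact aQR
      | exact aQR.symm
      | exact aQP _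
      | exact (aQP _).symm
      | exact aRP _
      | exact (aRP _).symm
      | exact aPP _ _ (by decide)

/-! The rooted `K_{2,3}` lemma. -/

theorem rooted_aux {V : Type*} [Finite V] {G : SimpleGraph V} (hG : G.Planar) (t : Fin 3 → V)
    (ht : ∀ i j, i ≠ j → G.Adj (t i) (t j)) (hX : CN G (Set.range t)ᶜ) (n : ℕ) :
    ∀ (Q R : Set V) (P : Fin 3 → Set V), (Qᶜ).ncard = n →
    Q.Nonempty → R.Nonempty → CN G Q → CN G R → (∀ i, t i ∈ P i) → (∀ i, CN G (P i)) →
    (∀ i j, i ≠ j → ∀ v, v ∈ P i → v ∉ P j) →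
    (∀ j, ∀ v, v ∈ Q → v ∉ P j) → (∀ j, ∀ v, v ∈ R → v ∉ P j) →
    (∀ v, v ∈ Q → v ∉ R) →
    (∀ j, Tch G Q (P j)) → (∀ j, Tch G R (P j)) → False := by
  induction n using Nat.strong_induction_on with
  | _ n ih =>
  intro Q R P hn Qne Rne cQ cR tP cP hPP hQP hRP hQR aQP aRP
  have grow : ∀ Q' : Set V, ∀ u, Q ⊆ Q' → u ∈ Q' → u ∉ Q → (Q'ᶜ).ncard < n := by
    intro Q' u hsub hu huQ
    rw [← hn]
    refine Set.ncard_lt_ncard ?_ (Set.toFinite _)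
    refine ⟨Set.compl_subset_compl.2 hsub, fun h => ?_⟩
    exact h huQ hu
  have aPP : ∀ i j, i ≠ j → Tch G (P i) (P j) :=
    fun i j h => ⟨t i, tP i, t j, tP j, ht i j h⟩
  have QX : ∀ v ∈ Q, v ∈ (Set.range t)ᶜ := by
    rintro v hv ⟨j, rfl⟩
    exact hQP j _ hv (tP j)
  have RX : ∀ v ∈ R, v ∈ (Set.range t)ᶜ := by
    rintro v hv ⟨j, rfl⟩
    exact hRP j _ hv (tP j)
  obtain ⟨q, hq, u, huX, huQ, hqu⟩ : ∃ q ∈ Q, ∃ u ∈ (Set.range t)ᶜ, u ∉ Q ∧ G.Adj q u := by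
    by_contra hcon
    push Not at hcon
    obtain ⟨q, hq⟩ := Qne
    obtain ⟨r, hr⟩ := Rne
    have := hX Q ⟨q, QX q hq, hq⟩ (by
      intro x hx _ y hy hadj
      by_contra hyQ
      exact hcon x hx y hy hyQ hadj)
    exact hQR r (this (RX r hr)) hr
  by_cases huR : u ∈ R
  · exact hG.1 (k5_of Q R P ⟨Qne, cQ⟩ ⟨Rne, cR⟩ (fun i => ⟨⟨_, tP i⟩, cP i⟩) hPP hQP hRP hQR
      ⟨q, hq, u, huR, hqu⟩ aQP aRP aPP)
  by_cases huP : ∃ j, u ∈ P j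
  · obtain ⟨j, huj⟩ := huP
    have hne : u ≠ t j := fun h => huX ⟨j, h.symm⟩
    obtain ⟨C, hCP, huC, htC, cC, cD, aDC⟩ := cn_split (cP j) (tP j) huj hne
    have hCk : ∀ k, k ≠ j → ∀ v ∈ C, v ∉ P k := fun k hk v hv => hPP j k hk.symm v (hCP hv)
    by_cases hCR : Tch G R C
    · refine hG.2 (k33_of ![Q, R, P j \ C] (Function.update P j C) ?_ ?_ ?_ ?_ ?_ ?_)
      · intro i
        fin_cases i
        exacts [⟨Qne, cQ⟩, ⟨Rne, cR⟩, ⟨⟨t j, tP j, htC⟩, cD⟩]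
      · intro i
        by_cases hi : i = j
        · subst hi; simp only [Function.update_self]; exact ⟨⟨u, huC⟩, cC⟩
        · rw [Function.update_of_ne hi]; exact ⟨⟨_, tP i⟩, cP i⟩
      · intro i k hik v hv hv'
        fin_cases i <;> fin_cases k <;> first
          | exact absurd rfl hik
          | exact hQR v hv hv'
          | exact hQR v hv' hv
          | exact hQP j v hv hv'.1
          | exact hQP j v hv' hv.1
          | exact hRP j v hv hv'.1
          | exact hRP j v hv' hv.1
      · intro i k hik v
        by_cases hi : i = j
        · subst hi
          rw [Function.update_self, Function.update_of_ne hik.symm]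
          exact hCk k hik.symm v
        · rw [Function.update_of_ne hi]
          by_cases hk : k = j
          · subst hk
            rw [Function.update_self]
            exact fun h h' => hCk i hi v h' h
          · rw [Function.update_of_ne hk]; exact hPP i k hik v
      · intro i k v
        by_cases hk : k = j
        · subst hk
          rw [Function.update_self]
          fin_cases i
          · exact fun h h' => hQP k v h (hCP h')
          · exact fun h h' => hRP k v h (hCP h')
          · exact fun h h' => h.2 h'
        · rw [Function.update_of_ne hk]
          fin_cases i
          · exact hQP k v
          · exact hRP k v
          · exact fun h h' => hPP k j hk v h' h.1
      · intro i k
        by_cases hk : k = j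
        · subst hk
          rw [Function.update_self]
          fin_cases i
          · exact ⟨q, hq, u, huC, hqu⟩
          · exact hCR
          · exact aDC
        · rw [Function.update_of_ne hk]
          fin_cases i
          · exact aQP k
          · exact aRP k
          · exact ⟨t j, ⟨tP j, htC⟩, t k, tP k, ht j k (Ne.symm hk)⟩
    · have hsub : ∀ i, Function.update P j (P j \ C) i ⊆ P i := by
        intro i
        by_cases hi : i = j
        · subst hi; rw [Function.update_self]; exact Set.sdiff_subset
        · rw [Function.update_of_ne hi]
      refine ih _ (grow (Q ∪ C) u Set.subset_union_left (Or.inr huC) huQ) (Q ∪ C) R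
        (Function.update P j (P j \ C)) rfl (Qne.mono Set.subset_union_left) Rne
        (cn_union cQ cC hq huC hqu) cR ?_ ?_ ?_ ?_ ?_ ?_ ?_ ?_
      · intro i
        by_cases hi : i = j
        · subst hi; rw [Function.update_self]; exact ⟨tP i, htC⟩
        · rw [Function.update_of_ne hi]; exact tP i
      · intro i
        by_cases hi : i = j
        · subst hi; rw [Function.update_self]; exact cD
        · rw [Function.update_of_ne hi]; exact cP i
      · exact fun i k hik v hv hv' => hPP i k hik v (hsub i hv) (hsub k hv')
      · rintro k v (hv | hv) hv'
        · exact hQP k v hv (hsub k hv')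
        · by_cases hk : k = j
          · subst hk; rw [Function.update_self] at hv'; exact hv'.2 hv
          · exact hCk k hk v hv (hsub k hv')
      · exact fun k v hv hv' => hRP k v hv (hsub k hv')
      · rintro v (hv | hv) hv'
        · exact hQR v hv hv'
        · exact hRP j v hv' (hCP hv)
      · intro k
        by_cases hk : k = j
        · subst hk
          rw [Function.update_self]
          obtain ⟨x, hx, y, hy, hxy⟩ := aDC
          exact ⟨y, Or.inr hy, x, hx, hxy.symm⟩
        · rw [Function.update_of_ne hk]
          obtain ⟨x, hx, y, hy, hxy⟩ := aQP k
          exact ⟨x, Or.inl hx, y, hy, hxy⟩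
      · intro k
        by_cases hk : k = j
        · subst hk
          rw [Function.update_self]
          obtain ⟨x, hx, y, hy, hxy⟩ := aRP k
          exact ⟨x, hx, y, ⟨hy, fun h => hCR ⟨x, hx, y, h, hxy⟩⟩, hxy⟩
        · rw [Function.update_of_ne hk]; exact aRP k
  · push Not at huP
    refine ih _ (grow (Q ∪ {u}) u Set.subset_union_left (Or.inr rfl) huQ) (Q ∪ {u}) R P rfl
      (Qne.mono Set.subset_union_left) Rne (cn_union cQ (cn_singleton G u) hq rfl hqu) cR tP cP hPP
      ?_ hRP ?_ ?_ aRP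
    · rintro k v (hv | hv)
      · exact hQP k v hv
      · rw [Set.mem_singleton_iff.1 hv]; exact huP k
    · rintro v (hv | hv)
      · exact hQR v hv
      · rw [Set.mem_singleton_iff.1 hv]; exact huR
    · intro k
      obtain ⟨x, hx, y, hy, hxy⟩ := aQP k
      exact ⟨x, Or.inl hx, y, hy, hxy⟩

/-! The gadget: an octahedron glued on a triangle. -/

/-- Glue an octahedron on the triangle `t`. -/
def glue {V : Type*} (G : SimpleGraph V) (t : Fin 3 → V) : SimpleGraph (V ⊕ Fin 3) where
  Adj x y := match x, y with
    | Sum.inl u, Sum.inl v => G.Adj u v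
    | Sum.inl u, Sum.inr i => ∃ j, j ≠ i ∧ u = t j
    | Sum.inr i, Sum.inl u => ∃ j, j ≠ i ∧ u = t j
    | Sum.inr i, Sum.inr j => i ≠ j
  symm := ⟨by
    rintro (u | i) (v | j) h
    · exact h.symm
    · exact h
    · exact h
    · exact Ne.symm h⟩
  loopless := ⟨by
    rintro (u | i) h
    · exact G.loopless.irrefl u h
    · exact h rfl⟩

section
variable {V : Type*} {G : SimpleGraph V} {t : Fin 3 → V}

theorem glue_restrict (ht : ∀ i j, i ≠ j → G.Adj (t i) (t j)) {F : Set (V ⊕ Fin 3)}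
    (hF : CN (glue G t) F) : CN G (Sum.inl ⁻¹' F) := by
  rintro U ⟨u, huF, huU⟩ hcl
  have := hF (Sum.inl '' U ∪ {x | ∃ i, x = Sum.inr i ∧ ∃ j, Sum.inl (t j) ∈ F ∧ t j ∈ U})
    ⟨Sum.inl u, huF, Or.inl ⟨u, huU, rfl⟩⟩ (by
      rintro x (⟨v, hv, rfl⟩ | ⟨i, rfl, j, hjF, hjU⟩) hxF (w | k) hy hadj
      · exact Or.inl ⟨w, hcl v hv hxF w hy hadj, rfl⟩
      · obtain ⟨j, _, rfl⟩ := hadj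
        exact Or.inr ⟨k, rfl, j, hxF, hv⟩
      · obtain ⟨j', _, rfl⟩ := hadj
        left
        refine ⟨t j', ?_, rfl⟩
        by_cases hjj : j = j'
        · rw [← hjj]; exact hjU
        · exact hcl (t j) hjU hjF (t j') hy (ht j j' hjj)
      · exact Or.inr ⟨k, rfl, j, hjF, hjU⟩)
  intro v hv
  rcases this hv with ⟨w, hw, he⟩ | ⟨i, hi, _⟩
  · cases he; exact hw
  · cases hi

theorem glue_exit {F : Set (V ⊕ Fin 3)} (hF : CN (glue G t) F) {i : Fin 3} {v : V}
    (hi : Sum.inr i ∈ F) (hv : Sum.inl v ∈ F) : ∃ j, Sum.inl (t j) ∈ F := by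
  by_contra hcon
  push Not at hcon
  have := hF (Set.range Sum.inr) ⟨_, hi, i, rfl⟩ (by
    rintro _ ⟨k, rfl⟩ _ (w | l) hy hadj
    · obtain ⟨j, _, rfl⟩ := hadj
      exact absurd hy (hcon j)
    · exact ⟨l, rfl⟩)
  obtain ⟨k, hk⟩ := this hv
  cases hk

theorem glue_tch (ht : ∀ i j, i ≠ j → G.Adj (t i) (t j)) {F F' : Set (V ⊕ Fin 3)}
    (hF : CN (glue G t) F) (hF' : CN (glue G t) F') {v v' : V}
    (hv : Sum.inl v ∈ F) (hv' : Sum.inl v' ∈ F') (hd : ∀ x, x ∈ F → x ∉ F')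
    (h : Tch (glue G t) F F') :
    Tch G (Sum.inl ⁻¹' F) (Sum.inl ⁻¹' F') := by
  have main : ∀ j j', Sum.inl (t j) ∈ F → Sum.inl (t j') ∈ F' →
      Tch G (Sum.inl ⁻¹' F) (Sum.inl ⁻¹' F') := by
    intro j j' hj hj'
    refine ⟨t j, hj, t j', hj', ht j j' ?_⟩
    rintro rfl
    exact hd _ hj hj'
  obtain ⟨x | i, hx, y | k, hy, hadj⟩ := h
  · exact ⟨x, hx, y, hy, hadj⟩
  · obtain ⟨j, _, rfl⟩ := hadj
    obtain ⟨j', hj'⟩ := glue_exit hF' hy hv'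
    exact main j j' hx hj'
  · obtain ⟨j, _, rfl⟩ := hadj
    obtain ⟨j', hj'⟩ := glue_exit hF hx hv
    exact main j' j hj' hy
  · obtain ⟨j, hj⟩ := glue_exit hF hx hv
    obtain ⟨j', hj'⟩ := glue_exit hF' hy hv'
    exact main _ _ hj hj'

end


/-! Finite combinatorics of traces of minor models on the gadget: `g w i` says that branch set
`w` contains the `i`-th gadget vertex, `τ w j` that it contains the `j`-th triangle vertex. -/

structure Tr {W : Type*} (H : SimpleGraph W) (g τ : W → Fin 3 → Prop) (I : W → Prop) : Prop where
  dg : ∀ w w' i, g w i → g w' i → w = w'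
  dt : ∀ w w' i, τ w i → τ w' i → w = w'
  ne : ∀ w, I w → ∃ i, g w i
  it : ∀ w, I w → ∀ j, ¬ τ w j
  tc : ∀ s w, I s → ¬ I w → H.Adj s w → ∃ j, τ w j
  ad : ∀ s w, I s → H.Adj s w →
    ∃ i, g s i ∧ ((∃ k, k ≠ i ∧ g w k) ∨ ∃ j, j ≠ i ∧ τ w j)

section
variable {W : Type*} {H : SimpleGraph W} {g τ : W → Fin 3 → Prop} {I : W → Prop}

/-- No four pairwise distinct things inject into three. -/
theorem pig {ρ : W → Fin 3 → Prop} (d : ∀ w w' i, ρ w i → ρ w' i → w = w')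
    (a : Fin 4 → W) (ha : Function.Injective a) (h : ∀ i, ∃ j, ρ (a i) j) : False := by
  choose f hf using h
  have : Function.Injective f := by
    intro x y hxy
    apply ha
    refine d _ _ _ (hf x) ?_
    rw [hxy]; exact hf y
  have := Fintype.card_le_of_injective f this
  simp at this

/-- Three distinct things use up all three places, bijectively. -/
theorem bij3 {ρ : W → Fin 3 → Prop} (d : ∀ w w' i, ρ w i → ρ w' i → w = w')
    (a : Fin 3 → W) (ha : Function.Injective a) (h : ∀ i, ∃ j, ρ (a i) j) :
    ∃ σ : Fin 3 → Fin 3, Function.Bijective σ ∧ ∀ i w, ρ w (σ i) ↔ w = a i := by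
  choose f hf using h
  have hi : Function.Injective f := by
    intro x y hxy
    apply ha
    refine d _ _ _ (hf x) ?_
    rw [hxy]; exact hf y
  refine ⟨f, Finite.injective_iff_bijective.1 hi, fun i w => ⟨fun h => d _ _ _ h (hf i), ?_⟩⟩
  rintro rfl
  exact hf i

theorem trA (T : Tr H g τ I) {s s' : W} (hs : I s) (hs' : I s') (hss : s ≠ s')
    (P : Fin 3 → W) (hP : Function.Injective P) (hPI : ∀ i, ¬ I (P i))
    (h1 : ∀ i, H.Adj s (P i)) (h2 : ∀ i, H.Adj s' (P i)) : False := by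
  obtain ⟨σ, hσ, hh⟩ := bij3 T.dt P hP (fun i => T.tc _ _ hs (hPI i) (h1 i))
  obtain ⟨i, hi⟩ := T.ne s hs
  obtain ⟨i', hi'⟩ := T.ne s' hs'
  have hii : i ≠ i' := by
    rintro rfl
    exact hss (T.dg _ _ _ hi hi')
  obtain ⟨a, ha⟩ := hσ.2 i
  obtain ⟨a', ha'⟩ := hσ.2 i'
  have hone : ∀ b j, τ (P b) j → j = σ b := by
    intro b j hj
    obtain ⟨c, rfl⟩ := hσ.2 j
    have := (hh c (P b)).1 hj
    rw [hP this]
  obtain ⟨k, hk, hk'⟩ := T.ad s (P a) hs (h1 a)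
  obtain ⟨l, hl, hl'⟩ := T.ad s' (P a') hs' (h2 a')
  have d := T.dg
  have e1 : s ≠ P a := fun h => hPI a (h ▸ hs)
  have e2 : s ≠ P a' := fun h => hPI a' (h ▸ hs)
  have e3 : s' ≠ P a := fun h => hPI a (h ▸ hs')
  have e4 : s' ≠ P a' := fun h => hPI a' (h ▸ hs')
  have e5 : P a ≠ P a' := by
    intro h
    have := hP h
    apply hii
    rw [← ha, ← ha', this]
  have m1 : ∃ m, m ≠ i ∧ m ≠ i' ∧ (g s m ∨ g (P a) m) := by
    rcases hk' with ⟨m, hm, hgm⟩ | ⟨j, hj, hjt⟩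
    · refine ⟨m, ?_, ?_, Or.inr hgm⟩
      · rintro rfl; exact e1 (d _ _ _ hi hgm)
      · rintro rfl; exact e3 (d _ _ _ hi' hgm)
    · have := hone a j hjt
      refine ⟨k, ?_, ?_, Or.inl hk⟩
      · rintro rfl; exact hj (by rw [this, ha])
      · rintro rfl; exact hss (d _ _ _ hk hi')
  have m2 : ∃ m, m ≠ i ∧ m ≠ i' ∧ (g s' m ∨ g (P a') m) := by
    rcases hl' with ⟨m, hm, hgm⟩ | ⟨j, hj, hjt⟩
    · refine ⟨m, ?_, ?_, Or.inr hgm⟩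
      · rintro rfl; exact e2 (d _ _ _ hi hgm)
      · rintro rfl; exact e4 (d _ _ _ hi' hgm)
    · have := hone a' j hjt
      refine ⟨l, ?_, ?_, Or.inl hl⟩
      · rintro rfl; exact hss (d _ _ _ hi hl)
      · rintro rfl; exact hj (by rw [this, ha'])
  obtain ⟨m, hm1, hm2, hm⟩ := m1
  obtain ⟨m', hm1', hm2', hm'⟩ := m2
  have : m = m' := by
    clear * - hm1 hm2 hm1' hm2' hii
    omega
  subst this
  rcases hm with hm | hm <;> rcases hm' with hm' | hm'
  · exact hss (d _ _ _ hm hm')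
  · exact e2 (d _ _ _ hm hm')
  · exact e3 (d _ _ _ hm' hm)
  · exact e5 (d _ _ _ hm hm')

theorem in3 (T : Tr H g τ I) (s : Fin 3 → W) (hs : Function.Injective s) (hI : ∀ i, I (s i)) :
    ∃ σ : Fin 3 → Fin 3, Function.Bijective σ ∧
      ∀ i w, ¬ I w → H.Adj (s i) w → ∃ j, j ≠ σ i ∧ τ w j := by
  obtain ⟨σ, hσ, hh⟩ := bij3 T.dg s hs (fun i => T.ne _ (hI i))
  refine ⟨σ, hσ, fun i w hw hadj => ?_⟩
  obtain ⟨k, hk, hk'⟩ := T.ad _ _ (hI i) hadj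
  obtain ⟨c, rfl⟩ := hσ.2 k
  have hc : i = c := hs ((hh c _).1 hk)
  subst hc
  rcases hk' with ⟨m, _, hm⟩ | h
  · obtain ⟨c, rfl⟩ := hσ.2 m
    have := (hh c _).1 hm
    exact absurd (this ▸ hI c) hw
  · exact h

/-- Three inside sets, two of them with two common outside neighbours, plus another outside
set. -/
theorem trC (T : Tr H g τ I) (s : Fin 3 → W) (hs : Function.Injective s) (hI : ∀ i, I (s i))
    {P Q R : W} (hP : ¬ I P) (hQ : ¬ I Q) (hR : ¬ I R) (hPQ : P ≠ Q) (hPR : P ≠ R) (hQR : Q ≠ R)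
    (q0 : H.Adj (s 0) Q) (q1 : H.Adj (s 1) Q) (r0 : H.Adj (s 0) R) (r1 : H.Adj (s 1) R)
    (p2 : H.Adj (s 2) P) : False := by
  obtain ⟨σ, hσ, h⟩ := in3 T s hs hI
  obtain ⟨a, ha, ha'⟩ := h 0 Q hQ q0
  obtain ⟨b, hb, hb'⟩ := h 1 Q hQ q1
  obtain ⟨c, hc, hc'⟩ := h 0 R hR r0
  obtain ⟨d, hd, hd'⟩ := h 1 R hR r1
  obtain ⟨e, he, he'⟩ := h 2 P hP p2
  have D := T.dt
  have n01 : σ 0 ≠ σ 1 := fun h => absurd (hσ.1 h) (by decide)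
  have f : ∀ {w w' : W} {i j : Fin 3}, w ≠ w' → τ w i → τ w' j → i ≠ j := by
    intro w w' i j hne h1 h2 hij
    subst hij
    exact hne (D _ _ _ h1 h2)
  have := f hPQ he' ha'
  have := f hPQ he' hb'
  have := f hPR he' hc'
  have := f hPR he' hd'
  have := f hQR ha' hc'
  have := f hQR ha' hd'
  have := f hQR hb' hc'
  have := f hQR hb' hd'
  omega

theorem trB (T : Tr H g τ I) (s : Fin 3 → W) (hs : Function.Injective s) (hI : ∀ i, I (s i))
    {Q R : W} (hQ : ¬ I Q) (hR : ¬ I R) (hQR : Q ≠ R)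
    (q : ∀ i, H.Adj (s i) Q) (r : ∀ i, H.Adj (s i) R) : False := by
  obtain ⟨σ, hσ, h⟩ := in3 T s hs hI
  have h' : ∀ w, ¬ I w → (∀ i, H.Adj (s i) w) → ∃ x y, x ≠ y ∧ τ w x ∧ τ w y := by
    intro w hw hadj
    obtain ⟨x, _, hx⟩ := h 0 w hw (hadj 0)
    obtain ⟨i, rfl⟩ := hσ.2 x
    obtain ⟨y, hy, hy'⟩ := h i w hw (hadj i)
    exact ⟨_, y, hy.symm, hx, hy'⟩
  obtain ⟨a, b, hab, ha, hb⟩ := h' Q hQ q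
  obtain ⟨c, d, hcd, hc, hd⟩ := h' R hR r
  have f : ∀ {i j : Fin 3}, τ Q i → τ R j → i ≠ j := by
    intro i j h1 h2 hij
    subst hij
    exact hQR (T.dt _ _ _ h1 h2)
  have := f ha hc
  have := f ha hd
  have := f hb hc
  have := f hb hd
  omega

end

theorem trK5 {g τ : Fin 5 → Fin 3 → Prop} {I : Fin 5 → Prop}
    (T : Tr (SimpleGraph.completeGraph (Fin 5)) g τ I) {s : Fin 5} (hs : I s) : False := by
  classical
  have adj : ∀ {x y : Fin 5}, x ≠ y → (SimpleGraph.completeGraph (Fin 5)).Adj x y := fun h => h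
  obtain ⟨e, he⟩ : ∃ e : Fin 5 ≃ Fin 5, e 0 = s := ⟨Equiv.swap 0 s, by simp⟩
  subst he
  have inj4 : ∀ (a b c d : Fin 5), a ≠ b → a ≠ c → a ≠ d → b ≠ c → b ≠ d → c ≠ d →
      Function.Injective ![e a, e b, e c, e d] := by
    intro a b c d h1 h2 h3 h4 h5 h6 x y hxy
    fin_cases x <;> fin_cases y <;> simp_all
  have inj3 : ∀ (a b c : Fin 5), a ≠ b → a ≠ c → b ≠ c →
      Function.Injective ![e a, e b, e c] := by
    intro a b c h1 h2 h4 x y hxy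
    fin_cases x <;> fin_cases y <;> simp_all
  have E : ∀ (a b c : Fin 5), 0 ≠ a → 0 ≠ b → 0 ≠ c → a ≠ b → a ≠ c → b ≠ c →
      I (e a) → I (e b) → I (e c) → False := by
    intro a b c h1 h2 h3 h4 h5 h6 i1 i2 i3
    refine pig T.dg _ (inj4 0 a b c h1 h2 h3 h4 h5 h6) ?_
    intro i
    fin_cases i
    exacts [T.ne _ hs, T.ne _ i1, T.ne _ i2, T.ne _ i3]
  have B : ∀ (a b c d : Fin 5), 0 ≠ a → 0 ≠ b → 0 ≠ c → 0 ≠ d → a ≠ b → a ≠ c → a ≠ d → b ≠ c →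
      b ≠ d → c ≠ d → I (e a) → I (e b) → ¬ I (e c) → ¬ I (e d) → False := by
    intro a b c d h1 h2 h3 h4 h5 h6 h7 h8 h9 h10 i1 i2 i3 i4
    refine trB T _ (inj3 0 a b h1 h2 h5) ?_ i3 i4 (e.injective.ne h10) ?_ ?_
    · intro i; fin_cases i
      exacts [hs, i1, i2]
    · intro i; fin_cases i
      exacts [adj (e.injective.ne h3), adj (e.injective.ne h6), adj (e.injective.ne h8)]
    · intro i; fin_cases i
      exacts [adj (e.injective.ne h4), adj (e.injective.ne h7), adj (e.injective.ne h9)]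
  have A : ∀ (a b c d : Fin 5), 0 ≠ a → 0 ≠ b → 0 ≠ c → 0 ≠ d → a ≠ b → a ≠ c → a ≠ d → b ≠ c →
      b ≠ d → c ≠ d → I (e a) → ¬ I (e b) → ¬ I (e c) → ¬ I (e d) → False := by
    intro a b c d h1 h2 h3 h4 h5 h6 h7 h8 h9 h10 i1 i2 i3 i4
    refine trA T hs i1 (e.injective.ne h1) _ (inj3 b c d h8 h9 h10) ?_ ?_ ?_
    · intro i; fin_cases i
      exacts [i2, i3, i4]
    · intro i; fin_cases i
      exacts [adj (e.injective.ne h2), adj (e.injective.ne h3), adj (e.injective.ne h4)]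
    · intro i; fin_cases i
      exacts [adj (e.injective.ne h5), adj (e.injective.ne h6), adj (e.injective.ne h7)]
  have D : ¬ I (e 1) → ¬ I (e 2) → ¬ I (e 3) → ¬ I (e 4) → False := by
    intro i1 i2 i3 i4
    refine pig T.dt _ (inj4 1 2 3 4 (by decide) (by decide) (by decide) (by decide) (by decide)
      (by decide)) ?_
    have : ∀ a, 0 ≠ a → ¬ I (e a) → ∃ j, τ (e a) j := fun a ha hI =>
      T.tc _ _ hs hI (adj (e.injective.ne ha))
    intro i; fin_cases i
    exacts [this 1 (by decide) i1, this 2 (by decide) i2, this 3 (by decide) i3,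
      this 4 (by decide) i4]
  by_cases i1 : I (e 1) <;> by_cases i2 : I (e 2) <;> by_cases i3 : I (e 3) <;>
    by_cases i4 : I (e 4)
  · exact E 1 2 3 (by decide) (by decide) (by decide) (by decide) (by decide) (by decide) i1 i2 i3
  · exact E 1 2 3 (by decide) (by decide) (by decide) (by decide) (by decide) (by decide) i1 i2 i3
  · exact E 1 2 4 (by decide) (by decide) (by decide) (by decide) (by decide) (by decide) i1 i2 i4
  · apply B 1 2 3 4 <;> first | decide | assumption
  · exact E 1 3 4 (by decide) (by decide) (by decide) (by decide) (by decide) (by decide) i1 i3 i4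
  · apply B 1 3 2 4 <;> first | decide | assumption
  · apply B 1 4 2 3 <;> first | decide | assumption
  · apply A 1 2 3 4 <;> first | decide | assumption
  · exact E 2 3 4 (by decide) (by decide) (by decide) (by decide) (by decide) (by decide) i2 i3 i4
  · apply B 2 3 1 4 <;> first | decide | assumption
  · apply B 2 4 1 3 <;> first | decide | assumption
  · apply A 2 1 3 4 <;> first | decide | assumption
  · apply B 3 4 1 2 <;> first | decide | assumption
  · apply A 3 1 2 4 <;> first | decide | assumption
  · apply A 4 1 2 3 <;> first | decide | assumption
  · exact D i1 i2 i3 i4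

/-- For `K_{3,3}`: exactly one branch set is inside. -/
theorem trK33 {W : Type*} {H : SimpleGraph W} {g τ : W → Fin 3 → Prop} {I : W → Prop}
    (T : Tr H g τ I) (A B : Fin 3 → W) (hA : Function.Injective A) (hB : Function.Injective B)
    (hAB : ∀ i j, A i ≠ B j) (adj : ∀ i j, H.Adj (A i) (B j)) {a : Fin 3} (ha : I (A a)) :
    (∀ i, i ≠ a → ¬ I (A i)) ∧ ∀ j, ¬ I (B j) := by
  have hBI : ∀ j, ¬ I (B j) := by
    intro b hb
    obtain ⟨a1, a2, h1, h2, h3⟩ : ∃ x y : Fin 3, a ≠ x ∧ a ≠ y ∧ x ≠ y := by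
      clear * -
      revert a; decide
    obtain ⟨b1, b2, k1, k2, k3⟩ : ∃ x y : Fin 3, b ≠ x ∧ b ≠ y ∧ x ≠ y := by
      clear * -
      revert b; decide
    have h1' := hA.ne h1
    have h2' := hA.ne h2
    have h3' := hA.ne h3
    have k1' := hB.ne k1
    have k2' := hB.ne k2
    have k3' := hB.ne k3
    have inj4 : ∀ (a b c d : W), a ≠ b → a ≠ c → a ≠ d → b ≠ c → b ≠ d → c ≠ d →
        Function.Injective ![a, b, c, d] := by
      intro a b c d h1 h2 h3 h4 h5 h6 x y hxy
      fin_cases x <;> fin_cases y <;> simp_all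
    have inj3 : ∀ (a b c : W), a ≠ b → a ≠ c → b ≠ c →
        Function.Injective ![a, b, c] := by
      intro a b c h1 h2 h4 x y hxy
      fin_cases x <;> fin_cases y <;> simp_all
    have E : ∀ x y : W, I x → I y → A a ≠ x → A a ≠ y → B b ≠ x → B b ≠ y → x ≠ y → False := by
      intro x y ix iy n1 n2 n3 n4 n5
      refine pig T.dg _ (inj4 (A a) (B b) x y (hAB _ _) n1 n2 n3 n4 n5) ?_
      intro i; fin_cases i
      exacts [T.ne _ ha, T.ne _ hb, T.ne _ ix, T.ne _ iy]
    have CA : ∀ x y, I (A x) → ¬ I (A y) → ¬ I (B b1) → ¬ I (B b2) → A a ≠ A x → False := by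
      intro x y ix iy i1 i2 n
      refine trC T ![A a, A x, B b] (inj3 _ _ _ n (hAB _ _) (hAB _ _)) ?_ iy i1 i2
        (hAB _ _) (hAB _ _) k3' (adj _ _) (adj _ _) (adj _ _) (adj _ _) (adj _ _).symm
      intro i; fin_cases i
      exacts [ha, ix, hb]
    have CB : ∀ x y, I (B x) → ¬ I (B y) → ¬ I (A a1) → ¬ I (A a2) → B b ≠ B x → False := by
      intro x y ix iy i1 i2 n
      refine trC T ![B b, B x, A a] (inj3 _ _ _ n (hAB _ _).symm (hAB _ _).symm) ?_ iy i1 i2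
        (hAB _ _).symm (hAB _ _).symm h3' (adj _ _).symm (adj _ _).symm (adj _ _).symm
        (adj _ _).symm (adj _ _)
      intro i; fin_cases i
      exacts [hb, ix, ha]
    by_cases i1 : I (A a1)
    · by_cases i2 : I (A a2)
      · exact E _ _ i1 i2 h1' h2' (hAB _ _).symm (hAB _ _).symm h3'
      by_cases j1 : I (B b1)
      · exact E _ _ i1 j1 h1' (hAB _ _) (hAB _ _).symm k1' (hAB _ _)
      by_cases j2 : I (B b2)
      · exact E _ _ i1 j2 h1' (hAB _ _) (hAB _ _).symm k2' (hAB _ _)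
      exact CA a1 a2 i1 i2 j1 j2 h1'
    by_cases i2 : I (A a2)
    · by_cases j1 : I (B b1)
      · exact E _ _ i2 j1 h2' (hAB _ _) (hAB _ _).symm k1' (hAB _ _)
      by_cases j2 : I (B b2)
      · exact E _ _ i2 j2 h2' (hAB _ _) (hAB _ _).symm k2' (hAB _ _)
      exact CA a2 a1 i2 i1 j1 j2 h2'
    by_cases j1 : I (B b1)
    · by_cases j2 : I (B b2)
      · exact E _ _ j1 j2 (hAB _ _) (hAB _ _) k1' k2' k3'
      exact CB b1 b2 j1 j2 i1 i2 k1'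
    by_cases j2 : I (B b2)
    · exact CB b2 b1 j2 j1 i1 i2 k2'
    refine pig T.dt _ (inj4 (A a1) (A a2) (B b1) (B b2) h3' (hAB _ _) (hAB _ _) (hAB _ _)
      (hAB _ _) k3') ?_
    intro i; fin_cases i
    exacts [T.tc _ _ hb i1 (adj _ _).symm, T.tc _ _ hb i2 (adj _ _).symm,
      T.tc _ _ ha j1 (adj _ _), T.tc _ _ ha j2 (adj _ _)]
  refine ⟨fun i hi hI => ?_, hBI⟩
  exact trA T ha hI (hA.ne hi.symm) B hB hBI (adj a) (adj i)

/-! Planarity of the glued graph. -/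

theorem glue_tr {V W : Type*} {G : SimpleGraph V} {t : Fin 3 → V}
    (H : SimpleGraph W) (f : W → Set (V ⊕ Fin 3)) (h1 : ∀ w, (f w).Nonempty)
    (h2 : ∀ w, CN (glue G t) (f w)) (h3 : ∀ w w', w ≠ w' → ∀ v, v ∈ f w → v ∉ f w')
    (h4 : ∀ w w', H.Adj w w' → ∃ u ∈ f w, ∃ v ∈ f w', (glue G t).Adj u v) :
    Tr H (fun w i => Sum.inr i ∈ f w) (fun w j => Sum.inl (t j) ∈ f w)
      (fun w => ∀ v, Sum.inl v ∉ f w) where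
  dg w w' i hw hw' := by
    by_contra hne
    exact h3 w w' hne _ hw hw'
  dt w w' i hw hw' := by
    by_contra hne
    exact h3 w w' hne _ hw hw'
  ne w hw := by
    obtain ⟨v | i, hx⟩ := h1 w
    · exact absurd hx (hw v)
    · exact ⟨i, hx⟩
  it w hw j := hw _
  tc s w hs hw hadj := by
    push Not at hw
    obtain ⟨v, hv⟩ := hw
    obtain ⟨x | i, hx, y | k, hy, ha⟩ := h4 s w hadj
    · exact absurd hx (hs x)
    · exact absurd hx (hs x)
    · obtain ⟨j, _, rfl⟩ := ha
      exact ⟨j, hy⟩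
    · exact glue_exit (h2 w) hy hv
  ad s w hs hadj := by
    obtain ⟨x | i, hx, y | k, hy, ha⟩ := h4 s w hadj
    · exact absurd hx (hs x)
    · exact absurd hx (hs x)
    · obtain ⟨j, hj, rfl⟩ := ha
      exact ⟨i, hx, Or.inr ⟨j, hj, hy⟩⟩
    · exact ⟨i, hx, Or.inl ⟨k, Ne.symm ha, hy⟩⟩

/-- If no branch set is inside the gadget, we get a minor of `G`. -/
theorem glue_outside {V W : Type*} {G : SimpleGraph V} {t : Fin 3 → V}
    (ht : ∀ i j, i ≠ j → G.Adj (t i) (t j))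
    (H : SimpleGraph W) (f : W → Set (V ⊕ Fin 3))
    (h2 : ∀ w, CN (glue G t) (f w)) (h3 : ∀ w w', w ≠ w' → ∀ v, v ∈ f w → v ∉ f w')
    (h4 : ∀ w w', H.Adj w w' → ∃ u ∈ f w, ∃ v ∈ f w', (glue G t).Adj u v)
    (ho : ∀ w, ∃ v, Sum.inl v ∈ f w) : H.IsMinor G := by
  rw [minor_iff]
  refine ⟨fun w => Sum.inl ⁻¹' f w, ho, fun w => glue_restrict ht (h2 w),
    fun w w' h v => h3 w w' h _, ?_⟩
  intro w w' hadj
  obtain ⟨v, hv⟩ := ho w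
  obtain ⟨v', hv'⟩ := ho w'
  have htch := h4 w w' hadj
  exact glue_tch ht (h2 w) (h2 w') hv hv' (h3 _ _ hadj.ne) htch

/-- The case of `K_{3,3}` with a branch set inside the gadget. -/
theorem glue_k33_inside {V W : Type*} [Finite V] {G : SimpleGraph V} (hG : G.Planar)
    {t : Fin 3 → V}
    (ht : ∀ i j, i ≠ j → G.Adj (t i) (t j)) (hX : CN G (Set.range t)ᶜ)
    (H : SimpleGraph W) (f : W → Set (V ⊕ Fin 3)) (h1 : ∀ w, (f w).Nonempty)
    (h2 : ∀ w, CN (glue G t) (f w)) (h3 : ∀ w w', w ≠ w' → ∀ v, v ∈ f w → v ∉ f w')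
    (h4 : ∀ w w', H.Adj w w' → ∃ u ∈ f w, ∃ v ∈ f w', (glue G t).Adj u v)
    (A B : Fin 3 → W) (hA : Function.Injective A) (hB : Function.Injective B)
    (hAB : ∀ i j, A i ≠ B j) (adj : ∀ i j, H.Adj (A i) (B j)) {a : Fin 3}
    (ha : ∀ v, Sum.inl v ∉ f (A a)) : False := by
  have T := glue_tr H f h1 h2 h3 h4
  obtain ⟨hAI, hBI⟩ := trK33 T A B hA hB hAB adj ha
  obtain ⟨σ, hσ, hh⟩ := bij3 T.dt B hB (fun j => T.tc _ _ ha (hBI j) (adj a j))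
  obtain ⟨a1, a2, n1, n2, n3⟩ : ∃ x y : Fin 3, x ≠ a ∧ y ≠ a ∧ x ≠ y := by
    clear * -
    revert a; decide
  have o1 := hAI a1 n1
  have o2 := hAI a2 n2
  push Not at o1 o2
  have oB := hBI
  push Not at oB
  obtain ⟨ρ, hρ⟩ := hσ.2.hasRightInverse
  have hρi : Function.Injective ρ := hρ.injective
  obtain ⟨v1, hv1⟩ := o1
  obtain ⟨v2, hv2⟩ := o2
  have tA : ∀ (x : Fin 3) (v : V), Sum.inl v ∈ f (A x) → ∀ j,
      Tch G (Sum.inl ⁻¹' f (A x)) (Sum.inl ⁻¹' f (B (ρ j))) := by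
    intro x v hv j
    obtain ⟨w, hw⟩ := oB (ρ j)
    exact glue_tch ht (h2 _) (h2 _) hv hw (h3 _ _ (hAB _ _)) (h4 _ _ (adj _ _))
  refine rooted_aux hG t ht hX _ (Sum.inl ⁻¹' f (A a1)) (Sum.inl ⁻¹' f (A a2))
    (fun j => Sum.inl ⁻¹' f (B (ρ j))) rfl ⟨v1, hv1⟩ ⟨v2, hv2⟩ (glue_restrict ht (h2 _))
    (glue_restrict ht (h2 _)) ?_ (fun j => glue_restrict ht (h2 _)) ?_ ?_ ?_ ?_
    (tA a1 v1 hv1) (tA a2 v2 hv2)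
  · intro j
    have := (hh (ρ j) _).2 rfl
    rw [hρ j] at this
    exact this
  · exact fun i j hij v => h3 _ _ (hB.ne (hρi.ne hij)) _
  · exact fun j v => h3 _ _ (hAB _ _) _
  · exact fun j v => h3 _ _ (hAB _ _) _
  · exact fun v => h3 _ _ (hA.ne n3) _

theorem glue_planar {V : Type*} [Finite V] {G : SimpleGraph V} (hG : G.Planar) {t : Fin 3 → V}
    (ht : ∀ i j, i ≠ j → G.Adj (t i) (t j)) (hX : CN G (Set.range t)ᶜ) : (glue G t).Planar := by
  constructor
  · rw [minor_iff]
    rintro ⟨f, h1, h2, h3, h4⟩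
    by_cases ho : ∀ w, ∃ v, Sum.inl v ∈ f w
    · exact hG.1 (glue_outside ht _ f h2 h3 h4 ho)
    · push Not at ho
      obtain ⟨s, hs⟩ := ho
      exact trK5 (glue_tr _ f h1 h2 h3 h4) hs
  · rw [minor_iff]
    rintro ⟨f, h1, h2, h3, h4⟩
    by_cases ho : ∀ w, ∃ v, Sum.inl v ∈ f w
    · exact hG.2 (glue_outside ht _ f h2 h3 h4 ho)
    · push Not at ho
      obtain ⟨s | s, hs⟩ := ho
      · exact glue_k33_inside hG ht hX _ f h1 h2 h3 h4 Sum.inl Sum.inr Sum.inl_injective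
          Sum.inr_injective (by simp) (by simp) hs
      · exact glue_k33_inside hG ht hX _ f h1 h2 h3 h4 Sum.inr Sum.inl Sum.inr_injective
          Sum.inl_injective (by simp) (by simp) hs

/-! Facial vertex sets. -/

/-- The vertex set of a facial triangle. -/
def FacialSet {V : Type*} (G : SimpleGraph V) (S : Set V) : Prop :=
  ∃ t : Fin 3 → V, S = Set.range t ∧ (∀ i j, i ≠ j → G.Adj (t i) (t j)) ∧ CN G Sᶜ

theorem facial_glue {V : Type*} [Finite V] {G : SimpleGraph V} {t : Fin 3 → V}
    (ht : ∀ i j, i ≠ j → G.Adj (t i) (t j)) {S : Set V}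
    (hS : FacialSet G S) (hne : S ≠ Set.range t) : FacialSet (glue G t) (Sum.inl '' S) := by
  obtain ⟨t', hSt, ht', hc⟩ := hS
  have inj : ∀ {t : Fin 3 → V}, (∀ i j, i ≠ j → G.Adj (t i) (t j)) → Function.Injective t := by
    intro t ht i j hij
    by_contra hne
    exact (ht i j hne).ne hij
  obtain ⟨j, hj⟩ : ∃ j, t j ∉ S := by
    by_contra hcon
    push Not at hcon
    apply hne
    symm
    apply Set.eq_of_subset_of_ncard_le
    · rintro _ ⟨j, rfl⟩; exact hcon j
    · rw [hSt, Set.ncard_range_of_injective (inj ht), Set.ncard_range_of_injective (inj ht')]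
    · exact Set.toFinite _
  have hR : ∀ i, (Sum.inr i : V ⊕ Fin 3) ∈ (Sum.inl '' S)ᶜ := by
    rintro i ⟨x, _, hx⟩
    cases hx
  have hL : ∀ v, v ∉ S → (Sum.inl v : V ⊕ Fin 3) ∈ (Sum.inl '' S)ᶜ := by
    rintro v hv ⟨x, hxS, hx⟩
    cases hx
    exact hv hxS
  refine ⟨Sum.inl ∘ t', ?_, ht', ?_⟩
  · rw [hSt, Set.range_comp]
  · refine cn_base (Sum.inl (t j)) (hL _ hj) ?_
    intro U hU hcl
    have i1 : ∀ i, i ≠ j → (Sum.inr i : V ⊕ Fin 3) ∈ U := fun i hi =>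
      hcl _ hU (hL _ hj) _ (hR i) ⟨j, hi.symm, rfl⟩
    have hex : ∃ i : Fin 3, i ≠ j := by
      clear * -
      revert j; decide
    have i2 : (Sum.inr j : V ⊕ Fin 3) ∈ U := by
      obtain ⟨i, hi⟩ := hex
      exact hcl _ (i1 i hi) (hR i) _ (hR j) hi
    rintro (v | i) hx
    · have := hc (Sum.inl ⁻¹' U) ⟨t j, hj, hU⟩ (by
        intro x hx hxS y hyS hadj
        exact hcl _ hx (hL x hxS) _ (hL y hyS) hadj)
      exact this (fun hv => hx ⟨v, hv, rfl⟩)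
    · by_cases hi : i = j
      · rw [hi]; exact i2
      · exact i1 i hi

/-! The orientation of the gadget. -/

def orient {V : Type*} (A : V → V → Prop) (t : Fin 3 → V) : V ⊕ Fin 3 → V ⊕ Fin 3 → Prop
  | Sum.inl u, Sum.inl v => A u v
  | Sum.inl u, Sum.inr i => ∃ j, j ≠ i ∧ u = t j ∧ A (t (-(i + j))) (t j)
  | Sum.inr i, Sum.inl u => ∃ j, j ≠ i ∧ u = t j ∧ A (t j) (t (-(i + j)))
  | Sum.inr i, Sum.inr j => j = i + 1

theorem orient_ok {V : Type*} {G : SimpleGraph V} {A : V → V → Prop} (hA : IsOrientation G A)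
    {t : Fin 3 → V} (ht : ∀ i j, i ≠ j → G.Adj (t i) (t j)) :
    IsOrientation (glue G t) (orient A t) := by
  have inj : Function.Injective t := by
    intro i j hij
    by_contra hne
    exact (ht i j hne).ne hij
  have third : ∀ i j : Fin 3, j ≠ i → j ≠ -(i + j) := by decide
  constructor
  · rintro (u | i) (v | k) h h'
    · exact hA.1 u v h h'
    · obtain ⟨j, hj, rfl, hjA⟩ := h
      obtain ⟨j', hj', he, hjA'⟩ := h'
      have := inj he
      subst this
      exact hA.1 _ _ hjA hjA'
    · obtain ⟨j, hj, rfl, hjA⟩ := h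
      obtain ⟨j', hj', he, hjA'⟩ := h'
      have := inj he
      subst this
      exact hA.1 _ _ hjA hjA'
    · have e1 : k = i + 1 := h
      have e2 : i = k + 1 := h'
      subst e1
      revert e2; clear * -; revert i; decide
  · have mix : ∀ u i, (∃ j, j ≠ i ∧ u = t j) ↔
        ((∃ j, j ≠ i ∧ u = t j ∧ A (t (-(i + j))) (t j)) ∨
          ∃ j, j ≠ i ∧ u = t j ∧ A (t j) (t (-(i + j)))) := by
      intro u i
      constructor
      · rintro ⟨j, hj, rfl⟩
        rcases (hA.2 _ _).1 (ht _ _ (third i j hj)) with h | h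
        · exact Or.inr ⟨j, hj, rfl, h⟩
        · exact Or.inl ⟨j, hj, rfl, h⟩
      · rintro (⟨j, hj, rfl, _⟩ | ⟨j, hj, rfl, _⟩) <;> exact ⟨j, hj, rfl⟩
    rintro (u | i) (v | k)
    · exact hA.2 u v
    · exact mix u k
    · exact (mix v i).trans or_comm
    · change i ≠ k ↔ k = i + 1 ∨ i = k + 1
      revert i k; decide

theorem orient_forces {V : Type*} {G : SimpleGraph V} {A : V → V → Prop} (hA : IsOrientation G A)
    {t : Fin 3 → V} (ht : ∀ i j, i ≠ j → G.Adj (t i) (t j)) {c : V ⊕ Fin 3 → Fin 2}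
    (hc : IsAcyclicColoring (orient A t) 2 c) (κ : Fin 2) : ¬ ∀ j, c (Sum.inl (t j)) = κ := by
  intro hm
  have cyc : ∀ x y z, c x = c y → c y = c z → orient A t x y → orient A t y z →
      orient A t z x → False := by
    intro x y z h1 h2 a1 a2 a3
    refine hc (c x) x rfl ?_
    refine Relation.TransGen.tail (Relation.TransGen.tail (Relation.TransGen.single
      ⟨rfl, h1.symm, a1⟩) ⟨h1.symm, (h1.trans h2).symm, a2⟩) ⟨(h1.trans h2).symm, rfl, a3⟩
  have hg : ∀ i, c (Sum.inr i) ≠ κ := by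
    intro i hi
    have key : ∀ j k : Fin 3, j ≠ i → k ≠ i → -(i + j) = k → -(i + k) = j →
        A (t j) (t k) → False := by
      intro j k hj hk e1 e2 h
      refine cyc (Sum.inl (t j)) (Sum.inl (t k)) (Sum.inr i) (by rw [hm, hm]) (by rw [hm, hi])
        h ⟨k, hk, rfl, by rw [e2]; exact h⟩ ⟨j, hj, rfl, by rw [e1]; exact h⟩
    obtain ⟨j, k, hj, hk, hjk, e1, e2⟩ : ∃ j k : Fin 3, j ≠ i ∧ k ≠ i ∧ j ≠ k ∧
        -(i + j) = k ∧ -(i + k) = j := by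
      clear * -
      revert i; decide
    rcases (hA.2 _ _).1 (ht j k hjk) with h | h
    · exact key j k hj hk e1 e2 h
    · exact key k j hk hj e2 e1 h
  have same : ∀ i j, c (Sum.inr i) = c (Sum.inr j) := by
    intro i j
    have h1 := hg i
    have h2 := hg j
    omega
  exact cyc (Sum.inr 0) (Sum.inr 1) (Sum.inr 2) (same _ _) (same _ _) rfl rfl rfl

theorem orient_restrict {V : Type*} {A : V → V → Prop} {t : Fin 3 → V} {c : V ⊕ Fin 3 → Fin 2}
    (hc : IsAcyclicColoring (orient A t) 2 c) : IsAcyclicColoring A 2 (c ∘ Sum.inl) := by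
  intro i v hv h
  refine hc i (Sum.inl v) hv ?_
  have h' : Relation.TransGen (fun a b => c (Sum.inl a) = i ∧ c (Sum.inl b) = i ∧ A a b) v v := h
  refine Relation.TransGen.lift Sum.inl ?_ v v h'
  intro a b hab
  exact hab

theorem main_induction
    (NL : ∀ (V : Type) [Finite V] (G : SimpleGraph V), G.Planar →
      ∀ A : V → V → Prop, IsOrientation G A → ∃ c : V → Fin 2, IsAcyclicColoring A 2 c)
    (n : ℕ) : ∀ (V : Type) [Finite V] (G : SimpleGraph V), G.Planar →
      ∀ A : V → V → Prop, IsOrientation G A → ∀ L : List (Set V), L.length = n → L.Nodup →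
      (∀ S ∈ L, FacialSet G S) →
      ∃ c : V → Fin 2, IsAcyclicColoring A 2 c ∧ ∀ S ∈ L, ∀ κ, ¬ ∀ v ∈ S, c v = κ := by
  induction n with
  | zero =>
    intro V _ G hG A hA L hL _ _
    obtain ⟨c, hc⟩ := NL V G hG A hA
    refine ⟨c, hc, ?_⟩
    rw [List.length_eq_zero_iff] at hL
    subst hL
    simp
  | succ n ih =>
    intro V _ G hG A hA L hL hnd hF
    match L, hL, hnd, hF with
    | S :: L, hL, hnd, hF =>
      obtain ⟨t, hS, ht, hX⟩ := hF S (by simp)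
      subst hS
      rw [List.nodup_cons] at hnd
      obtain ⟨c, hc, hcL⟩ := ih (V ⊕ Fin 3) (glue G t) (glue_planar hG ht hX) (orient A t)
        (orient_ok hA ht) (L.map (fun S => Sum.inl '' S)) (by simpa using hL)
        (hnd.2.map (Set.image_injective.2 Sum.inl_injective)) (by
          intro S' hS'
          rw [List.mem_map] at hS'
          obtain ⟨S, hSL, rfl⟩ := hS'
          refine facial_glue ht (hF S (List.mem_cons_of_mem _ hSL)) ?_
          rintro rfl
          exact hnd.1 hSL)
      refine ⟨c ∘ Sum.inl, orient_restrict hc, ?_⟩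
      intro S hSm κ hmono
      rcases List.mem_cons.1 hSm with rfl | hSL
      · exact orient_forces hA ht hc κ (fun j => hmono _ ⟨j, rfl⟩)
      · refine hcL _ (List.mem_map.2 ⟨S, hSL, rfl⟩) κ ?_
        rintro _ ⟨v, hv, rfl⟩
        exact hmono v hv

/-- if every planar digraph is acyclically 2-colourable, then every oriented
planar triangulation has an acyclic 2-colouring without monochromatic facial triangles. -/
theorem stmt_9
    (NL : ∀ (V : Type) [Finite V] (G : SimpleGraph V), G.Planar →
      ∀ A : V → V → Prop, IsOrientation G A → ∃ c : V → Fin 2, IsAcyclicColoring A 2 c)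
    (V : Type) [Finite V] (T : SimpleGraph V) (hT : IsPlanarTriangulation T)
    (A : V → V → Prop) (hA : IsOrientation T A) :
    ∃ c : V → Fin 2, IsAcyclicColoring A 2 c ∧
      ∀ a b d : V, IsFacialTriangle T a b d → ¬ (c a = c b ∧ c b = c d) := by
  have hfin : {S : Set V | FacialSet T S}.Finite := Set.toFinite _
  obtain ⟨c, hc, hcF⟩ := main_induction NL _ V T hT.2.1 A hA hfin.toFinset.toList rfl
    (Finset.nodup_toList _) (by
      intro S hS
      simpa using hS)
  refine ⟨c, hc, ?_⟩
  rintro a b d ⟨⟨hab, had, hbd⟩, hpre⟩ ⟨e1, e2⟩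
  have hset : {v | v ≠ a ∧ v ≠ b ∧ v ≠ d} = (Set.range ![a, b, d])ᶜ := by
    ext v
    simp [eq_comm]
    tauto
  have hfac : FacialSet T (Set.range ![a, b, d]) := by
    refine ⟨![a, b, d], rfl, ?_, ?_⟩
    · intro i j hij
      fin_cases i <;> fin_cases j <;> first
        | exact absurd rfl hij
        | exact hab
        | exact hab.symm
        | exact had
        | exact had.symm
        | exact hbd
        | exact hbd.symm
    · rw [← hset]
      exact (cn_iff _ _).1 hpre
  refine hcF (Set.range ![a, b, d]) (by
    rw [Finset.mem_toList, Set.Finite.mem_toFinset]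
    exact hfac) (c d) ?_
  rintro _ ⟨i, rfl⟩
  fin_cases i
  · exact e1.trans e2
  · exact e2
  · rfl
end

section
/- Suppose every orientation of every planar triangulation admits an acyclic 2-colouring with no monochromatic facial triangle. Then for every planar triangulation T, every facial triangle a1a2a3 of T, every non-monochromatic pre-colouring p : {a1,a2,a3} → {1,2}, and every orientation of T, there exists an acyclic 2-colouring with no monochromatic facial triangle extending p. -/
namespace P10

/-- Cut version of connectedness of a vertex set. -/
def Cn {V : Type*} (G : SimpleGraph V) (s : Set V) : Prop :=
  ∀ P : Set V, (∃ x ∈ s, x ∈ P) → (∃ y ∈ s, y ∉ P) →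
    ∃ a ∈ s, ∃ b ∈ s, a ∈ P ∧ b ∉ P ∧ G.Adj a b

theorem cn_iff {V : Type*} (G : SimpleGraph V) (s : Set V) :
    (G.induce s).Preconnected ↔ Cn G s := by
  constructor
  · rintro h P ⟨x, hx, hxP⟩ ⟨y, hy, hyP⟩
    obtain ⟨w⟩ := h ⟨x, hx⟩ ⟨y, hy⟩
    obtain ⟨d, -, h1, h2⟩ := w.exists_boundary_dart {z | z.1 ∈ P} hxP hyP
    exact ⟨d.fst.1, d.fst.2, d.snd.1, d.snd.2, h1, h2, d.adj⟩
  · intro h x y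
    by_contra hxy
    obtain ⟨a, ha, b, hb, ⟨ha', hra⟩, hbP, hab⟩ :=
      h {z | ∃ hz : z ∈ s, (G.induce s).Reachable x ⟨z, hz⟩}
        ⟨x.1, x.2, x.2, SimpleGraph.Reachable.refl _⟩ ⟨y.1, y.2, fun ⟨_, h⟩ => hxy h⟩
    exact hbP ⟨hb, hra.trans (SimpleGraph.Adj.reachable (G := G.induce s)
      (u := ⟨a, ha⟩) (v := ⟨b, hb⟩) hab)⟩

theorem conn_iff {V : Type*} (G : SimpleGraph V) (s : Set V) (hs : s.Nonempty) :
    (G.induce s).Connected ↔ Cn G s := by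
  rw [← cn_iff]
  constructor
  · exact fun h => h.preconnected
  · intro h
    have : Nonempty s := hs.to_subtype
    exact ⟨h⟩

theorem Cn.union {V : Type*} {G : SimpleGraph V} {s t : Set V} (hs : Cn G s) (ht : Cn G t)
    {a b : V} (ha : a ∈ s) (hb : b ∈ t) (hab : G.Adj a b) : Cn G (s ∪ t) := by
  rintro P ⟨x, hx, hxP⟩ ⟨y, hy, hyP⟩
  by_cases h1 : (∃ x ∈ s, x ∈ P) ∧ (∃ y ∈ s, y ∉ P)
  · obtain ⟨a, ha, b, hb, h⟩ := hs P h1.1 h1.2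
    exact ⟨a, Or.inl ha, b, Or.inl hb, h⟩
  by_cases h2 : (∃ x ∈ t, x ∈ P) ∧ (∃ y ∈ t, y ∉ P)
  · obtain ⟨a, ha, b, hb, h⟩ := ht P h2.1 h2.2
    exact ⟨a, Or.inr ha, b, Or.inr hb, h⟩
  by_cases h3 : a ∈ P
  · refine ⟨a, Or.inl ha, b, Or.inr hb, h3, ?_, hab⟩
    intro h4
    rcases hy with hy | hy
    · exact h1 ⟨⟨a, ha, h3⟩, ⟨y, hy, hyP⟩⟩
    · exact h2 ⟨⟨b, hb, h4⟩, ⟨y, hy, hyP⟩⟩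
  · refine ⟨b, Or.inr hb, a, Or.inl ha, ?_, h3, hab.symm⟩
    by_contra h4
    rcases hx with hx | hx
    · exact h1 ⟨⟨x, hx, hxP⟩, ⟨a, ha, h3⟩⟩
    · exact h2 ⟨⟨x, hx, hxP⟩, ⟨b, hb, h4⟩⟩

theorem cn_singleton {V : Type*} (G : SimpleGraph V) (x : V) : Cn G {x} := by
  rintro P ⟨a, rfl, h⟩ ⟨b, rfl, hb⟩
  exact absurd h hb

/-- The component of `a` inside the set `R`. -/
theorem exists_component {V : Type*} (G : SimpleGraph V) (R : Set V) (a : V) (ha : a ∈ R) :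
    ∃ Z ⊆ R, a ∈ Z ∧ Cn G Z ∧ ∀ z ∈ Z, ∀ y ∈ R, G.Adj z y → y ∈ Z := by
  let r : V → V → Prop := fun x y => y ∈ R ∧ G.Adj x y
  refine ⟨{z | Relation.ReflTransGen r a z}, ?_, Relation.ReflTransGen.refl, ?_, ?_⟩
  · intro z hz
    rcases Relation.ReflTransGen.cases_tail hz with h | ⟨c, -, h⟩
    · exact h ▸ ha
    · exact h.1
  · have key : ∀ P : Set V, a ∈ P → ∀ y, Relation.ReflTransGen r a y → y ∉ P →
        ∃ u, Relation.ReflTransGen r a u ∧ ∃ v, Relation.ReflTransGen r a v ∧ u ∈ P ∧ v ∉ P ∧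
          G.Adj u v := by
      intro P haP y hy
      induction hy with
      | refl => intro h; exact absurd haP h
      | @tail b c hb hc ih =>
        intro hcP
        by_cases hbP : b ∈ P
        · exact ⟨b, hb, c, hb.tail hc, hbP, hcP, hc.2⟩
        · exact ih hbP
    rintro P ⟨x, hx, hxP⟩ ⟨y, hy, hyP⟩
    by_cases haP : a ∈ P
    · exact key P haP y hy hyP
    · obtain ⟨u, hu, v, hv, h1, h2, h3⟩ := key Pᶜ haP x hx (fun h => h hxP)
      exact ⟨v, hv, u, hu, by simpa using h2, h1, h3.symm⟩
  · intro z hz y hy hzy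
    exact Relation.ReflTransGen.tail hz ⟨hy, hzy⟩

/-- splitting a connected set -/
theorem Cn.split {V : Type*} {G : SimpleGraph V} {A : Set V} (hA : Cn G A) {a x : V}
    (ha : a ∈ A) (hx : x ∈ A) (hax : a ≠ x) :
    ∃ A' M : Set V, A' ⊆ A ∧ M ⊆ A ∧ (∀ y ∈ A, y ∈ A' ∨ y ∈ M) ∧ Disjoint A' M ∧
      a ∈ A' ∧ x ∈ M ∧ Cn G A' ∧ Cn G M := by
  obtain ⟨Z, hZ, haZ, hcZ, hZc⟩ := exists_component G (A \ {x}) a ⟨ha, hax⟩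
  refine ⟨Z, A \ Z, fun z hz => (hZ hz).1, fun z hz => hz.1, ?_, Set.disjoint_sdiff_right, haZ,
    ⟨hx, fun h => (hZ h).2 rfl⟩, hcZ, ?_⟩
  · intro y hy
    by_cases h : y ∈ Z
    · exact Or.inl h
    · exact Or.inr ⟨hy, h⟩
  · have key : ∀ Q : Set V, (∃ q ∈ A \ Z, q ∈ Q) → x ∉ Q → ∃ u ∈ A \ Z, ∃ v ∈ A \ Z,
        u ∈ Q ∧ v ∉ Q ∧ G.Adj u v := by
      rintro Q ⟨q, hq, hqQ⟩ hxQ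
      obtain ⟨u, hu, v, hv, h1, h2, h3⟩ := hA ((A \ Z) ∩ Q) ⟨q, hq.1, hq, hqQ⟩
        ⟨x, hx, fun h => hxQ h.2⟩
      have hvZ : v ∉ Z := by
        intro hvZ
        apply h1.1.2
        refine hZc v hvZ u ⟨hu, ?_⟩ h3.symm
        rintro rfl
        exact hxQ h1.2
      exact ⟨u, h1.1, v, ⟨hv, hvZ⟩, h1.2, fun h => h2 ⟨⟨hv, hvZ⟩, h⟩, h3⟩
    rintro P ⟨u, hu, huP⟩ ⟨y, hy, hyP⟩
    by_cases hxP : x ∈ P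
    · obtain ⟨u, hu, v, hv, h1, h2, h3⟩ := key Pᶜ ⟨y, hy, hyP⟩ (fun h => h hxP)
      exact ⟨v, hv, u, hu, by simpa using h2, h1, h3.symm⟩
    · exact key P ⟨u, hu, huP⟩ hxP

/-- Minor models inside `X`. -/
def Mod {W V : Type*} (K : SimpleGraph W) (G : SimpleGraph V) (X : Set V) : Prop :=
  ∃ f : W → Set V, (∀ w, (f w).Nonempty) ∧ (∀ w, f w ⊆ X) ∧ (∀ w, Cn G (f w)) ∧
    (∀ w w', w ≠ w' → Disjoint (f w) (f w')) ∧
    ∀ w w', K.Adj w w' → ∃ u ∈ f w, ∃ v ∈ f w', G.Adj u v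

theorem isMinor_iff {W V : Type*} (K : SimpleGraph W) (G : SimpleGraph V) :
    K.IsMinor G ↔ Mod K G Set.univ := by
  constructor
  · rintro ⟨f, h1, h2, h3, h4⟩
    exact ⟨f, h1, fun _ => Set.subset_univ _, fun w => (conn_iff G _ (h1 w)).1 (h2 w),
      fun w w' h => h3 h, fun w w' h => h4 h⟩
  · rintro ⟨f, h1, -, h2, h3, h4⟩
    exact ⟨f, h1, fun w => (conn_iff G _ (h1 w)).2 (h2 w),
      fun w w' h => h3 w w' h, fun w w' h => h4 w w' h⟩

theorem mod_range {W V U : Type*} (K : SimpleGraph W) (G : SimpleGraph V) (T : SimpleGraph U)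
    (j : U → V) (hj : Function.Injective j) (hadj : ∀ a b, G.Adj (j a) (j b) → T.Adj a b)
    (h : Mod K G (Set.range j)) : K.IsMinor T := by
  rw [isMinor_iff]
  obtain ⟨f, h1, h2, h3, h4, h5⟩ := h
  refine ⟨fun w => j ⁻¹' (f w), ?_, fun _ => Set.subset_univ _, ?_, ?_, ?_⟩
  · intro w
    obtain ⟨x, hx⟩ := h1 w
    obtain ⟨y, rfl⟩ := h2 w hx
    exact ⟨y, hx⟩
  · rintro w P ⟨x, hx, hxP⟩ ⟨y, hy, hyP⟩
    obtain ⟨a, ha, b, hb, ⟨a', ha', rfl⟩, h7, h8⟩ := h3 w (j '' P) ⟨j x, hx, x, hxP, rfl⟩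
      ⟨j y, hy, fun ⟨z, hz, hzy⟩ => hyP (hj hzy ▸ hz)⟩
    obtain ⟨b', rfl⟩ := h2 w hb
    exact ⟨a', ha, b', hb, ha', fun h => h7 ⟨b', h, rfl⟩, hadj _ _ h8⟩
  · intro w w' hw
    exact Disjoint.preimage j (h4 w w' hw)
  · intro w w' hw
    obtain ⟨u, hu, v, hv, huv⟩ := h5 w w' hw
    obtain ⟨u', rfl⟩ := h2 w hu
    obtain ⟨v', rfl⟩ := h2 w' hv
    exact ⟨u', hu, v', hv, hadj _ _ huv⟩

abbrev K5 : SimpleGraph (Fin 5) := SimpleGraph.completeGraph (Fin 5)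
abbrev K33 : SimpleGraph (Fin 3 ⊕ Fin 3) := completeBipartiteGraph (Fin 3) (Fin 3)

def PlanarIn {V : Type*} (G : SimpleGraph V) (X : Set V) : Prop :=
  ¬ Mod K5 G X ∧ ¬ Mod K33 G X

theorem planar_iff {V : Type*} (G : SimpleGraph V) : G.Planar ↔ PlanarIn G Set.univ := by
  unfold SimpleGraph.Planar PlanarIn
  rw [isMinor_iff, isMinor_iff]

/-- Touching sets. -/
def Tch {V : Type*} (G : SimpleGraph V) (s t : Set V) : Prop := ∃ u ∈ s, ∃ v ∈ t, G.Adj u v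

theorem Tch.symm {V : Type*} {G : SimpleGraph V} {s t : Set V} (h : Tch G s t) : Tch G t s := by
  obtain ⟨u, hu, v, hv, h⟩ := h
  exact ⟨v, hv, u, hu, h.symm⟩

theorem mod_K33 {V : Type*} (G : SimpleGraph V) (X : Set V) (L R : Fin 3 → Set V)
    (hL : ∀ i, (L i).Nonempty ∧ L i ⊆ X ∧ Cn G (L i))
    (hR : ∀ i, (R i).Nonempty ∧ R i ⊆ X ∧ Cn G (R i))
    (hLL : ∀ i j, i ≠ j → Disjoint (L i) (L j)) (hRR : ∀ i j, i ≠ j → Disjoint (R i) (R j))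
    (hLR : ∀ i j, Disjoint (L i) (R j)) (ht : ∀ i j, Tch G (L i) (R j)) : Mod K33 G X := by
  refine ⟨Sum.elim L R, ?_, ?_, ?_, ?_, ?_⟩
  · rintro (i | i)
    exacts [(hL i).1, (hR i).1]
  · rintro (i | i)
    exacts [(hL i).2.1, (hR i).2.1]
  · rintro (i | i)
    exacts [(hL i).2.2, (hR i).2.2]
  · rintro (i | i) (j | j) h
    · exact hLL i j (fun e => h (by rw [e]))
    · exact hLR i j
    · exact (hLR j i).symm
    · exact hRR i j (fun e => h (by rw [e]))
  · rintro (i | i) (j | j) h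
    · simp at h
    · exact ht i j
    · exact (ht j i).symm
    · simp at h

/-- The configuration of two sets both touching three sets containing the vertices of
a nonseparating triangle does not occur in planar graphs. -/
theorem no_tripod {V : Type*} [Finite V] (G : SimpleGraph V) (X : Set V) (hX : PlanarIn G X)
    (s : Fin 3 → V) (hs : ∀ i j, i ≠ j → G.Adj (s i) (s j))
    (hc : Cn G (X \ Set.range s)) : ∀ (n : ℕ) (A : Fin 3 → Set V) (B C : Set V),
    (Bᶜ).ncard = n →
    (∀ i, s i ∈ A i ∧ A i ⊆ X ∧ Cn G (A i)) → (∀ i j, i ≠ j → Disjoint (A i) (A j)) →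
    B.Nonempty → C.Nonempty → B ⊆ X → C ⊆ X → Cn G B → Cn G C → Disjoint B C →
    (∀ i, Disjoint B (A i)) → (∀ i, Disjoint C (A i)) →
    (∀ i, Tch G B (A i)) → (∀ i, Tch G C (A i)) → False := by
  intro n
  induction n using Nat.strong_induction_on with
  | _ n ih =>
  intro A B C hn hA hAA hB hC hBX hCX hcB hcC hBC hBA hCA htB htC
  have hBs : ∀ x ∈ B, x ∉ Set.range s := by
    rintro x hx ⟨i, rfl⟩
    exact (Set.disjoint_left.1 (hBA i)) hx (hA i).1
  have hCs : ∀ x ∈ C, x ∉ Set.range s := by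
    rintro x hx ⟨i, rfl⟩
    exact (Set.disjoint_left.1 (hCA i)) hx (hA i).1
  obtain ⟨b, hb⟩ := hB
  obtain ⟨c, hcc⟩ := hC
  obtain ⟨u, hu, x, hx, huB, hxB, hux⟩ := hc B ⟨b, ⟨hBX hb, hBs b hb⟩, hb⟩
    ⟨c, ⟨hCX hcc, hCs c hcc⟩, fun h => (Set.disjoint_left.1 hBC) h hcc⟩
  by_cases hxC : x ∈ C
  · -- K5
    apply hX.1
    have h5 : ∀ i j : Fin 5, i < j → Disjoint ((![A 0, A 1, A 2, B, C] : Fin 5 → Set V) i)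
        ((![A 0, A 1, A 2, B, C] : Fin 5 → Set V) j) ∧ Tch G ((![A 0, A 1, A 2, B, C] : Fin 5 → Set V) i)
        ((![A 0, A 1, A 2, B, C] : Fin 5 → Set V) j) := by
      have hAt : ∀ i j, i ≠ j → Disjoint (A i) (A j) ∧ Tch G (A i) (A j) := fun i j h =>
        ⟨hAA i j h, s i, (hA i).1, s j, (hA j).1, hs i j h⟩
      have hBt : ∀ i, Disjoint (A i) B ∧ Tch G (A i) B := fun i => ⟨(hBA i).symm, (htB i).symm⟩
      have hCt : ∀ i, Disjoint (A i) C ∧ Tch G (A i) C := fun i => ⟨(hCA i).symm, (htC i).symm⟩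
      have hBCt : Disjoint B C ∧ Tch G B C := ⟨hBC, u, huB, x, hxC, hux⟩
      intro i j hij
      fin_cases i <;> fin_cases j <;> first
        | (exfalso; revert hij; decide)
        | exact hAt _ _ (by decide)
        | exact hBt _
        | exact hCt _
        | exact hBCt
    have h1 : ∀ i : Fin 5, ((![A 0, A 1, A 2, B, C] : Fin 5 → Set V) i).Nonempty ∧
        ((![A 0, A 1, A 2, B, C] : Fin 5 → Set V) i) ⊆ X ∧
        Cn G ((![A 0, A 1, A 2, B, C] : Fin 5 → Set V) i) := by
      have hA' : ∀ i, (A i).Nonempty ∧ A i ⊆ X ∧ Cn G (A i) := fun i => ⟨⟨_, (hA i).1⟩, (hA i).2⟩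
      intro i
      fin_cases i
      · exact hA' 0
      · exact hA' 1
      · exact hA' 2
      · exact ⟨⟨b, hb⟩, hBX, hcB⟩
      · exact ⟨⟨c, hcc⟩, hCX, hcC⟩
    refine ⟨![A 0, A 1, A 2, B, C], fun i => (h1 i).1, fun i => (h1 i).2.1, fun i => (h1 i).2.2,
      ?_, ?_⟩
    · intro i j hij
      rcases lt_or_gt_of_ne hij with h | h
      · exact (h5 i j h).1
      · exact (h5 j i h).1.symm
    · intro i j hij
      rcases lt_or_gt_of_ne (SimpleGraph.Adj.ne hij) with h | h
      · exact (h5 i j h).2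
      · exact (h5 j i h).2.symm
  by_cases hxA : ∃ i, x ∈ A i
  · obtain ⟨i, hxi⟩ := hxA
    have hsx : s i ≠ x := fun h => hx.2 ⟨i, h⟩
    obtain ⟨A', M, hA'A, hMA, hAM, hdis, hsA', hxM, hcA', hcM⟩ :=
      (hA i).2.2.split (hA i).1 hxi hsx
    by_cases htC' : Tch G C A'
    ·
      refine ih ((B ∪ M)ᶜ.ncard) ?_ (Function.update A i A') (B ∪ M) C rfl ?_ ?_ ⟨b, Or.inl hb⟩
        ⟨c, hcc⟩ (Set.union_subset hBX (hMA.trans (hA i).2.1)) hCX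
        (hcB.union hcM huB hxM hux) hcC ?_ ?_ ?_ ?_ ?_
      · rw [← hn]
        apply Set.ncard_lt_ncard _ (Set.toFinite _)
        rw [Set.ssubset_iff_of_subset (by intro y hy h; exact hy (Or.inl h))]
        exact ⟨x, hxB, fun h => h (Or.inr hxM)⟩
      · intro k
        by_cases hk : k = i
        · subst hk
          simp only [Function.update_self]
          exact ⟨hsA', hA'A.trans (hA k).2.1, hcA'⟩
        · rw [Function.update_of_ne hk]
          exact hA k
      · intro k l hkl
        by_cases hk : k = i
        · subst hk
          rw [Function.update_self, Function.update_of_ne hkl.symm]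
          exact (hAA k l hkl).mono_left hA'A
        · rw [Function.update_of_ne hk]
          by_cases hl : l = i
          · subst hl
            rw [Function.update_self]
            exact (hAA k l hkl).mono_right hA'A
          · rw [Function.update_of_ne hl]
            exact hAA k l hkl
      · exact Set.disjoint_union_left.2 ⟨hBC, ((hCA i).mono_right hMA).symm⟩
      · intro k
        by_cases hk : k = i
        · subst hk
          rw [Function.update_self]
          exact Set.disjoint_union_left.2 ⟨(hBA k).mono_right hA'A, hdis.symm⟩
        · rw [Function.update_of_ne hk]
          exact Set.disjoint_union_left.2 ⟨hBA k, (hAA i k (Ne.symm hk)).mono_left hMA⟩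
      · intro k
        by_cases hk : k = i
        · subst hk
          rw [Function.update_self]
          exact (hCA k).mono_right hA'A
        · rw [Function.update_of_ne hk]
          exact hCA k
      · intro k
        by_cases hk : k = i
        · subst hk
          rw [Function.update_self]
          obtain ⟨p, hp, q, hq, h1, h2, h3⟩ := (hA k).2.2 M ⟨x, hxi, hxM⟩
            ⟨s k, (hA k).1, Set.disjoint_left.1 hdis hsA'⟩
          exact ⟨p, Or.inr h1, q, (hAM q hq).resolve_right h2, h3⟩
        · rw [Function.update_of_ne hk]
          obtain ⟨p, hp, q, hq, h⟩ := htB k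
          exact ⟨p, Or.inl hp, q, hq, h⟩
      · intro k
        by_cases hk : k = i
        · subst hk
          rw [Function.update_self]
          exact htC'
        · rw [Function.update_of_ne hk]
          exact htC k
    · -- K33
      apply hX.2
      have htCM : Tch G C M := by
        obtain ⟨p, hp, q, hq, h⟩ := htC i
        rcases hAM q hq with h1 | h1
        · exact absurd ⟨p, hp, q, h1, h⟩ htC'
        · exact ⟨p, hp, q, h1, h⟩
      have hup : ∀ (Q : Set V → Prop), Q M → (∀ k, k ≠ i → Q (A k)) →
          ∀ k, Q (Function.update A i M k) := by
        intro Q h1 h2 k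
        by_cases hk : k = i
        · subst hk
          rw [Function.update_self]
          exact h1
        · rw [Function.update_of_ne hk]
          exact h2 k hk
      have hMA' : ∀ k, k ≠ i → Disjoint M (A k) := fun k hk =>
        (hAA i k hk.symm).mono_left hMA
      have hthree : ∀ (Q : Set V → Prop), Q A' → Q B → Q C →
          ∀ k, Q ((![A', B, C] : Fin 3 → Set V) k) := by
        intro Q h1 h2 h3 k
        fin_cases k
        exacts [h1, h2, h3]
      refine mod_K33 G X ![A', B, C] (Function.update A i M) ?_ ?_ ?_ ?_ ?_ ?_
      · exact hthree (fun Y => Y.Nonempty ∧ Y ⊆ X ∧ Cn G Y)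
          ⟨⟨_, hsA'⟩, hA'A.trans (hA i).2.1, hcA'⟩ ⟨⟨b, hb⟩, hBX, hcB⟩ ⟨⟨c, hcc⟩, hCX, hcC⟩
      · exact hup (fun Y => Y.Nonempty ∧ Y ⊆ X ∧ Cn G Y)
          ⟨⟨_, hxM⟩, hMA.trans (hA i).2.1, hcM⟩ (fun k _ => ⟨⟨_, (hA k).1⟩, (hA k).2⟩)
      · have e1 : Disjoint A' B := ((hBA i).mono_right hA'A).symm
        have e2 : Disjoint A' C := ((hCA i).mono_right hA'A).symm
        intro k l hkl
        fin_cases k <;> fin_cases l <;> first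
          | exact absurd rfl hkl
          | exact e1
          | exact e2
          | exact hBC
          | exact e1.symm
          | exact e2.symm
          | exact hBC.symm
      · intro k l hkl
        by_cases hk : k = i
        · subst hk
          rw [Function.update_self, Function.update_of_ne hkl.symm]
          exact hMA' l hkl.symm
        · rw [Function.update_of_ne hk]
          by_cases hl : l = i
          · subst hl
            rw [Function.update_self]
            exact (hMA' k hk).symm
          · rw [Function.update_of_ne hl]
            exact hAA k l hkl
      · intro k
        refine hup (fun Y => Disjoint ((![A', B, C] : Fin 3 → Set V) k) Y) ?_ ?_
        · exact hthree (fun Y => Disjoint Y M) hdis ((hBA i).mono_right hMA)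
            ((hCA i).mono_right hMA) k
        · intro l hl
          exact hthree (fun Y => Disjoint Y (A l)) ((hAA i l hl.symm).mono_left hA'A) (hBA l)
            (hCA l) k
      · intro k
        refine hup (fun Y => Tch G ((![A', B, C] : Fin 3 → Set V) k) Y) ?_ ?_
        · refine hthree (fun Y => Tch G Y M) ?_ ⟨u, huB, x, hxM, hux⟩ htCM k
          obtain ⟨p, hp, q, hq, h1, h2, h3⟩ := (hA i).2.2 M ⟨x, hxi, hxM⟩
            ⟨s i, (hA i).1, Set.disjoint_left.1 hdis hsA'⟩
          exact ⟨q, (hAM q hq).resolve_right h2, p, h1, h3.symm⟩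
        · intro l hl
          exact hthree (fun Y => Tch G Y (A l)) ⟨s i, hsA', s l, (hA l).1, hs i l hl.symm⟩
            (htB l) (htC l) k
  · -- absorb a free vertex
    push Not at hxA
    refine ih ((B ∪ {x})ᶜ.ncard) ?_ A (B ∪ {x}) C rfl hA hAA ⟨b, Or.inl hb⟩ ⟨c, hcc⟩
      (Set.union_subset hBX (by rintro y rfl; exact hx.1)) hCX
      (hcB.union (cn_singleton G x) huB rfl hux) hcC ?_ ?_ hCA ?_ htC
    · rw [← hn]
      apply Set.ncard_lt_ncard _ (Set.toFinite _)
      rw [Set.ssubset_iff_of_subset (by intro y hy h; exact hy (Or.inl h))]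
      exact ⟨x, hxB, fun h => h (Or.inr rfl)⟩
    · exact Set.disjoint_union_left.2 ⟨hBC, Set.disjoint_singleton_left.2 hxC⟩
    · intro k
      exact Set.disjoint_union_left.2 ⟨hBA k, Set.disjoint_singleton_left.2 (hxA k)⟩
    · intro k
      obtain ⟨p, hp, q, hq, h⟩ := htB k
      exact ⟨p, Or.inl hp, q, hq, h⟩


/-- A separation of `G` along a clique. -/
structure Sep {V : Type*} (G : SimpleGraph V) (X Y : Set V) : Prop where
  cov : ∀ v, v ∈ X ∨ v ∈ Y
  clq : ∀ u v, u ∈ X → u ∈ Y → v ∈ X → v ∈ Y → u ≠ v → G.Adj u v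
  crs : ∀ u v, G.Adj u v → u ∈ Y ∨ v ∈ X

theorem Sep.symm {V : Type*} {G : SimpleGraph V} {X Y : Set V} (h : Sep G X Y) : Sep G Y X :=
  ⟨fun v => (h.cov v).symm, fun u v a b c d e => h.clq u v b a d c e,
    fun u v a => (h.crs v u a.symm).symm⟩

theorem Sep.meet {V : Type*} {G : SimpleGraph V} {X Y : Set V} (h : Sep G X Y) {s : Set V}
    (hs : Cn G s) (h1 : ∃ x ∈ s, x ∈ X) (h2 : ∃ y ∈ s, y ∈ Y) : ∃ z ∈ s, z ∈ X ∧ z ∈ Y := by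
  by_contra hcon
  push Not at hcon
  obtain ⟨x, hx, hxX⟩ := h1
  obtain ⟨y, hy, hyY⟩ := h2
  obtain ⟨a, ha, b, hb, h3, h4, h5⟩ := hs X ⟨x, hx, hxX⟩ ⟨y, hy, fun h => hcon y hy h hyY⟩
  rcases h.crs a b h5 with h6 | h6
  · exact hcon a ha h3 h6
  · exact h4 h6

theorem Sep.cn_inter {V : Type*} {G : SimpleGraph V} {X Y : Set V} (h : Sep G X Y) {s : Set V}
    (hs : Cn G s) : Cn G (s ∩ X) := by
  have key : ∀ P : Set V, (∃ x ∈ s ∩ X, x ∈ P) → (∃ y ∈ s ∩ X, y ∉ P) →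
      (∀ z ∈ s, z ∈ X → z ∈ Y → z ∉ P) → ∃ a ∈ s ∩ X, ∃ b ∈ s ∩ X, a ∈ P ∧ b ∉ P ∧ G.Adj a b := by
    rintro P ⟨x, hx, hxP⟩ ⟨y, hy, hyP⟩ hz
    obtain ⟨a, ha, b, hb, h3, h4, h5⟩ := hs (P ∩ X) ⟨x, hx.1, hxP, hx.2⟩
      ⟨y, hy.1, fun h => hyP h.1⟩
    have haY : a ∉ Y := fun haY => hz a ha h3.2 haY h3.1
    have hbX : b ∈ X := (h.crs a b h5).resolve_left haY
    exact ⟨a, ⟨ha, h3.2⟩, b, ⟨hb, hbX⟩, h3.1, fun h => h4 ⟨h, hbX⟩, h5⟩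
  intro P h1 h2
  by_cases hA : ∀ z ∈ s, z ∈ X → z ∈ Y → z ∉ P
  · exact key P h1 h2 hA
  by_cases hB : ∀ z ∈ s, z ∈ X → z ∈ Y → z ∈ P
  · obtain ⟨a, ha, b, hb, h3, h4, h5⟩ := key Pᶜ h2 (by simpa using h1)
      (fun z h1 h2 h3 h => h (hB z h1 h2 h3))
    exact ⟨b, hb, a, ha, by simpa using h4, h3, h5.symm⟩
  push Not at hA hB
  obtain ⟨z, hz, hzX, hzY, hzP⟩ := hA
  obtain ⟨z', hz', hzX', hzY', hzP'⟩ := hB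
  exact ⟨z, ⟨hz, hzX⟩, z', ⟨hz', hzX'⟩, hzP, hzP', h.clq z z' hzX hzY hzX' hzY'
    (fun h => hzP' (h ▸ hzP))⟩

theorem Sep.restrict {W V : Type*} {K : SimpleGraph W} {G : SimpleGraph V} {X Y : Set V}
    (h : Sep G X Y) (f : W → Set V) (h1 : ∀ w, Cn G (f w))
    (h2 : ∀ w w', w ≠ w' → Disjoint (f w) (f w'))
    (h3 : ∀ w w', K.Adj w w' → ∃ u ∈ f w, ∃ v ∈ f w', G.Adj u v)
    (h4 : ∀ w, ∃ x ∈ f w, x ∈ X) : Mod K G X := by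
  refine ⟨fun w => f w ∩ X, fun w => ?_, fun w => Set.inter_subset_right,
    fun w => h.cn_inter (h1 w), fun w w' hw => ?_, fun w w' hw => ?_⟩
  · obtain ⟨x, hx, hx'⟩ := h4 w
    exact ⟨x, hx, hx'⟩
  · exact (h2 w w' hw).mono Set.inter_subset_left Set.inter_subset_left
  · obtain ⟨u, hu, v, hv, huv⟩ := h3 w w' hw
    by_cases hh : u ∈ X ∧ v ∈ X
    · exact ⟨u, ⟨hu, hh.1⟩, v, ⟨hv, hh.2⟩, huv⟩
    have hY : u ∈ Y ∧ v ∈ Y := by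
      have e1 := h.crs u v huv
      have e2 := h.crs v u huv.symm
      have e3 := h.cov u
      have e4 := h.cov v
      tauto
    obtain ⟨z, hz, hzX, hzY⟩ := h.meet (h1 w) (h4 w) ⟨u, hu, hY.1⟩
    obtain ⟨z', hz', hzX', hzY'⟩ := h.meet (h1 w') (h4 w') ⟨v, hv, hY.2⟩
    refine ⟨z, ⟨hz, hzX⟩, z', ⟨hz', hzX'⟩, h.clq z z' hzX hzY hzX' hzY' ?_⟩
    rintro rfl
    exact Set.disjoint_left.1 (h2 w w' hw.ne) hz hz'

theorem Sep.no_K33 {V : Type*} [Finite V] {G : SimpleGraph V} {X Y : Set V}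
    (h : Sep G X Y) (s : Fin 3 → V) (hs : ∀ i j, i ≠ j → G.Adj (s i) (s j))
    (hXY : X ∩ Y = Set.range s) (hX : PlanarIn G X) 
    (hcX : Cn G (X \ Set.range s)) 
    (L R : Fin 3 → Set V) (hL : ∀ i, (L i).Nonempty) 
    (hcL : ∀ i, Cn G (L i)) (hcR : ∀ i, Cn G (R i))
    (hLL : ∀ i j, i ≠ j → Disjoint (L i) (L j)) (hRR : ∀ i j, i ≠ j → Disjoint (R i) (R j))
    (hLR : ∀ i j, Disjoint (L i) (R j)) (ht : ∀ i j, Tch G (L i) (R j))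
    (i0 i1 : Fin 3) (h01 : i0 ≠ i1) (h0 : ∀ x ∈ L i0, x ∉ Y) (h1 : ∀ x ∈ L i1, x ∉ Y)
    (hm : ∀ k, ∃ z ∈ R k, z ∈ Set.range s) : False := by
  have hm' : ∀ k, ∃ l, s l ∈ R k := by
    intro k
    obtain ⟨z, hz, l, rfl⟩ := hm k
    exact ⟨l, hz⟩
  choose π hπ using hm'
  have hinj : Function.Injective π := by
    intro a b hab
    by_contra hne
    exact Set.disjoint_left.1 (hRR a b hne) (hπ a) (hab ▸ hπ b)
  have hsurj : Function.Surjective π := Finite.surjective_of_injective hinj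
  have hrange : Set.range (s ∘ π) = Set.range s := hsurj.range_comp s
  have hsX : ∀ l, s l ∈ X := fun l => (hXY.symm ▸ (⟨l, rfl⟩ : s l ∈ Set.range s) : s l ∈ X ∩ Y).1
  have hLX : ∀ i, (∀ x ∈ L i, x ∉ Y) → L i ⊆ X := fun i hi x hx =>
    (h.cov x).resolve_right (hi x hx)
  have htt : ∀ i, (∀ x ∈ L i, x ∉ Y) → ∀ k, Tch G (L i) (R k ∩ X) := by
    intro i hi k
    obtain ⟨u, hu, v, hv, huv⟩ := ht i k
    exact ⟨u, hu, v, ⟨hv, (h.crs u v huv).resolve_left (hi u hu)⟩, huv⟩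
  exact no_tripod G X hX (s ∘ π) (fun i j hij => hs _ _ (fun e => hij (hinj e)))
    (by rw [hrange]; exact hcX) _ (fun k => R k ∩ X) (L i0) (L i1) rfl
    (fun k => ⟨⟨hπ k, hsX _⟩, Set.inter_subset_right, h.cn_inter (hcR k)⟩)
    (fun i j hij => (hRR i j hij).mono Set.inter_subset_left Set.inter_subset_left)
    (hL i0) (hL i1) (hLX i0 h0) (hLX i1 h1) (hcL i0) (hcL i1) (hLL i0 i1 h01)
    (fun k => (hLR i0 k).mono_right Set.inter_subset_left)
    (fun k => (hLR i1 k).mono_right Set.inter_subset_left) (htt i0 h0) (htt i1 h1)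

theorem Sep.no_K33' {V : Type*} [Finite V] {G : SimpleGraph V} {X Y : Set V}
    (h : Sep G X Y) (s : Fin 3 → V) (hs : ∀ i j, i ≠ j → G.Adj (s i) (s j))
    (hXY : X ∩ Y = Set.range s) (hX : PlanarIn G X) (hY : PlanarIn G Y)
    (hcX : Cn G (X \ Set.range s)) (hcY : Cn G (Y \ Set.range s))
    (L R : Fin 3 → Set V) (hL : ∀ i, (L i).Nonempty) 
    (hcL : ∀ i, Cn G (L i)) (hcR : ∀ i, Cn G (R i))
    (hLL : ∀ i j, i ≠ j → Disjoint (L i) (L j)) (hRR : ∀ i j, i ≠ j → Disjoint (R i) (R j))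
    (hLR : ∀ i j, Disjoint (L i) (R j)) (ht : ∀ i j, Tch G (L i) (R j))
    (i0 i1 : Fin 3) (h0 : ∀ x ∈ L i0, x ∉ Y) (h1 : ∀ x ∈ L i1, x ∉ X) : False := by
  have hm : ∀ k, ∃ z ∈ R k, z ∈ Set.range s := by
    intro k
    rw [← hXY]
    obtain ⟨u, hu, v, hv, huv⟩ := ht i0 k
    obtain ⟨u', hu', v', hv', huv'⟩ := ht i1 k
    exact h.meet (hcR k) ⟨v, hv, (h.crs u v huv).resolve_left (h0 u hu)⟩
      ⟨v', hv', (h.crs v' u' huv'.symm).resolve_right (h1 u' hu')⟩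
  have h01 : i0 ≠ i1 := by
    rintro rfl
    obtain ⟨x, hx⟩ := hL i0
    rcases h.cov x with hh | hh
    · exact h1 x hx hh
    · exact h0 x hx hh
  obtain ⟨i2, h20, h21⟩ : ∃ i2 : Fin 3, i2 ≠ i0 ∧ i2 ≠ i1 := by
    have hd : ∀ i0 i1 : Fin 3, ∃ i2 : Fin 3, i2 ≠ i0 ∧ i2 ≠ i1 := by decide
    exact hd i0 i1
  have hns : ∀ x ∈ L i2, x ∉ Set.range s := by
    have hm' : ∀ k, ∃ l, s l ∈ R k := by
      intro k
      obtain ⟨z, hz, l, rfl⟩ := hm k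
      exact ⟨l, hz⟩
    choose π hπ using hm'
    have hinj : Function.Injective π := by
      intro a b hab
      by_contra hne
      exact Set.disjoint_left.1 (hRR a b hne) (hπ a) (hab ▸ hπ b)
    have hsurj : Function.Surjective π := Finite.surjective_of_injective hinj
    rintro x hx ⟨l, rfl⟩
    obtain ⟨k, rfl⟩ := hsurj l
    exact Set.disjoint_left.1 (hLR i2 k) hx (hπ k)
  by_cases hx : ∃ x ∈ L i2, x ∈ X
  · have h2 : ∀ x ∈ L i2, x ∉ Y := by
      intro y hy hyY
      obtain ⟨z, hz, hz'⟩ := h.meet (hcL i2) hx ⟨y, hy, hyY⟩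
      exact hns z hz (hXY ▸ hz')
    exact h.no_K33 s hs hXY hX hcX L R hL hcL hcR hLL hRR hLR ht i0 i2 h20.symm h0 h2 hm
  · push Not at hx
    exact h.symm.no_K33 s hs (by rw [Set.inter_comm]; exact hXY) hY hcY L R hL hcL hcR hLL hRR hLR
      ht i1 i2 h21.symm h1 hx hm

theorem Sep.planar {V : Type*} [Finite V] {G : SimpleGraph V} {X Y : Set V}
    (h : Sep G X Y) (s : Fin 3 → V) (hs : ∀ i j, i ≠ j → G.Adj (s i) (s j))
    (hXY : X ∩ Y = Set.range s) (hX : PlanarIn G X) (hY : PlanarIn G Y)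
    (hcX : Cn G (X \ Set.range s)) (hcY : Cn G (Y \ Set.range s)) : G.Planar := by
  rw [planar_iff]
  constructor
  · rintro ⟨f, h1, -, h2, h3, h4⟩
    by_cases hA : ∀ w, ∃ x ∈ f w, x ∈ X
    · exact hX.1 (h.restrict f h2 h3 h4 hA)
    · push Not at hA
      obtain ⟨w0, hw0⟩ := hA
      refine hY.1 (h.symm.restrict f h2 h3 h4 ?_)
      intro w
      by_cases hw : w = w0
      · subst hw
        obtain ⟨x, hx⟩ := h1 w
        exact ⟨x, hx, (h.cov x).resolve_left (hw0 x hx)⟩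
      · obtain ⟨u, hu, v, hv, huv⟩ := h4 w w0 hw
        exact ⟨u, hu, (h.crs u v huv).resolve_right (hw0 v hv)⟩
  · rintro ⟨f, h1, -, h2, h3, h4⟩
    by_cases hA : ∀ w, ∃ x ∈ f w, x ∈ X
    · exact hX.2 (h.restrict f h2 h3 h4 hA)
    by_cases hB : ∀ w, ∃ x ∈ f w, x ∈ Y
    · exact hY.2 (h.symm.restrict f h2 h3 h4 hB)
    push Not at hA hB
    obtain ⟨w1, hw1⟩ := hA
    obtain ⟨w0, hw0⟩ := hB
    have hLR : ∀ i j, Tch G (f (Sum.inl i)) (f (Sum.inr j)) := fun i j => h4 _ _ (by simp)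
    have hno : ¬ Tch G (f w0) (f w1) := by
      rintro ⟨u, hu, v, hv, huv⟩
      rcases h.crs u v huv with hh | hh
      · exact hw0 u hu hh
      · exact hw1 v hv hh
    rcases w0 with i0 | i0 <;> rcases w1 with i1 | i1
    · exact h.no_K33' s hs hXY hX hY hcX hcY (fun i => f (Sum.inl i)) (fun i => f (Sum.inr i))
        (fun i => h1 _) (fun i => h2 _) (fun i => h2 _) (fun i j hij => h3 _ _ (by simpa using hij))
        (fun i j hij => h3 _ _ (by simpa using hij)) (fun i j => h3 _ _ (by simp)) hLR i0 i1 hw0 hw1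
    · exact hno (hLR _ _)
    · exact hno (hLR _ _).symm
    · exact h.no_K33' s hs hXY hX hY hcX hcY (fun i => f (Sum.inr i)) (fun i => f (Sum.inl i))
        (fun i => h1 _) (fun i => h2 _) (fun i => h2 _) (fun i j hij => h3 _ _ (by simpa using hij))
        (fun i j hij => h3 _ _ (by simpa using hij)) (fun i j => h3 _ _ (by simp))
        (fun i j => (hLR j i).symm) i0 i1 hw0 hw1


/-- The triangle vertex `a k` has a neighbour outside of the triangle `a`. -/
def Att {V : Type*} (T : SimpleGraph V) (a : Fin 3 → V) (k : Fin 3) : Prop :=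
  ∃ v, T.Adj (a k) v ∧ ∀ l, v ≠ a l

/-- `W` is the union of `U` and `V` glued along two triangles. -/
structure PO {U V W : Type*} (i : U → W) (j : V → W) (s : Fin 3 → U) (a : Fin 3 → V) : Prop where
  injI : Function.Injective i
  injJ : Function.Injective j
  cov : ∀ w, (∃ u, i u = w) ∨ ∃ v, j v = w
  eq : ∀ k, i (s k) = j (a k)
  int : ∀ u v, i u = j v → ∃ k, u = s k ∧ v = a k

theorem PO.symm {U V W : Type*} {i : U → W} {j : V → W} {s : Fin 3 → U} {a : Fin 3 → V}
    (h : PO i j s a) : PO j i a s :=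
  ⟨h.injJ, h.injI, fun w => (h.cov w).symm, fun k => (h.eq k).symm,
    fun u v e => let ⟨k, h1, h2⟩ := h.int v u e.symm; ⟨k, h2, h1⟩⟩

theorem exists_PO {U V : Type} [Finite U] [Finite V] (s : Fin 3 → U) (a : Fin 3 → V)
    (hs : Function.Injective s) (ha : Function.Injective a) :
    ∃ (W : Type) (_ : Finite W) (i : U → W) (j : V → W), PO i j s a := by
  classical
  refine ⟨U ⊕ {v : V // ∀ k, v ≠ a k}, inferInstance, Sum.inl,
    fun v => if h : ∃ k, v = a k then Sum.inl (s h.choose) else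
      Sum.inr ⟨v, fun k hk => h ⟨k, hk⟩⟩, ?_⟩
  have hch : ∀ k (h : ∃ l, a k = a l), h.choose = k := fun k h => (ha h.choose_spec).symm
  refine ⟨Sum.inl_injective, ?_, ?_, ?_, ?_⟩
  · intro v w hvw
    dsimp only at hvw
    by_cases hv : ∃ k, v = a k <;> by_cases hw : ∃ k, w = a k
    · rw [dif_pos hv, dif_pos hw] at hvw
      have := hs (Sum.inl_injective hvw)
      rw [hv.choose_spec, this, ← hw.choose_spec]
    · rw [dif_pos hv, dif_neg hw] at hvw
      cases hvw
    · rw [dif_neg hv, dif_pos hw] at hvw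
      cases hvw
    · rw [dif_neg hv, dif_neg hw] at hvw
      simpa using hvw
  · rintro (u | v)
    · exact Or.inl ⟨u, rfl⟩
    · refine Or.inr ⟨v.1, ?_⟩
      rw [dif_neg (fun ⟨k, hk⟩ => v.2 k hk)]
  · intro k
    rw [dif_pos ⟨k, rfl⟩, hch k]
  · intro u v huv
    by_cases hv : ∃ k, v = a k
    · rw [dif_pos hv] at huv
      exact ⟨hv.choose, Sum.inl_injective huv, hv.choose_spec⟩
    · rw [dif_neg hv] at huv
      cases huv

theorem tri_adj {V : Type*} {G : SimpleGraph V} {s : Fin 3 → V}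
    (h : IsTriangle G (s 0) (s 1) (s 2)) : ∀ i j, i ≠ j → G.Adj (s i) (s j) := by
  obtain ⟨h1, h2, h3⟩ := h
  intro i j hij
  fin_cases i <;> fin_cases j <;> first
    | exact absurd rfl hij
    | exact h1
    | exact h2
    | exact h3
    | exact h1.symm
    | exact h2.symm
    | exact h3.symm

theorem tri_inj {V : Type*} {G : SimpleGraph V} {s : Fin 3 → V}
    (h : IsTriangle G (s 0) (s 1) (s 2)) : Function.Injective s := by
  intro i j hij
  by_contra hne
  exact (tri_adj h i j hne).ne hij

theorem facial_cn {V : Type*} {G : SimpleGraph V} {s : Fin 3 → V}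
    (h : IsFacialTriangle G (s 0) (s 1) (s 2)) : Cn G {v | ∀ k, v ≠ s k} := by
  have := (cn_iff _ _).1 h.2
  convert this using 2
  ext v
  constructor
  · intro h
    exact ⟨h 0, h 1, h 2⟩
  · rintro ⟨h0, h1, h2⟩ k
    fin_cases k
    exacts [h0, h1, h2]

theorem cn_image {U W : Type*} {B : SimpleGraph U} {G : SimpleGraph W} (i : U → W)
    (hi : ∀ u v, B.Adj u v → G.Adj (i u) (i v)) {t : Set U} (ht : Cn B t) : Cn G (i '' t) := by
  rintro P ⟨_, ⟨x, hx, rfl⟩, hxP⟩ ⟨_, ⟨y, hy, rfl⟩, hyP⟩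
  obtain ⟨a, ha, b, hb, h1, h2, h3⟩ := ht (i ⁻¹' P) ⟨x, hx, hxP⟩ ⟨y, hy, hyP⟩
  exact ⟨i a, ⟨a, ha, rfl⟩, i b, ⟨b, hb, rfl⟩, h1, h2, hi _ _ h3⟩

theorem facial_transfer {U V W : Type*} {i : U → W} {j : V → W} {s : Fin 3 → U} {a : Fin 3 → V}
    (h : PO i j s a) {B : SimpleGraph U} {T : SimpleGraph V} {G : SimpleGraph W}
    (hi : ∀ u v, B.Adj u v → G.Adj (i u) (i v)) (hj : ∀ u v, T.Adj u v → G.Adj (j u) (j v))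
    (ha : IsFacialTriangle T (a 0) (a 1) (a 2)) {x y z : U} (hf : IsFacialTriangle B x y z)
    (hk : ∃ k, Att T a k ∧ s k ≠ x ∧ s k ≠ y ∧ s k ≠ z) :
    IsFacialTriangle G (i x) (i y) (i z) := by
  refine ⟨⟨hi _ _ hf.1.1, hi _ _ hf.1.2.1, hi _ _ hf.1.2.2⟩, ?_⟩
  rw [cn_iff]
  obtain ⟨k, ⟨v, hv, hva⟩, hkx⟩ := hk
  have h1 := cn_image i hi ((cn_iff _ _).1 hf.2)
  have h2 := cn_image j hj (facial_cn ha)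
  have h3 := h1.union h2 (a := i (s k)) (b := j v) ⟨s k, hkx, rfl⟩ ⟨v, hva, rfl⟩
    (by rw [h.eq]; exact hj _ _ hv)
  convert h3 using 1
  ext w
  constructor
  · rintro ⟨hx, hy, hz⟩
    have hl : (∃ u, i u = w) → w ∈ i '' {v | v ≠ x ∧ v ≠ y ∧ v ≠ z} ∪ j '' {v | ∀ k, v ≠ a k} := by
      rintro ⟨u, rfl⟩
      exact Or.inl ⟨u, ⟨fun e => hx (by rw [e]), fun e => hy (by rw [e]), fun e => hz (by rw [e])⟩,
        rfl⟩
    rcases h.cov w with hw | ⟨v, rfl⟩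
    · exact hl hw
    · by_cases hv : ∃ k, v = a k
      · obtain ⟨k, rfl⟩ := hv
        exact hl ⟨s k, h.eq k⟩
      · push Not at hv
        exact Or.inr ⟨v, hv, rfl⟩
  · rintro (⟨u, ⟨hx, hy, hz⟩, rfl⟩ | ⟨v, hv, rfl⟩)
    · exact ⟨fun e => hx (h.injI e), fun e => hy (h.injI e), fun e => hz (h.injI e)⟩
    · have : ∀ u, j v ≠ i u := by
        intro u e
        obtain ⟨k, -, hk⟩ := h.int u v e.symm
        exact hv k hk
      exact ⟨this _, this _, this _⟩

theorem glue {U V : Type} [Finite U] [Finite V] (B : SimpleGraph U) (T : SimpleGraph V)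
    (hB : B.Planar) (hT : T.Planar) (AB : U → U → Prop) (AT : V → V → Prop)
    (hAB : IsOrientation B AB) (hAT : IsOrientation T AT) (s : Fin 3 → U) (a : Fin 3 → V)
    (hs : IsFacialTriangle B (s 0) (s 1) (s 2)) (ha : IsFacialTriangle T (a 0) (a 1) (a 2))
    (hag : ∀ k l, AB (s k) (s l) ↔ AT (a k) (a l)) :
    ∃ (W : Type) (_ : Finite W) (G : SimpleGraph W) (A : W → W → Prop) (i : U → W) (j : V → W),
      G.Planar ∧ IsOrientation G A ∧ PO i j s a ∧ (∀ u v, AB u v → A (i u) (i v)) ∧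
      (∀ u v, AT u v → A (j u) (j v)) ∧
      (∀ x y z, IsFacialTriangle B x y z → (∃ k, Att T a k ∧ s k ≠ x ∧ s k ≠ y ∧ s k ≠ z) →
        IsFacialTriangle G (i x) (i y) (i z)) ∧
      (∀ x y z, IsFacialTriangle T x y z → (∃ k, Att B s k ∧ a k ≠ x ∧ a k ≠ y ∧ a k ≠ z) →
        IsFacialTriangle G (j x) (j y) (j z)) := by
  obtain ⟨W, hW, i, j, h⟩ := exists_PO s a (tri_inj hs.1) (tri_inj ha.1)
  let A : W → W → Prop := fun w w' =>
    (∃ u v, i u = w ∧ i v = w' ∧ AB u v) ∨ (∃ u v, j u = w ∧ j v = w' ∧ AT u v)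
  have hAi : ∀ u v, A (i u) (i v) ↔ AB u v := by
    intro u v
    constructor
    · rintro (⟨u', v', h1, h2, h3⟩ | ⟨u', v', h1, h2, h3⟩)
      · rwa [← h.injI h1, ← h.injI h2]
      · obtain ⟨k, rfl, rfl⟩ := h.int _ _ h1.symm
        obtain ⟨l, rfl, rfl⟩ := h.int _ _ h2.symm
        exact (hag k l).2 h3
    · intro h1
      exact Or.inl ⟨u, v, rfl, rfl, h1⟩
  have hAj : ∀ u v, A (j u) (j v) ↔ AT u v := by
    intro u v
    constructor
    · rintro (⟨u', v', h1, h2, h3⟩ | ⟨u', v', h1, h2, h3⟩)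
      · obtain ⟨k, rfl, rfl⟩ := h.int _ _ h1
        obtain ⟨l, rfl, rfl⟩ := h.int _ _ h2
        exact (hag k l).1 h3
      · rwa [← h.injJ h1, ← h.injJ h2]
    · intro h1
      exact Or.inr ⟨u, v, rfl, rfl, h1⟩
  have hanti : ∀ w w', A w w' → ¬ A w' w := by
    rintro w w' (⟨u, v, rfl, rfl, h3⟩ | ⟨u, v, rfl, rfl, h3⟩) h4
    · exact hAB.1 _ _ h3 ((hAi _ _).1 h4)
    · exact hAT.1 _ _ h3 ((hAj _ _).1 h4)
  let G : SimpleGraph W :=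
    { Adj := fun w w' => A w w' ∨ A w' w
      symm := ⟨fun _ _ => Or.symm⟩
      loopless := ⟨fun w hw => hw.elim (fun h => hanti w w h h) (fun h => hanti w w h h)⟩ }
  have hGi : ∀ u v, G.Adj (i u) (i v) ↔ B.Adj u v := fun u v => by
    rw [hAB.2]
    exact or_congr (hAi u v) (hAi v u)
  have hGj : ∀ u v, G.Adj (j u) (j v) ↔ T.Adj u v := fun u v => by
    rw [hAT.2]
    exact or_congr (hAj u v) (hAj v u)
  have hrange : Set.range i ∩ Set.range j = Set.range (i ∘ s) := by
    ext w
    constructor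
    · rintro ⟨⟨u, rfl⟩, ⟨v, hv⟩⟩
      obtain ⟨k, rfl, -⟩ := h.int u v hv.symm
      exact ⟨k, rfl⟩
    · rintro ⟨k, rfl⟩
      exact ⟨⟨s k, rfl⟩, ⟨a k, (h.eq k).symm⟩⟩
  have hadj : ∀ k l, k ≠ l → G.Adj ((i ∘ s) k) ((i ∘ s) l) := fun k l hkl =>
    (hGi _ _).2 (tri_adj hs.1 k l hkl)
  have hsep : Sep G (Set.range i) (Set.range j) := by
    refine ⟨h.cov, ?_, ?_⟩
    · intro u v h1 h2 h3 h4 h5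
      obtain ⟨k, rfl⟩ : u ∈ Set.range (i ∘ s) := hrange ▸ ⟨h1, h2⟩
      obtain ⟨l, rfl⟩ : v ∈ Set.range (i ∘ s) := hrange ▸ ⟨h3, h4⟩
      exact hadj k l (fun e => h5 (by rw [e]))
    · rintro w w' ((⟨u, v, rfl, rfl, h3⟩ | ⟨u, v, rfl, rfl, h3⟩) |
        (⟨u, v, rfl, rfl, h3⟩ | ⟨u, v, rfl, rfl, h3⟩))
      · exact Or.inr ⟨_, rfl⟩
      · exact Or.inl ⟨_, rfl⟩
      · exact Or.inr ⟨_, rfl⟩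
      · exact Or.inl ⟨_, rfl⟩
  have hcX : Cn G (Set.range i \ Set.range (i ∘ s)) := by
    convert cn_image i (fun u v => (hGi u v).2) (facial_cn hs) using 1
    ext w
    constructor
    · rintro ⟨⟨u, rfl⟩, hu⟩
      exact ⟨u, fun k hk => hu ⟨k, by rw [hk]; rfl⟩, rfl⟩
    · rintro ⟨u, hu, rfl⟩
      exact ⟨⟨u, rfl⟩, fun ⟨k, hk⟩ => hu k (h.injI hk).symm⟩
  have hcY : Cn G (Set.range j \ Set.range (i ∘ s)) := by
    convert cn_image j (fun u v => (hGj u v).2) (facial_cn ha) using 1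
    ext w
    constructor
    · rintro ⟨⟨u, rfl⟩, hu⟩
      exact ⟨u, fun k hk => hu ⟨k, by rw [hk]; exact h.eq k⟩, rfl⟩
    · rintro ⟨u, hu, rfl⟩
      exact ⟨⟨u, rfl⟩, fun ⟨k, hk⟩ => hu k (h.injJ ((h.eq k).symm.trans hk)).symm⟩
  refine ⟨W, hW, G, A, i, j, ?_, ⟨hanti, fun _ _ => Iff.rfl⟩, h, fun u v => (hAi u v).2,
    fun u v => (hAj u v).2, ?_, ?_⟩
  · exact hsep.planar (i ∘ s) hadj hrange
      ⟨fun hm => hB.1 (mod_range _ G B i h.injI (fun u v => (hGi u v).1) hm),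
        fun hm => hB.2 (mod_range _ G B i h.injI (fun u v => (hGi u v).1) hm)⟩
      ⟨fun hm => hT.1 (mod_range _ G T j h.injJ (fun u v => (hGj u v).1) hm),
        fun hm => hT.2 (mod_range _ G T j h.injJ (fun u v => (hGj u v).1) hm)⟩ hcX hcY
  · intro x y z hf hk
    exact facial_transfer h (fun u v => (hGi u v).2) (fun u v => (hGj u v).2) ha hf hk
  · intro x y z hf hk
    exact facial_transfer h.symm (fun u v => (hGj u v).2) (fun u v => (hGi u v).2) hs hf hk


/-! ### The octahedron -/

def antip : Fin 6 → Fin 6 := ![4, 5, 3, 2, 0, 1]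

def pairCls : Fin 6 → Fin 3 := ![0, 1, 2, 2, 0, 1]

def octAdj (u v : Fin 6) : Prop := u ≠ v ∧ v ≠ antip u

instance : DecidableRel octAdj := fun u v => by unfold octAdj; infer_instance

def octa : SimpleGraph (Fin 6) where
  Adj := octAdj
  symm := ⟨by decide⟩
  loopless := ⟨by decide⟩

instance : DecidableRel octa.Adj := fun u v => by
  change Decidable (octAdj u v); infer_instance

def octArcs (b1 b2 : Bool) : List (Fin 6 × Fin 6) :=
  [(0, 1), (1, 3), (3, 0), (3, 4), (4, 5), (3, 5)] ++
  (if b1 then [(1, 2), (2, 4), (4, 1)] else [(2, 1), (1, 4), (4, 2)]) ++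
  (if b2 then [(2, 0), (0, 5), (5, 2)] else [(0, 2), (2, 5), (5, 0)])

def octA (b1 b2 : Bool) (u v : Fin 6) : Prop := (u, v) ∈ octArcs b1 b2

instance (b1 b2 : Bool) : DecidableRel (octA b1 b2) := fun u v => by
  unfold octA; infer_instance

theorem octA_orient (b1 b2 : Bool) : IsOrientation octa (octA b1 b2) := by
  constructor
  · revert b1 b2
    decide
  · revert b1 b2
    decide

theorem octa_facial (x y z : Fin 6) (h1 : octa.Adj x y ∧ octa.Adj x z ∧ octa.Adj y z)
    (h2 : ∀ u v : Fin 6, (u ≠ x ∧ u ≠ y ∧ u ≠ z) → (v ≠ x ∧ v ≠ y ∧ v ≠ z) → u ≠ v →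
      octa.Adj u v) : IsFacialTriangle octa x y z := by
  refine ⟨h1, ?_⟩
  rw [cn_iff]
  rintro P ⟨u, hu, huP⟩ ⟨v, hv, hvP⟩
  exact ⟨u, hu, v, hv, huP, hvP, h2 u v hu hv (fun e => hvP (e ▸ huP))⟩

theorem octa_planar : octa.Planar := by
  rw [planar_iff]
  constructor
  · rintro ⟨f, h1, -, -, h3, h4⟩
    choose g hg using h1
    have hinj : Function.Injective g := by
      intro a b hab
      by_contra hne
      exact Set.disjoint_left.1 (h3 a b hne) (hg a) (hab ▸ hg b)
    have huniq : ∀ w x, x ∈ f w → x ≠ g w → ∀ w', x ≠ g w' := by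
      rintro w x hx hne w' rfl
      by_cases hw : w = w'
      · exact hne (by rw [hw])
      · exact Set.disjoint_left.1 (h3 w w' hw) hx (hg w')
    have hone : ∀ x y : Fin 6, (∀ w, x ≠ g w) → (∀ w, y ≠ g w) → x = y := by
      intro x y hx hy
      have hcard : (Finset.univ.image g)ᶜ.card = 1 := by
        rw [Finset.card_compl, Finset.card_image_of_injective _ hinj]
        simp
      obtain ⟨e, he⟩ := Finset.card_eq_one.1 hcard
      have hx' : x ∈ (Finset.univ.image g)ᶜ := by simpa [eq_comm] using hx
      have hy' : y ∈ (Finset.univ.image g)ᶜ := by simpa [eq_comm] using hy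
      rw [he, Finset.mem_singleton] at hx' hy'
      rw [hx', hy']
    obtain ⟨w0, hw0⟩ : ∃ w0, ∀ w, w ≠ w0 → ∀ x ∈ f w, x = g w := by
      by_cases hall : ∃ w0, ∃ x ∈ f w0, x ≠ g w0
      · obtain ⟨w0, x, hx, hxg⟩ := hall
        refine ⟨w0, fun w hw y hy => ?_⟩
        by_contra hyg
        have := hone x y (huniq w0 x hx hxg) (huniq w y hy hyg)
        subst this
        exact Set.disjoint_left.1 (h3 w w0 hw) hy hx
      · push Not at hall
        exact ⟨0, fun w _ x hx => hall w x hx⟩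
    have hpc : ∀ u v, octa.Adj u v → pairCls u ≠ pairCls v := by decide
    have hadj : ∀ w w', w ≠ w0 → w' ≠ w0 → w ≠ w' → pairCls (g w) ≠ pairCls (g w') := by
      intro w w' hw hw' hne
      obtain ⟨u, hu, v, hv, huv⟩ := h4 w w' hne
      rw [hw0 w hw u hu, hw0 w' hw' v hv] at huv
      exact hpc _ _ huv
    have hcard : Fintype.card {w : Fin 5 // w ≠ w0} ≤ Fintype.card (Fin 3) := by
      apply Fintype.card_le_of_injective (fun w => pairCls (g w.1))
      intro a b hab
      by_contra hne
      exact hadj a.1 b.1 a.2 b.2 (fun e => hne (Subtype.ext e)) hab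
    simp [Fintype.card_subtype_compl] at hcard
  · rintro ⟨f, h1, -, -, h3, h4⟩
    choose g hg using h1
    have hinj : Function.Injective g := by
      intro a b hab
      by_contra hne
      exact Set.disjoint_left.1 (h3 a b hne) (hg a) (hab ▸ hg b)
    have hsurj : Function.Surjective g :=
      ((Fintype.bijective_iff_injective_and_card g).2 ⟨hinj, by simp⟩).2
    have hf : ∀ w, ∀ x ∈ f w, x = g w := by
      intro w x hx
      obtain ⟨w', rfl⟩ := hsurj x
      by_contra hne
      exact Set.disjoint_left.1 (h3 w w' (fun e => hne (by rw [e]))) hx (hg w')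
    have hadj : ∀ i j, octa.Adj (g (Sum.inl i)) (g (Sum.inr j)) := by
      intro i j
      obtain ⟨u, hu, v, hv, huv⟩ := h4 (Sum.inl i) (Sum.inr j) (by simp)
      rwa [hf _ u hu, hf _ v hv] at huv
    have hσ : ∀ i, ∃ k, antip (g (Sum.inl i)) = g (Sum.inl k) := by
      intro i
      obtain ⟨w, hw⟩ := hsurj (antip (g (Sum.inl i)))
      rcases w with k | k
      · exact ⟨k, hw.symm⟩
      · exact absurd hw (hadj i k).2
    choose σ hσ using hσ
    have hanti : ∀ u, antip (antip u) = u ∧ antip u ≠ u := by decide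
    have hσ1 : ∀ i, σ (σ i) = i := by
      intro i
      have := (hanti (g (Sum.inl i))).1
      rw [hσ, hσ] at this
      exact Sum.inl_injective (hinj this)
    have hσ2 : ∀ i, σ i ≠ i := by
      intro i e
      have := (hanti (g (Sum.inl i))).2
      rw [hσ, e] at this
      exact this rfl
    have hd : ∀ a b c : Fin 3, (![a, b, c] (![a, b, c] 0) = 0) → (![a, b, c] (![a, b, c] 1) = 1) →
        (![a, b, c] (![a, b, c] 2) = 2) → a ≠ 0 → b ≠ 1 → c ≠ 2 → False := by decide
    have he : σ = ![σ 0, σ 1, σ 2] := by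
      funext k
      fin_cases k <;> rfl
    refine hd (σ 0) (σ 1) (σ 2) ?_ ?_ ?_ (hσ2 0) (hσ2 1) (hσ2 2)
    · rw [← he]; exact hσ1 0
    · rw [← he]; exact hσ1 1
    · rw [← he]; exact hσ1 2

/-! ### Colourings -/

/-- good colourings -/
def Good {V : Type*} (G : SimpleGraph V) (A : V → V → Prop) (c : V → Fin 2) : Prop :=
  IsAcyclicColoring A 2 c ∧ ∀ a b d : V, IsFacialTriangle G a b d → ¬ (c a = c b ∧ c b = c d)

theorem acyclic_pull {U W : Type*} {AB : U → U → Prop} {A : W → W → Prop} {c : W → Fin 2}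
    (h : IsAcyclicColoring A 2 c) (i : U → W) (hi : ∀ u v, AB u v → A (i u) (i v)) :
    IsAcyclicColoring AB 2 (c ∘ i) := by
  intro k v hv ht
  apply h k (i v) hv
  exact Relation.TransGen.lift i (fun a b ⟨h1, h2, h3⟩ => ⟨h1, h2, hi _ _ h3⟩) v v ht

theorem acyclic_tri {W : Type*} {A : W → W → Prop} {c : W → Fin 2}
    (h : IsAcyclicColoring A 2 c) {x y z : W} (h1 : A x y) (h2 : A y z) (h3 : A z x) :
    ¬ (c x = c y ∧ c y = c z) := by
  rintro ⟨e1, e2⟩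
  refine h (c x) x rfl (((Relation.TransGen.single ⟨rfl, e1.symm, h1⟩).tail
    ⟨e1.symm, (e1.trans e2).symm, h2⟩).tail ⟨(e1.trans e2).symm, rfl, h3⟩)

def Hyp : Prop := ∀ (V : Type) [Finite V] (T : SimpleGraph V), IsPlanarTriangulation T →
      ∀ A : V → V → Prop, IsOrientation T A →
        ∃ c : V → Fin 2, IsAcyclicColoring A 2 c ∧
          ∀ a b d : V, IsFacialTriangle T a b d → ¬ (c a = c b ∧ c b = c d)

theorem exists_good (H : Hyp) (V : Type) [Finite V] (hV : 3 ≤ Nat.card V) (G : SimpleGraph V)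
    (hG : G.Planar) (A : V → V → Prop) (hA : IsOrientation G A) : ∃ c, Good G A c := by
  obtain ⟨M, hGM, hM⟩ := (Set.toFinite {M : SimpleGraph V | M.Planar}).exists_le_maximal hG
  have hMt : IsPlanarTriangulation M :=
    ⟨hV, hM.1, fun K h1 h2 => le_antisymm (hM.2 h2 h1) h1⟩
  obtain ⟨n, ⟨e⟩⟩ := Finite.exists_equiv_fin V
  have hor : IsOrientation M (fun a b => A a b ∨ (M.Adj a b ∧ ¬ G.Adj a b ∧ e a < e b)) := by
    constructor
    · rintro a b (h1 | ⟨h1, h2, h3⟩) (h4 | ⟨h4, h5, h6⟩)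
      · exact hA.1 a b h1 h4
      · exact h5 ((hA.2 b a).2 (Or.inr h1))
      · exact h2 ((hA.2 a b).2 (Or.inr h4))
      · exact lt_asymm h3 h6
    · intro a b
      constructor
      · intro h
        by_cases hab : G.Adj a b
        · rcases (hA.2 a b).1 hab with h | h
          · exact Or.inl (Or.inl h)
          · exact Or.inr (Or.inl h)
        · rcases lt_or_gt_of_ne (fun h' => h.ne (e.injective h') : e a ≠ e b) with h' | h'
          · exact Or.inl (Or.inr ⟨h, hab, h'⟩)
          · exact Or.inr (Or.inr ⟨h.symm, fun h => hab h.symm, h'⟩)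
      · rintro ((h | h) | (h | h))
        · exact hGM ((hA.2 a b).2 (Or.inl h))
        · exact h.1
        · exact hGM ((hA.2 a b).2 (Or.inr h))
        · exact h.1.symm
  obtain ⟨c, hc1, hc2⟩ := H V M hMt _ hor
  refine ⟨c, acyclic_pull hc1 id (fun u v h => Or.inl h), ?_⟩
  intro a b d hf
  refine hc2 a b d ⟨⟨hGM hf.1.1, hGM hf.1.2.1, hGM hf.1.2.2⟩, ?_⟩
  exact hf.2.mono (fun x y h => hGM h)


theorem cyc_agree {U V : Type*} {AB : U → U → Prop} {AT : V → V → Prop}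
    (hB : ∀ a b, AB a b → ¬ AB b a) (hT : ∀ a b, AT a b → ¬ AT b a) (s : Fin 3 → U) (a : Fin 3 → V)
    (s1 : AB (s 0) (s 1)) (s2 : AB (s 1) (s 2)) (s3 : AB (s 2) (s 0))
    (a1 : AT (a 0) (a 1)) (a2 : AT (a 1) (a 2)) (a3 : AT (a 2) (a 0)) :
    ∀ k l, AB (s k) (s l) ↔ AT (a k) (a l) := by
  have hB' : ∀ x, ¬ AB x x := fun x h => hB x x h h
  have hT' : ∀ x, ¬ AT x x := fun x h => hT x x h h
  intro k l
  fin_cases k <;> fin_cases l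
  · exact iff_of_false (hB' _) (hT' _)
  · exact iff_of_true s1 a1
  · exact iff_of_false (hB _ _ s3) (hT _ _ a3)
  · exact iff_of_false (hB _ _ s1) (hT _ _ a1)
  · exact iff_of_false (hB' _) (hT' _)
  · exact iff_of_true s2 a2
  · exact iff_of_true s3 a3
  · exact iff_of_false (hB _ _ s2) (hT _ _ a2)
  · exact iff_of_false (hB' _) (hT' _)

theorem orient_adj {U W : Type*} {B : SimpleGraph U} {AB : U → U → Prop} {G : SimpleGraph W}
    {A : W → W → Prop} (hB : IsOrientation B AB) (hG : IsOrientation G A) (i : U → W)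
    (hi : ∀ u v, AB u v → A (i u) (i v)) : ∀ u v, B.Adj u v → G.Adj (i u) (i v) := by
  intro u v h
  rw [hG.2]
  exact ((hB.2 u v).1 h).imp (hi _ _) (hi _ _)

theorem Att.map {U W : Type*} {B : SimpleGraph U} {G : SimpleGraph W} {s : Fin 3 → U} {k : Fin 3}
    (h : Att B s k) (i : U → W) (hinj : Function.Injective i)
    (hi : ∀ u v, B.Adj u v → G.Adj (i u) (i v)) : Att G (i ∘ s) k := by
  obtain ⟨v, hv, hvs⟩ := h
  exact ⟨i v, hi _ _ hv, fun l e => hvs l (hinj e)⟩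

/-- Pulling back a good colouring along a map preserving arcs and all faces but one. -/
theorem good_pull {V W : Type*} {T : SimpleGraph V} {A : V → V → Prop} {a : Fin 3 → V}
    {G : SimpleGraph W} {A' : W → W → Prop} {c : W → Fin 2} (hc : Good G A' c) (F : V → W)
    (hF : ∀ u v, A u v → A' (F u) (F v))
    (hf : ∀ x y z, IsFacialTriangle T x y z → (∃ k, a k ≠ x ∧ a k ≠ y ∧ a k ≠ z) →
      IsFacialTriangle G (F x) (F y) (F z))
    (hS : c (F (a 1)) ≠ c (F (a 2))) : Good T A (c ∘ F) := by
  refine ⟨acyclic_pull hc.1 F hF, ?_⟩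
  rintro x y z hxyz ⟨h1, h2⟩
  by_cases hk : ∃ k, a k ≠ x ∧ a k ≠ y ∧ a k ≠ z
  · exact hc.2 _ _ _ (hf x y z hxyz hk) ⟨h1, h2⟩
  · have hall : ∀ k, c (F (a k)) = c (F x) := by
      intro k
      by_contra hne
      apply hk
      refine ⟨k, ?_, ?_, ?_⟩
      · intro e; exact hne (by rw [e])
      · intro e; exact hne (by rw [e]; exact h1.symm)
      · intro e; exact hne (by rw [e]; exact (h1.trans h2).symm)
    exact hS ((hall 1).trans (hall 2).symm)

theorem stage1 (H : Hyp) (V : Type) [Finite V] (T : SimpleGraph V) (hT : T.Planar)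
    (A : V → V → Prop) (hA : IsOrientation T A) (a : Fin 3 → V)
    (ha : IsFacialTriangle T (a 0) (a 1) (a 2))
    (a1 : A (a 0) (a 1)) (a2 : A (a 1) (a 2)) (a3 : A (a 2) (a 0))
    (hatt : Att T a 2 ∨ (Att T a 0 ∧ Att T a 1)) :
    ∃ c, Good T A c ∧ c (a 0) = c (a 1) ∧ c (a 1) ≠ c (a 2) := by
  have hQ0 : ∀ Q : Fin 3 → Prop, Q 0 → Q 2 → ∃ k, Att T a k ∧ Q k := by
    intro Q h0 h2
    rcases hatt with h | h
    · exact ⟨2, h, h2⟩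
    · exact ⟨0, h.1, h0⟩
  have hQ1 : ∀ Q : Fin 3 → Prop, Q 1 → Q 2 → ∃ k, Att T a k ∧ Q k := by
    intro Q h0 h2
    rcases hatt with h | h
    · exact ⟨2, h, h2⟩
    · exact ⟨1, h.2, h0⟩
  let s1 : Fin 3 → Fin 6 := ![0, 1, 3]
  let s2 : Fin 3 → Fin 6 := ![1, 2, 4]
  let s3 : Fin 3 → Fin 6 := ![2, 0, 5]
  have f1 : IsFacialTriangle octa (s1 0) (s1 1) (s1 2) := octa_facial _ _ _ (by decide) (by decide)
  have f2 : IsFacialTriangle octa (s2 0) (s2 1) (s2 2) := octa_facial _ _ _ (by decide) (by decide)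
  have f3 : IsFacialTriangle octa (s3 0) (s3 1) (s3 2) := octa_facial _ _ _ (by decide) (by decide)
  have t1 : ∀ k, Att octa s1 k := by
    change ∀ k, ∃ v, octa.Adj (s1 k) v ∧ ∀ l, v ≠ s1 l
    decide
  have t2 : ∀ k, Att octa s2 k := by
    change ∀ k, ∃ v, octa.Adj (s2 k) v ∧ ∀ l, v ≠ s2 l
    decide
  have t3 : ∀ k, Att octa s3 k := by
    change ∀ k, ∃ v, octa.Adj (s3 k) v ∧ ∀ l, v ≠ s3 l
    decide
  have hO := octA_orient true true
  -- first copy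
  obtain ⟨W1, _, G1, A1, i1, j1, hG1, hA1, P1, hi1, hj1, hB1, hT1⟩ := glue octa T octa_planar hT
    (octA true true) A hO hA s1 a f1 ha (cyc_agree hO.1 hA.1 s1 a (by decide) (by decide)
      (by decide) a1 a2 a3)
  have f2' : IsFacialTriangle G1 (i1 (s2 0)) (i1 (s2 1)) (i1 (s2 2)) :=
    hB1 _ _ _ f2 (hQ0 (fun k => s1 k ≠ s2 0 ∧ s1 k ≠ s2 1 ∧ s1 k ≠ s2 2) (by decide) (by decide))
  have f3' : IsFacialTriangle G1 (i1 (s3 0)) (i1 (s3 1)) (i1 (s3 2)) :=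
    hB1 _ _ _ f3 (hQ1 (fun k => s1 k ≠ s3 0 ∧ s1 k ≠ s3 1 ∧ s1 k ≠ s3 2) (by decide) (by decide))
  -- second copy
  obtain ⟨W2, _, G2, A2, i2, j2, hG2, hA2, P2, hi2, hj2, hB2, hT2⟩ := glue G1 T hG1 hT
    A1 A hA1 hA (i1 ∘ s2) a f2' ha (cyc_agree hA1.1 hA.1 (i1 ∘ s2) a (hi1 _ _ (by decide))
      (hi1 _ _ (by decide)) (hi1 _ _ (by decide)) a1 a2 a3)
  have f3'' : IsFacialTriangle G2 (i2 (i1 (s3 0))) (i2 (i1 (s3 1))) (i2 (i1 (s3 2))) := by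
    refine hB2 _ _ _ f3' (hQ0 (fun k => i1 (s2 k) ≠ i1 (s3 0) ∧ i1 (s2 k) ≠ i1 (s3 1) ∧
      i1 (s2 k) ≠ i1 (s3 2)) ?_ ?_)
    · simp only [ne_eq, P1.injI.eq_iff]
      decide
    · simp only [ne_eq, P1.injI.eq_iff]
      decide
  -- third copy
  obtain ⟨W3, _, G3, A3, i3, j3, hG3, hA3, P3, hi3, hj3, hB3, hT3⟩ := glue G2 T hG2 hT
    A2 A hA2 hA (i2 ∘ i1 ∘ s3) a f3'' ha (cyc_agree hA2.1 hA.1 (i2 ∘ i1 ∘ s3) a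
      (hi2 _ _ (hi1 _ _ (by decide)))
      (hi2 _ _ (hi1 _ _ (by decide))) (hi2 _ _ (hi1 _ _ (by decide))) a1 a2 a3)
  have hcard : 3 ≤ Nat.card W3 := by
    have := Nat.card_le_card_of_injective (j3 ∘ a) (P3.injJ.comp (tri_inj ha.1))
    simpa using this
  obtain ⟨c, hc⟩ := exists_good H W3 hcard G3 hG3 A3 hA3
  -- faces of the copies
  have n12 : ∀ k, (∀ m, s2 k ≠ s1 m) → ∀ x, i1 (s2 k) ≠ j1 x := by
    intro k hk x e
    obtain ⟨m, h, -⟩ := P1.int _ _ e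
    exact hk m h
  have n13 : ∀ k, (∀ m, s3 k ≠ s1 m) → ∀ x, i2 (i1 (s3 k)) ≠ i2 (j1 x) := by
    intro k hk x e
    obtain ⟨m, h, -⟩ := P1.int _ _ (P2.injI e)
    exact hk m h
  have n23 : ∀ k, (∀ m, s3 k ≠ s2 m) → ∀ x, i2 (i1 (s3 k)) ≠ j2 x := by
    intro k hk x e
    obtain ⟨m, h, -⟩ := P2.int _ _ e
    exact hk m (P1.injI h)
  have F1 : ∀ x y z, IsFacialTriangle T x y z → (∃ k, a k ≠ x ∧ a k ≠ y ∧ a k ≠ z) →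
      IsFacialTriangle G3 (i3 (i2 (j1 x))) (i3 (i2 (j1 y))) (i3 (i2 (j1 z))) := by
    rintro x y z hf ⟨k, hk⟩
    have h1 := hT1 x y z hf ⟨k, t1 k, hk⟩
    have m1 := n12 1 (by decide)
    have m2 := n12 2 (by decide)
    have h2 := hB2 _ _ _ h1 (hQ1 (fun k => i1 (s2 k) ≠ j1 x ∧ i1 (s2 k) ≠ j1 y ∧ i1 (s2 k) ≠ j1 z)
      ⟨m1 x, m1 y, m1 z⟩ ⟨m2 x, m2 y, m2 z⟩)
    have m1 := n13 0 (by decide)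
    have m2 := n13 2 (by decide)
    exact hB3 _ _ _ h2 (hQ0 (fun k => i2 (i1 (s3 k)) ≠ i2 (j1 x) ∧ i2 (i1 (s3 k)) ≠ i2 (j1 y) ∧
      i2 (i1 (s3 k)) ≠ i2 (j1 z)) ⟨m1 x, m1 y, m1 z⟩ ⟨m2 x, m2 y, m2 z⟩)
  have F2 : ∀ x y z, IsFacialTriangle T x y z → (∃ k, a k ≠ x ∧ a k ≠ y ∧ a k ≠ z) →
      IsFacialTriangle G3 (i3 (j2 x)) (i3 (j2 y)) (i3 (j2 z)) := by
    rintro x y z hf ⟨k, hk⟩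
    have h1 := hT2 x y z hf ⟨k, (t2 k).map i1 P1.injI (orient_adj hO hA1 i1 hi1), hk⟩
    have m1 := n23 1 (by decide)
    have m2 := n23 2 (by decide)
    exact hB3 _ _ _ h1 (hQ1 (fun k => i2 (i1 (s3 k)) ≠ j2 x ∧ i2 (i1 (s3 k)) ≠ j2 y ∧
      i2 (i1 (s3 k)) ≠ j2 z) ⟨m1 x, m1 y, m1 z⟩ ⟨m2 x, m2 y, m2 z⟩)
  have F3 : ∀ x y z, IsFacialTriangle T x y z → (∃ k, a k ≠ x ∧ a k ≠ y ∧ a k ≠ z) →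
      IsFacialTriangle G3 (j3 x) (j3 y) (j3 z) := by
    rintro x y z hf ⟨k, hk⟩
    exact hT3 x y z hf ⟨k, ((t3 k).map i1 P1.injI (orient_adj hO hA1 i1 hi1)).map i2 P2.injI
      (orient_adj hA1 hA2 i2 hi2), hk⟩
  have fin : ∀ F : V → W3, (∀ u v, A u v → A3 (F u) (F v)) →
      (∀ x y z, IsFacialTriangle T x y z → (∃ k, a k ≠ x ∧ a k ≠ y ∧ a k ≠ z) →
      IsFacialTriangle G3 (F x) (F y) (F z)) → c (F (a 0)) = c (F (a 1)) →
      ∃ c, Good T A c ∧ c (a 0) = c (a 1) ∧ c (a 1) ≠ c (a 2) := by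
    intro F h1 h2 h3
    have h4 : c (F (a 1)) ≠ c (F (a 2)) := fun h4 =>
      acyclic_tri hc.1 (h1 _ _ a1) (h1 _ _ a2) (h1 _ _ a3) ⟨h3, h4⟩
    exact ⟨c ∘ F, good_pull hc F h1 h2 h4, h3, h4⟩
  have e10 : j1 (a 0) = i1 0 := (P1.eq 0).symm
  have e11 : j1 (a 1) = i1 1 := (P1.eq 1).symm
  have e20 : j2 (a 0) = i2 (i1 1) := (P2.eq 0).symm
  have e21 : j2 (a 1) = i2 (i1 2) := (P2.eq 1).symm
  have e30 : j3 (a 0) = i3 (i2 (i1 2)) := (P3.eq 0).symm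
  have e31 : j3 (a 1) = i3 (i2 (i1 0)) := (P3.eq 1).symm
  have pig : ∀ x y z : Fin 2, x = y ∨ y = z ∨ z = x := by decide
  rcases pig (c (i3 (i2 (i1 0)))) (c (i3 (i2 (i1 1)))) (c (i3 (i2 (i1 2)))) with h | h | h
  · exact fin (fun x => i3 (i2 (j1 x))) (fun u v h => hi3 _ _ (hi2 _ _ (hj1 _ _ h))) F1
      (by rw [e10, e11]; exact h)
  · exact fin (fun x => i3 (j2 x)) (fun u v h => hi3 _ _ (hj2 _ _ h)) F2
      (by rw [e20, e21]; exact h)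
  · exact fin j3 hj3 F3 (by rw [e30, e31]; exact h)

theorem stage2 (H : Hyp) (V : Type) [Finite V] (T : SimpleGraph V) (hT : T.Planar)
    (A : V → V → Prop) (hA : IsOrientation T A) (a : Fin 3 → V)
    (ha : IsFacialTriangle T (a 0) (a 1) (a 2))
    (a1 : A (a 0) (a 1)) (hatt : Att T a 2) :
    ∃ c, Good T A c ∧ c (a 0) = c (a 1) ∧ c (a 1) ≠ c (a 2) := by
  classical
  let s : Fin 3 → Fin 6 := ![0, 1, 2]
  obtain ⟨b1, hb1⟩ : ∃ b1 : Bool, A (a 1) (a 2) ↔ b1 = true := ⟨decide (A (a 1) (a 2)), by simp⟩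
  obtain ⟨b2, hb2⟩ : ∃ b2 : Bool, A (a 2) (a 0) ↔ b2 = true := ⟨decide (A (a 2) (a 0)), by simp⟩
  have hb1' : A (a 2) (a 1) ↔ b1 = false := by
    have h1 := hA.1 (a 1) (a 2)
    have h2 := (hA.2 (a 1) (a 2)).1 ha.1.2.2
    rw [← Bool.not_eq_true, ← hb1]
    tauto
  have hb2' : A (a 0) (a 2) ↔ b2 = false := by
    have h1 := hA.1 (a 0) (a 2)
    have h2 := (hA.2 (a 0) (a 2)).1 ha.1.2.1
    rw [← Bool.not_eq_true, ← hb2]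
    tauto
  have hO := octA_orient b1 b2
  have f0 : IsFacialTriangle octa (s 0) (s 1) (s 2) := octa_facial _ _ _ (by decide) (by decide)
  have hag : ∀ k l, octA b1 b2 (s k) (s l) ↔ A (a k) (a l) := by
    have hT' : ∀ x, ¬ A x x := fun x h => hA.1 x x h h
    intro k l
    fin_cases k <;> fin_cases l
    · exact iff_of_false (by clear hb1 hb2 hb1' hb2' hO; revert b1 b2; decide) (hT' _)
    · exact iff_of_true (by clear hb1 hb2 hb1' hb2' hO; revert b1 b2; decide) a1
    · refine Iff.trans ?_ hb2'.symm
      clear hb1 hb2 hb1' hb2' hO; revert b1 b2; decide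
    · exact iff_of_false (by clear hb1 hb2 hb1' hb2' hO; revert b1 b2; decide) (hA.1 _ _ a1)
    · exact iff_of_false (by clear hb1 hb2 hb1' hb2' hO; revert b1 b2; decide) (hT' _)
    · refine Iff.trans ?_ hb1.symm
      clear hb1 hb2 hb1' hb2' hO; revert b1 b2; decide
    · refine Iff.trans ?_ hb2.symm
      clear hb1 hb2 hb1' hb2' hO; revert b1 b2; decide
    · refine Iff.trans ?_ hb1'.symm
      clear hb1 hb2 hb1' hb2' hO; revert b1 b2; decide
    · exact iff_of_false (by clear hb1 hb2 hb1' hb2' hO; revert b1 b2; decide) (hT' _)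
  obtain ⟨W, _, G, A', i, j, hG, hA', P, hi, hj, hB, hT1⟩ := glue octa T octa_planar hT
    (octA b1 b2) A hO hA s a f0 ha hag
  let d : Fin 3 → Fin 6 := ![0, 1, 3]
  have fd : IsFacialTriangle octa (d 0) (d 1) (d 2) := octa_facial _ _ _ (by decide) (by decide)
  have fq : IsFacialTriangle octa 3 4 5 := octa_facial _ _ _ (by decide) (by decide)
  have fd' : IsFacialTriangle G (i (d 0)) (i (d 1)) (i (d 2)) :=
    hB _ _ _ fd ⟨2, hatt, by decide⟩
  have fq' : IsFacialTriangle G (i 3) (i 4) (i 5) := hB _ _ _ fq ⟨2, hatt, by decide⟩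
  have td : Att octa d 2 := by
    change ∃ v, octa.Adj (d 2) v ∧ ∀ l, v ≠ d l
    decide
  have arcs : octA b1 b2 0 1 ∧ octA b1 b2 1 3 ∧ octA b1 b2 3 0 := by
    clear hb1 hb2 hb1' hb2' hO hag hi; revert b1 b2; decide
  have arcs1 : (octA b1 b2 1 2 ∧ octA b1 b2 2 4 ∧ octA b1 b2 4 1) ∨
      (octA b1 b2 2 1 ∧ octA b1 b2 1 4 ∧ octA b1 b2 4 2) := by
    clear hb1 hb2 hb1' hb2' hO hag hi; revert b1 b2; decide
  have arcs2 : (octA b1 b2 2 0 ∧ octA b1 b2 0 5 ∧ octA b1 b2 5 2) ∨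
      (octA b1 b2 0 2 ∧ octA b1 b2 2 5 ∧ octA b1 b2 5 0) := by
    clear hb1 hb2 hb1' hb2' hO hag hi; revert b1 b2; decide
  obtain ⟨c, hc, h01, h13⟩ := stage1 H W G hG A' hA' (i ∘ d) fd' (hi _ _ arcs.1) (hi _ _ arcs.2.1)
    (hi _ _ arcs.2.2) (Or.inl (td.map i P.injI (orient_adj hO hA' i hi)))
  replace h01 : c (i 0) = c (i 1) := h01
  replace h13 : c (i 1) ≠ c (i 3) := h13
  have h12 : c (i 1) ≠ c (i 2) := by
    intro h12
    have h4 : c (i 4) ≠ c (i 1) := by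
      intro h4
      rcases arcs1 with ⟨h, h', h''⟩ | ⟨h, h', h''⟩
      · exact acyclic_tri hc.1 (hi _ _ h) (hi _ _ h') (hi _ _ h'') ⟨h12, by rw [h4, h12]⟩
      · exact acyclic_tri hc.1 (hi _ _ h) (hi _ _ h') (hi _ _ h'') ⟨h12.symm, by rw [h4]⟩
    have h5 : c (i 5) ≠ c (i 1) := by
      intro h5
      rcases arcs2 with ⟨h, h', h''⟩ | ⟨h, h', h''⟩
      · exact acyclic_tri hc.1 (hi _ _ h) (hi _ _ h') (hi _ _ h'')
          ⟨by rw [← h12, h01], by rw [h5, h01]⟩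
      · exact acyclic_tri hc.1 (hi _ _ h) (hi _ _ h') (hi _ _ h'')
          ⟨by rw [← h12, h01], by rw [h5, h12]⟩
    have hd : ∀ x y z w : Fin 2, x ≠ y → z ≠ x → w ≠ x → y = z ∧ z = w := by decide
    exact hc.2 _ _ _ fq' (hd _ _ _ _ h13 h4 h5)
  have e0 : j (a 0) = i 0 := (P.eq 0).symm
  have e1 : j (a 1) = i 1 := (P.eq 1).symm
  have e2 : j (a 2) = i 2 := (P.eq 2).symm
  have t0 : ∀ k, Att octa s k := by
    change ∀ k, ∃ v, octa.Adj (s k) v ∧ ∀ l, v ≠ s l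
    decide
  refine ⟨c ∘ j, good_pull (a := a) hc j hj ?_ (by rw [e1, e2]; exact h12), ?_, ?_⟩
  · rintro x y z hf ⟨k, hk⟩
    exact hT1 x y z hf ⟨k, t0 k, hk⟩
  · change c (j (a 0)) = c (j (a 1))
    rw [e0, e1, h01]
  · change c (j (a 1)) ≠ c (j (a 2))
    rw [e1, e2]
    exact h12


/-! ### Degenerate cases and conclusion -/

theorem acyc_mono {V : Type*} {A A' : V → V → Prop} {X Y : Set V} (h : AcyclicOn A' Y)
    (hXY : X ⊆ Y) (hA : ∀ u ∈ X, ∀ v ∈ X, A u v → A' u v) : AcyclicOn A X := by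
  intro v hv ht
  exact h v (hXY hv) (Relation.TransGen.lift id
    (fun a b ⟨h1, h2, h3⟩ => ⟨hXY h1, hXY h2, hA a h1 b h2 h3⟩) v v ht)

theorem acyc_out {V : Type*} {A : V → V → Prop} {X : Set V} {u : V}
    (hu : ∀ v ∈ X, ¬ A u v) (h : AcyclicOn A (X \ {u})) : AcyclicOn A X := by
  have key : ∀ v w, Relation.TransGen (fun a b => a ∈ X ∧ b ∈ X ∧ A a b) v w →
      v ≠ u ∧ (w = u ∨
        Relation.TransGen (fun a b => a ∈ X \ {u} ∧ b ∈ X \ {u} ∧ A a b) v w) := by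
    intro v w ht
    induction ht with
    | single h1 =>
      rename_i b
      have hv : v ≠ u := by rintro rfl; exact hu _ h1.2.1 h1.2.2
      refine ⟨hv, ?_⟩
      by_cases hb : b = u
      · exact Or.inl hb
      · exact Or.inr (.single ⟨⟨h1.1, hv⟩, ⟨h1.2.1, hb⟩, h1.2.2⟩)
    | tail h1 h2 ih =>
      rename_i b d
      refine ⟨ih.1, ?_⟩
      have hb : b ≠ u := by rintro rfl; exact hu _ h2.2.1 h2.2.2
      by_cases hd : d = u
      · exact Or.inl hd
      · exact Or.inr (.tail (ih.2.resolve_left hb) ⟨⟨h2.1, hb⟩, ⟨h2.2.1, hd⟩, h2.2.2⟩)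
  intro v hv ht
  obtain ⟨h1, h2⟩ := key v v ht
  exact h v ⟨hv, h1⟩ (h2.resolve_left h1)

theorem acyc_swap {V : Type*} {A : V → V → Prop} {X : Set V} (h : AcyclicOn A X) :
    AcyclicOn (fun a b => A b a) X := by
  intro v hv ht
  apply h v hv
  rw [← Relation.transGen_swap]
  exact Relation.TransGen.lift id (fun a b ⟨h1, h2, h3⟩ => ⟨h2, h1, h3⟩) v v ht

theorem acyc_in {V : Type*} {A : V → V → Prop} {X : Set V} {u : V}
    (hu : ∀ v ∈ X, ¬ A v u) (h : AcyclicOn A (X \ {u})) : AcyclicOn A X :=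
  acyc_swap (acyc_out (A := fun a b => A b a) hu (acyc_swap h))

theorem acyc_low {V : Type*} {A : V → V → Prop} (hA : ∀ a b, A a b → ¬ A b a) {X : Set V}
    (x y z : V) (hn : ∀ v, A x v ∨ A v x → v = y ∨ v = z) (hX : x ∉ X ∨ y ∉ X ∨ z ∉ X)
    (h : AcyclicOn A (X \ {x})) : AcyclicOn A X := by
  by_cases hx : x ∈ X
  · by_cases ho : ∀ v ∈ X, ¬ A x v
    · exact acyc_out ho h
    · push Not at ho
      obtain ⟨v, hv, hxv⟩ := ho
      refine acyc_in ?_ h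
      intro w hw hwx
      have e1 := hn v (Or.inl hxv)
      have e2 := hn w (Or.inr hwx)
      have : v = w := by
        rcases e1 with rfl | rfl <;> rcases e2 with rfl | rfl <;> tauto
      subst this
      exact hA _ _ hxv hwx
  · rwa [Set.diff_singleton_eq_self hx] at h

theorem natt {V : Type*} {T : SimpleGraph V} {a : Fin 3 → V} {k : Fin 3} (h : ¬ Att T a k) :
    ∀ v, T.Adj (a k) v → v = a 0 ∨ v = a 1 ∨ v = a 2 := by
  intro v hv
  by_contra hne
  push Not at hne
  apply h
  refine ⟨v, hv, fun l => ?_⟩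
  fin_cases l
  · exact hne.1
  · exact hne.2.1
  · exact hne.2.2

theorem low_two (H : Hyp) (V : Type) [Finite V] (T : SimpleGraph V) (hT : T.Planar)
    (A : V → V → Prop) (hA : IsOrientation T A) (a : Fin 3 → V)
    (ha : IsFacialTriangle T (a 0) (a 1) (a 2)) (h0 : ¬ Att T a 0) (h2 : ¬ Att T a 2) :
    ∃ c, Good T A c ∧ c (a 0) = c (a 1) ∧ c (a 1) ≠ c (a 2) := by
  classical
  have hinj := tri_inj ha.1
  have hcard : 3 ≤ Nat.card V := by
    have := Nat.card_le_card_of_injective a hinj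
    simpa using this
  have h01 : a 0 ≠ a 1 := ha.1.1.ne
  have h02 : a 0 ≠ a 2 := ha.1.2.1.ne
  have h12 : a 1 ≠ a 2 := ha.1.2.2.ne
  obtain ⟨c0, hc0⟩ := exists_good H V hcard T hT A hA
  have hadj : ∀ u v, A u v ∨ A v u → T.Adj u v := fun u v h => (hA.2 u v).2 h
  have n0 : ∀ v, T.Adj (a 0) v → v = a 1 ∨ v = a 2 := by
    intro v hv
    rcases natt h0 v hv with e | e
    · exact absurd e.symm hv.ne
    · exact e
  have n2 : ∀ v, T.Adj (a 2) v → v = a 0 ∨ v = a 1 := by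
    intro v hv
    rcases natt h2 v hv with e | e | e
    · exact Or.inl e
    · exact Or.inr e
    · exact absurd e.symm hv.ne
  let q := c0 (a 1)
  let c : V → Fin 2 := fun v => if v = a 2 then 1 - q else if v = a 0 then q else c0 v
  have hq : ∀ x : Fin 2, x ≠ 1 - x := by decide
  have e2 : c (a 2) = 1 - q := by simp [c]
  have e0 : c (a 0) = q := by simp [c, h02]
  have e1 : c (a 1) = q := by simp [c, h12, h01.symm, q]
  have eo : ∀ v, v ≠ a 2 → v ≠ a 0 → c v = c0 v := by
    intro v hv hv'
    simp [c, hv, hv']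
  have hne : c (a 1) ≠ c (a 2) := by rw [e1, e2]; exact hq q
  refine ⟨c, ⟨?_, ?_⟩, by rw [e0, e1], hne⟩
  · intro i
    have hS : a 1 ∉ {v | c v = i} ∨ a 2 ∉ {v | c v = i} := by
      by_contra hh
      push Not at hh
      exact hne (hh.1.trans hh.2.symm)
    refine acyc_low hA.1 (a 2) (a 0) (a 1) (fun v h => n2 v (hadj _ _ h)) (by tauto) ?_
    refine acyc_low hA.1 (a 0) (a 1) (a 2) (fun v h => n0 v (hadj _ _ h)) (by simp) ?_
    refine acyc_mono (hc0.1 i) ?_ (fun _ _ _ _ h => h)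
    rintro v ⟨⟨hv, hv2⟩, hv0⟩
    have : c v = i := hv
    rw [eo v hv2 hv0] at this
    exact this
  · rintro x y z hf ⟨hxy, hyz⟩
    have hsub : ∀ u v w, T.Adj u v → T.Adj u w → T.Adj v w → c u = c v → c u = c w →
        u ≠ a 2 ∧ u ≠ a 0 := by
      intro u v w huv huw hvw cv cw
      constructor
      · rintro rfl
        rcases n2 v huv with rfl | rfl
        · exact hne (by rw [cv, e0, e1])
        · exact hne cv.symm
      · rintro rfl
        have hvw' := hvw.ne
        rcases n0 v huv with rfl | rfl <;> rcases n0 w huw with rfl | rfl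
        · exact hvw' rfl
        · exact hne (cv.symm.trans cw)
        · exact hne (cw.symm.trans cv)
        · exact hvw' rfl
    obtain ⟨⟨t1, t2, t3⟩, -⟩ := id hf
    have gx := hsub x y z t1 t2 t3 hxy (hxy.trans hyz)
    have gy := hsub y x z t1.symm t3 t2 hxy.symm hyz
    have gz := hsub z x y t2.symm t3.symm t1 (hxy.trans hyz).symm hyz.symm
    rw [eo x gx.1 gx.2, eo y gy.1 gy.2] at hxy
    rw [eo y gy.1 gy.2, eo z gz.1 gz.2] at hyz
    exact hc0.2 x y z hf ⟨hxy, hyz⟩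

theorem facial_swap {V : Type*} {T : SimpleGraph V} {x y z : V} (h : IsFacialTriangle T x y z) :
    IsFacialTriangle T y x z := by
  refine ⟨⟨h.1.1.symm, h.1.2.2, h.1.2.1⟩, ?_⟩
  have e : {v | v ≠ y ∧ v ≠ x ∧ v ≠ z} = {v | v ≠ x ∧ v ≠ y ∧ v ≠ z} := by
    ext v; simp only [Set.mem_setOf_eq]; tauto
  rw [e]
  exact h.2

theorem facial_rot {V : Type*} {T : SimpleGraph V} {x y z : V} (h : IsFacialTriangle T x y z) :
    IsFacialTriangle T y z x := by
  refine ⟨⟨h.1.2.2, h.1.1.symm, h.1.2.1.symm⟩, ?_⟩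
  have e : {v | v ≠ y ∧ v ≠ z ∧ v ≠ x} = {v | v ≠ x ∧ v ≠ y ∧ v ≠ z} := by
    ext v; simp only [Set.mem_setOf_eq]; tauto
  rw [e]
  exact h.2

theorem att_swap {V : Type*} {T : SimpleGraph V} {a : Fin 3 → V} :
    (Att T ![a 1, a 0, a 2] 0 → Att T a 1) ∧ (Att T ![a 1, a 0, a 2] 2 → Att T a 2) := by
  constructor
  · rintro ⟨v, hv, h⟩
    refine ⟨v, hv, fun l => ?_⟩
    fin_cases l
    · exact h 1
    · exact h 0
    · exact h 2
  · rintro ⟨v, hv, h⟩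
    refine ⟨v, hv, fun l => ?_⟩
    fin_cases l
    · exact h 1
    · exact h 0
    · exact h 2

theorem core (H : Hyp) (V : Type) [Finite V] (T : SimpleGraph V) (hT : T.Planar)
    (A : V → V → Prop) (hA : IsOrientation T A) (a : Fin 3 → V)
    (ha : IsFacialTriangle T (a 0) (a 1) (a 2)) (a1 : A (a 0) (a 1)) :
    ∃ c, Good T A c ∧ c (a 0) = c (a 1) ∧ c (a 1) ≠ c (a 2) := by
  by_cases h2 : Att T a 2
  · exact stage2 H V T hT A hA a ha a1 h2
  by_cases h0 : Att T a 0
  swap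
  · exact low_two H V T hT A hA a ha h0 h2
  by_cases h1 : Att T a 1
  swap
  · obtain ⟨c, hc, e1, e2⟩ := low_two H V T hT A hA ![a 1, a 0, a 2] (facial_swap ha)
      (fun h => h1 (att_swap.1 h)) (fun h => h2 (att_swap.2 h))
    replace e1 : c (a 1) = c (a 0) := e1
    replace e2 : c (a 0) ≠ c (a 2) := e2
    exact ⟨c, hc, e1.symm, e1 ▸ e2⟩
  have h01 : a 0 ≠ a 1 := ha.1.1.ne
  have h02 : a 0 ≠ a 2 := ha.1.2.1.ne
  have h12 : a 1 ≠ a 2 := ha.1.2.2.ne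
  have n2 : ∀ v, T.Adj (a 2) v → v = a 0 ∨ v = a 1 := by
    intro v hv
    rcases natt h2 v hv with e | e | e
    · exact Or.inl e
    · exact Or.inr e
    · exact absurd e.symm hv.ne
  let A' : V → V → Prop := fun x y =>
    (A x y ∧ x ≠ a 2 ∧ y ≠ a 2) ∨ (x = a 1 ∧ y = a 2) ∨ (x = a 2 ∧ y = a 0)
  have hA' : IsOrientation T A' := by
    constructor
    · rintro x y (⟨h, hx, hy⟩ | ⟨rfl, rfl⟩ | ⟨rfl, rfl⟩)
      · rintro (⟨h', -⟩ | ⟨-, e⟩ | ⟨e, -⟩)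
        · exact hA.1 _ _ h h'
        · exact hx e
        · exact hy e
      · rintro (⟨-, e, -⟩ | ⟨e, -⟩ | ⟨-, e⟩)
        · exact e rfl
        · exact h12 e.symm
        · exact h01 e.symm
      · rintro (⟨-, -, e⟩ | ⟨e, -⟩ | ⟨e, -⟩)
        · exact e rfl
        · exact h01 e
        · exact h02 e
    · intro x y
      constructor
      · intro h
        by_cases hx : x = a 2
        · subst hx
          rcases n2 y h with rfl | rfl
          · exact Or.inl (Or.inr (Or.inr ⟨rfl, rfl⟩))
          · exact Or.inr (Or.inr (Or.inl ⟨rfl, rfl⟩))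
        by_cases hy : y = a 2
        · subst hy
          rcases n2 x h.symm with rfl | rfl
          · exact Or.inr (Or.inr (Or.inr ⟨rfl, rfl⟩))
          · exact Or.inl (Or.inr (Or.inl ⟨rfl, rfl⟩))
        rcases (hA.2 x y).1 h with h | h
        · exact Or.inl (Or.inl ⟨h, hx, hy⟩)
        · exact Or.inr (Or.inl ⟨h, hy, hx⟩)
      · have hh : ∀ x y, A' x y → T.Adj x y := by
          rintro x y (⟨h, -⟩ | ⟨rfl, rfl⟩ | ⟨rfl, rfl⟩)
          · exact (hA.2 _ _).2 (Or.inl h)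
          · exact ha.1.2.2
          · exact ha.1.2.1.symm
        rintro (h | h)
        · exact hh _ _ h
        · exact (hh _ _ h).symm
  obtain ⟨c, hc, e1, e2⟩ := stage1 H V T hT A' hA' a ha (Or.inl ⟨a1, h02, h12⟩)
    (Or.inr (Or.inl ⟨rfl, rfl⟩)) (Or.inr (Or.inr ⟨rfl, rfl⟩)) (Or.inr ⟨h0, h1⟩)
  refine ⟨c, ⟨?_, hc.2⟩, e1, e2⟩
  intro i
  have hS : a 1 ∉ {v | c v = i} ∨ a 2 ∉ {v | c v = i} := by
    by_contra hh
    push Not at hh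
    exact e2 (hh.1.trans hh.2.symm)
  refine acyc_low hA.1 (a 2) (a 0) (a 1) (fun v h => n2 v ((hA.2 _ _).2 h)) (by tauto) ?_
  refine acyc_mono (hc.1 i) Set.diff_subset ?_
  intro u hu v hv huv
  exact Or.inl ⟨huv, hu.2, hv.2⟩

theorem good_swap {V : Type*} {T : SimpleGraph V} {A : V → V → Prop} {c : V → Fin 2}
    (h : Good T A c) : Good T A (fun v => 1 - c v) := by
  have hd : ∀ x y : Fin 2, 1 - x = 1 - y → x = y := by decide
  have hd' : ∀ x y : Fin 2, 1 - x = y → x = 1 - y := by decide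
  refine ⟨fun i => ?_, ?_⟩
  · refine acyc_mono (h.1 (1 - i)) ?_ (fun _ _ _ _ h => h)
    intro v hv
    exact hd' _ _ hv
  · rintro x y z hf ⟨h1, h2⟩
    exact h.2 x y z hf ⟨hd _ _ h1, hd _ _ h2⟩

theorem core3 (H : Hyp) (V : Type) [Finite V] (T : SimpleGraph V) (hT : T.Planar)
    (A : V → V → Prop) (hA : IsOrientation T A) (x y z : V)
    (ha : IsFacialTriangle T x y z) (p q : Fin 2) (hpq : p ≠ q) :
    ∃ c, Good T A c ∧ c x = p ∧ c y = p ∧ c z = q := by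
  obtain ⟨c, hc, e1, e2⟩ : ∃ c, Good T A c ∧ c x = c y ∧ c y ≠ c z := by
    rcases (hA.2 x y).1 ha.1.1 with h | h
    · exact core H V T hT A hA ![x, y, z] ha h
    · obtain ⟨c, hc, e1, e2⟩ := core H V T hT A hA ![y, x, z] (facial_swap ha) h
      replace e1 : c y = c x := e1
      replace e2 : c x ≠ c z := e2
      exact ⟨c, hc, e1.symm, e1 ▸ e2⟩
  have hd : ∀ u v w p q : Fin 2, u = v → v ≠ w → p ≠ q → (u = p ∧ v = p ∧ w = q) ∨
      (1 - u = p ∧ 1 - v = p ∧ 1 - w = q) := by decide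
  rcases hd _ _ _ p q e1 e2 hpq with h | h
  · exact ⟨c, hc, h⟩
  · exact ⟨_, good_swap hc, h⟩

theorem main (H : Hyp) (V : Type) [Finite V] (T : SimpleGraph V) (hT : T.Planar)
    (A : V → V → Prop) (hA : IsOrientation T A) (x y z : V)
    (ha : IsFacialTriangle T x y z) (p q r : Fin 2) (hp : ¬ (p = q ∧ q = r)) :
    ∃ c, Good T A c ∧ c x = p ∧ c y = q ∧ c z = r := by
  have hd : ∀ p q r : Fin 2, ¬ (p = q ∧ q = r) →
      (p = q ∧ p ≠ r) ∨ (q = r ∧ q ≠ p) ∨ (r = p ∧ r ≠ q) := by decide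
  rcases hd p q r hp with ⟨rfl, h⟩ | ⟨rfl, h⟩ | ⟨rfl, h⟩
  · exact core3 H V T hT A hA x y z ha _ _ h
  · obtain ⟨c, hc, h1, h2, h3⟩ := core3 H V T hT A hA y z x (facial_rot ha) _ _ h
    exact ⟨c, hc, h3, h1, h2⟩
  · obtain ⟨c, hc, h1, h2, h3⟩ := core3 H V T hT A hA z x y (facial_rot (facial_rot ha)) _ _ h
    exact ⟨c, hc, h2, h3, h1⟩

end P10
/-- from acyclic 2-colourings of oriented triangulations without
monochromatic facial triangles one gets such colourings extending any non-monochromatic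
pre-colouring of a facial triangle. -/
theorem stmt_10
    (H : ∀ (V : Type) [Finite V] (T : SimpleGraph V), IsPlanarTriangulation T →
      ∀ A : V → V → Prop, IsOrientation T A →
        ∃ c : V → Fin 2, IsAcyclicColoring A 2 c ∧
          ∀ a b d : V, IsFacialTriangle T a b d → ¬ (c a = c b ∧ c b = c d))
    (V : Type) [Finite V] (T : SimpleGraph V) (hT : IsPlanarTriangulation T)
    (a₁ a₂ a₃ : V) (ht : IsFacialTriangle T a₁ a₂ a₃)
    (p₁ p₂ p₃ : Fin 2) (hp : ¬ (p₁ = p₂ ∧ p₂ = p₃))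
    (A : V → V → Prop) (hA : IsOrientation T A) :
    ∃ c : V → Fin 2, IsAcyclicColoring A 2 c ∧
      (∀ a b d : V, IsFacialTriangle T a b d → ¬ (c a = c b ∧ c b = c d)) ∧
      c a₁ = p₁ ∧ c a₂ = p₂ ∧ c a₃ = p₃ := by
  obtain ⟨c, hc, h⟩ := P10.main H V T hT.2.1 A hA a₁ a₂ a₃ ht p₁ p₂ p₃ hp
  exact ⟨c, hc.1, hc.2, h⟩
end
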